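/- arXiv:1304.5342 — 4 statements merged into one kernel-verified Lean document; each statement's English description precedes it below -/
import Mathlib

section
/- Let G be a connected finite simple graph with at least 3 vertices. Then for every prime power q and every finite field 𝔽_q with q elements, the point count [X_G]_q is divisible by q². -/
open scoped Classical
open Matrix

/-- The graph polynomial (Kirchhoff polynomial) of a finite simple graph `G`:
`Ψ_G = Σ_T Π_{e ∉ T} x_e`, summed over spanning trees `T` of `G`. -/
noncomputable def graphPoly {V : Type*} [Fintype V] (G : SimpleGraph V) :
    MvPolynomial G.edgeSet ℤ :=
  letI : Fintype G.edgeSet := Fintype.ofFinite _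
  ∑ T : Finset G.edgeSet,
    if (SimpleGraph.fromEdgeSet (Subtype.val '' (T : Set G.edgeSet))).IsTree then
      ∏ e ∈ Tᶜ, MvPolynomial.X e
    else 0

/-- `[X_G]_q`: the number of points `x ∈ K^{E(G)}` with `Ψ_G(x) = 0`. -/
noncomputable def Xcount {V : Type*} [Fintype V] (G : SimpleGraph V)
    (K : Type*) [CommRing K] : ℕ :=
  Nat.card {x : G.edgeSet → K // MvPolynomial.aeval x (graphPoly G) = 0}

set_option linter.unusedSectionVars false
set_option linter.unusedSimpArgs false
section Lin
variable {ι : Type*} [Fintype ι] [DecidableEq ι] {K : Type*} [Field K]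

/-- Replace row and column `i` by the unit vector. -/
def rr (i : ι) (A : Matrix ι ι K) : Matrix ι ι K :=
  (A.updateRow i (Pi.single i 1)).updateCol i (Pi.single i 1)

theorem det_rr (i : ι) (A : Matrix ι ι K) :
    (rr i A).det = (A.updateRow i (Pi.single i 1)).det := by
  unfold rr
  set B := A.updateRow i (Pi.single i 1) with hB
  have h1 : B = B.updateCol i (Pi.single i 1 + (fun k => B k i - (Pi.single i 1 : ι → K) k)) := by
    ext a b
    by_cases h : b = i
    · subst h; simp
    · simp [h]
  conv_rhs => rw [h1, det_updateCol_add]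
  rw [left_eq_add]
  apply det_eq_zero_of_row_eq_zero i
  intro j
  by_cases h : j = i
  · subst h; simp [hB]
  · simp [hB, h]

theorem det_add_single (i : ι) (A : Matrix ι ι K) (x : K) :
    (A + single i i x).det = A.det + x * (rr i A).det := by
  rw [det_rr, ← det_updateRow_smul]
  have : A + single i i x = A.updateRow i (A i + x • Pi.single i 1) := by
    ext a b
    by_cases h : a = i
    · subst h
      by_cases h2 : b = a
      · subst h2; simp
      · simp [h2, Ne.symm h2]
    · simp [h, Ne.symm h]
  rw [this, det_updateRow_add]
  simp

theorem rr_apply (i : ι) (A : Matrix ι ι K) (a b : ι) :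
    rr i A a b = if a = i ∧ b = i then 1 else if a = i ∨ b = i then 0 else A a b := by
  unfold rr
  by_cases h : b = i <;> by_cases h2 : a = i <;> simp [updateCol_apply, updateRow_apply, h, h2, Pi.single_apply]

theorem rr_comm {i j : ι} (h : i ≠ j) (A : Matrix ι ι K) : rr i (rr j A) = rr j (rr i A) := by
  ext a b
  simp only [rr_apply]
  grind

theorem rr_add {i j : ι} (h : i ≠ j) (A : Matrix ι ι K) (x : K) :
    rr i (A + single j j x) = rr i A + single j j x := by
  ext a b
  simp only [rr_apply, Matrix.add_apply, single_apply]
  grind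

theorem rr_symm (i : ι) {A : Matrix ι ι K} (h : A.IsSymm) : (rr i A).IsSymm := by
  ext a b
  have := h.apply a b
  simp only [rr_apply, Matrix.transpose_apply]
  grind

theorem dodgson {i j : ι} (hij : i ≠ j) (A : Matrix ι ι K) (hA : A.IsSymm) :
    (rr i A).det * (rr j A).det - A.det * (rr i (rr j A)).det
      = ((A.updateRow j (Pi.single i 1)).det) ^ 2 := by
  have key : A.det * ((A.updateRow i (Pi.single i 1)).updateRow j (Pi.single j 1)).det =
      adjugate A j j * adjugate A i i - adjugate A j i * adjugate A i j := by
    set B := A.updateRow i (Pi.single i 1) with hB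
    rw [← cramer_transpose_apply, ← smul_eq_mul, ← Pi.smul_apply, ← map_smul]
    have : A.det • (Pi.single j (1:K) : ι → K) = ∑ k, adjugate A j k • A k := by
      have h := congrFun (adjugate_mul A) j
      ext b
      have h2 := congrFun h b
      rw [Matrix.mul_apply] at h2
      simp only [Finset.sum_apply, Pi.smul_apply, smul_eq_mul] at h2 ⊢
      rw [h2]
      simp [Matrix.one_apply, Pi.single_apply, eq_comm]
    rw [this, map_sum, Finset.sum_apply]
    simp only [cramer_transpose_apply, det_updateRow_smul]
    rw [Finset.sum_eq_add j i hij.symm]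
    · have e1 : B.updateRow j (A j) = B := by
        ext a b
        by_cases h : a = j
        · subst h; simp [hB, hij.symm]
        · simp [h]
      have e2 : (B.updateRow j (A i)).det = - adjugate A i j := by
        have : B.updateRow j (A i) = (A.updateRow j (Pi.single i 1)).submatrix (Equiv.swap i j) id := by
          ext a b
          by_cases h : a = j
          · subst h; simp [updateRow_apply, hij]
          · by_cases h2 : a = i
            · subst h2; simp [hB, hij]
            · simp [hB, h, h2, Equiv.swap_apply_of_ne_of_ne]
        rw [this, det_permute, Equiv.Perm.sign_swap hij, adjugate_apply]
        simp
      rw [e1, e2, hB, ← adjugate_apply]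
      ring
    · intro k _ hk
      have : (B.updateRow j (A k)).det = 0 := by
        apply det_zero_of_row_eq hk.1.symm
        ext b
        simp [hB, hk.1, hk.2]
      rw [this, mul_zero]
    · simp
    · simp
  have h2 : (rr i (rr j A)).det = ((A.updateRow i (Pi.single i 1)).updateRow j (Pi.single j 1)).det := by
    rw [rr_comm hij, det_rr]
    have : (rr i A).updateRow j (Pi.single j 1) = rr i (A.updateRow j (Pi.single j 1)) := by
      ext a b
      simp only [rr_apply, updateRow_apply, Pi.single_apply]
      grind
    rw [this, det_rr, updateRow_comm _ hij.symm]
  rw [h2, key, det_rr, det_rr, ← adjugate_apply, ← adjugate_apply, ← adjugate_apply]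
  have := (hA.adjugate).apply i j
  rw [this]
  ring
end Lin
section Cnt
variable {s m : Type*} [Fintype s] [DecidableEq s] [Fintype m] [DecidableEq m]
  {K : Type*} [Field K] [Fintype K]

/-- Iterated sum over diagonal entries indexed by the list. -/
def cnt : List s → (Matrix (s ⊕ m) (s ⊕ m) K → ℤ) → Matrix (s ⊕ m) (s ⊕ m) K → ℤ
  | [], P, A => P A
  | i :: l, P, A => ∑ x : K, cnt l P (A + single (Sum.inl i) (Sum.inl i) x)

theorem cnt_comm (φ : Matrix (s ⊕ m) (s ⊕ m) K → Matrix (s ⊕ m) (s ⊕ m) K) (l : List s)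
    (P : Matrix (s ⊕ m) (s ⊕ m) K → ℤ)
    (h : ∀ i ∈ l, ∀ A x, φ (A + single (Sum.inl i) (Sum.inl i) x)
      = φ A + single (Sum.inl i) (Sum.inl i) x) (A) :
    cnt l P (φ A) = cnt l (fun B => P (φ B)) A := by
  induction l generalizing A with
  | nil => rfl
  | cons i l ih =>
    simp only [cnt]
    refine Finset.sum_congr rfl fun x _ => ?_
    rw [← h i (by simp), ih (fun j hj => h j (by simp [hj]))]

theorem cnt_sum {β : Type*} (t : Finset β) (l : List s)
    (P : β → Matrix (s ⊕ m) (s ⊕ m) K → ℤ) (A) :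
    cnt l (fun B => ∑ x ∈ t, P x B) A = ∑ x ∈ t, cnt l (P x) A := by
  induction l generalizing A with
  | nil => rfl
  | cons i l ih =>
    simp only [cnt, ih]
    rw [Finset.sum_comm]

theorem cnt_cons (i : s) (l : List s) (P : Matrix (s ⊕ m) (s ⊕ m) K → ℤ) (A) :
    cnt (i :: l) P A =
      cnt l (fun B => ∑ x : K, P (B + single (Sum.inl i) (Sum.inl i) x)) A := by
  rw [cnt_sum]
  simp only [cnt]
  refine Finset.sum_congr rfl fun x _ => ?_
  apply cnt_comm (fun B => B + single (Sum.inl i) (Sum.inl i) x)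
  intro j _ A y
  exact add_right_comm _ _ _

theorem cnt_add (l : List s) (P Q : Matrix (s ⊕ m) (s ⊕ m) K → ℤ) (A) :
    cnt l (fun B => P B + Q B) A = cnt l P A + cnt l Q A := by
  induction l generalizing A with
  | nil => rfl
  | cons i l ih => simp only [cnt, ih, Finset.sum_add_distrib]

theorem cnt_mul (l : List s) (c : ℤ) (P : Matrix (s ⊕ m) (s ⊕ m) K → ℤ) (A) :
    cnt l (fun B => c * P B) A = c * cnt l P A := by
  induction l generalizing A with
  | nil => rfl
  | cons i l ih => simp only [cnt, ih, Finset.mul_sum]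

theorem cnt_const (l : List s) (c : ℤ) (A : Matrix (s ⊕ m) (s ⊕ m) K) :
    cnt l (fun _ => c) A = (Fintype.card K : ℤ) ^ l.length * c := by
  induction l generalizing A with
  | nil => simp [cnt]
  | cons i l ih => simp [cnt, ih, pow_succ]; ring

theorem cnt_dvd (l : List s) (d : ℤ) (P Q : Matrix (s ⊕ m) (s ⊕ m) K → ℤ)
    (h : ∀ B, B.IsSymm → d ∣ P B - Q B) (A) (hA : A.IsSymm) :
    d ∣ cnt l P A - cnt l Q A := by
  induction l generalizing A with
  | nil => exact h A hA
  | cons i l ih =>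
    simp only [cnt, ← Finset.sum_sub_distrib]
    refine Finset.dvd_sum fun x _ => ih _ ?_
    refine hA.add ?_
    simp [Matrix.IsSymm]

/-- indicator of singular matrices -/
noncomputable def zz (A : Matrix (s ⊕ m) (s ⊕ m) K) : ℤ := if A.det = 0 then 1 else 0

/-- indicator of common zeros -/
noncomputable def pp (i : s) (A : Matrix (s ⊕ m) (s ⊕ m) K) : ℤ :=
  if A.det = 0 ∧ (rr (Sum.inl i) A).det = 0 then 1 else 0

theorem sum_lin (a b : K) : (∑ x : K, if b + x * a = 0 then (1:ℤ) else 0) =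
    if a = 0 then (if b = 0 then (Fintype.card K : ℤ) else 0) else 1 := by
  by_cases ha : a = 0
  · subst ha
    by_cases hb : b = 0 <;> simp [hb]
  · have : ∀ x : K, b + x * a = 0 ↔ x = - b / a := by
      intro x
      rw [eq_div_iff ha]
      constructor
      · intro h; linear_combination h
      · intro h; linear_combination h
    simp [this, ha]

theorem sum_lin2 (a b c d g : K) (h : b * c - d * a = g ^ 2) :
    (Fintype.card K : ℤ) ∣
    (∑ x : K, if d + x * c = 0 ∧ b + x * a = 0 then (1:ℤ) else 0) -
    ((if g = 0 then 1 else 0) + (-1) * (if c = 0 ∧ a = 0 then 1 else 0)) := by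
  by_cases ha : a = 0
  · subst ha
    by_cases hb : b = 0
    · subst hb
      have hg : g = 0 := by
        have : g ^ 2 = 0 := by rw [← h]; ring
        simpa using this
      have := sum_lin c d
      simp only [mul_zero, add_zero, and_true, hg, if_true]
      rw [this]
      by_cases hc : c = 0
      · by_cases hd : d = 0 <;> simp [hc, hd]
      · simp [hc]
    · have hg : g = 0 ↔ c = 0 := by
        constructor
        · intro hg; subst hg
          have : b * c = 0 := by linear_combination h
          exact (mul_eq_zero.1 this).resolve_left hb
        · intro hc; subst hc
          have : g ^ 2 = 0 := by rw [← h]; ring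
          simpa using this
      by_cases hc : c = 0 <;> simp [hb, hg, hc]
  · have : ∀ x : K, (d + x * c = 0 ∧ b + x * a = 0) ↔ (g = 0 ∧ x = - b / a) := by
      intro x
      rw [eq_div_iff ha]
      constructor
      · rintro ⟨h1, h2⟩
        refine ⟨?_, by linear_combination h2⟩
        have : g ^ 2 = 0 := by rw [← h]; linear_combination c * h2 - a * h1
        simpa using this
      · rintro ⟨rfl, h2⟩
        refine ⟨?_, by linear_combination h2⟩
        have : a * (d + x * c) = 0 := by linear_combination c * h2 - h
        exact (mul_eq_zero.1 this).resolve_left ha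
    simp only [this]
    by_cases hg : g = 0 <;> simp [hg, ha]

theorem sum_zz (i : s) (A : Matrix (s ⊕ m) (s ⊕ m) K) :
    (∑ x : K, zz (A + single (Sum.inl i) (Sum.inl i) x)) =
      ((Fintype.card K : ℤ) * pp i A + 1) + (-1) * zz (rr (Sum.inl i) A) := by
  simp only [zz, pp, det_add_single, sum_lin]
  by_cases h1 : A.det = 0 <;> by_cases h2 : (rr (Sum.inl i) A).det = 0 <;> simp [h1, h2]

theorem sum_pp {i j : s} (hij : i ≠ j) (A : Matrix (s ⊕ m) (s ⊕ m) K) (hA : A.IsSymm) :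
    (Fintype.card K : ℤ) ∣
    (∑ x : K, pp i (A + single (Sum.inl j) (Sum.inl j) x)) -
      (zz (A.updateRow (Sum.inl j) (Pi.single (Sum.inl i) 1))
        + (-1) * pp i (rr (Sum.inl j) A)) := by
  have hij' : (Sum.inl i : s ⊕ m) ≠ Sum.inl j := by simpa using hij
  have := sum_lin2 _ _ _ _ _ (dodgson hij' A hA)
  simp only [zz, pp, rr_add hij', det_add_single]
  rw [rr_comm hij'] at this ⊢
  exact this

/-- Lower right block vanishes, and rows outside of `S` have zero `m`-part. -/
def Good (S : List s) (A : Matrix (s ⊕ m) (s ⊕ m) K) : Prop :=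
  (∀ a b, A (Sum.inr a) (Sum.inr b) = 0) ∧ ∀ i ∉ S, ∀ a, A (Sum.inl i) (Sum.inr a) = 0

theorem Good.det_eq_zero (hm : 2 ≤ Fintype.card m) {i : s} {A : Matrix (s ⊕ m) (s ⊕ m) K}
    (h : Good [i] A) : A.det = 0 := by
  obtain ⟨w, hw0, hw⟩ : ∃ w : m → K, w ≠ 0 ∧ ∑ a, A (Sum.inl i) (Sum.inr a) * w a = 0 := by
    let f : (m → K) →ₗ[K] K := ∑ a, A (Sum.inl i) (Sum.inr a) • LinearMap.proj a
    have hf : LinearMap.ker f ≠ ⊥ := f.ker_ne_bot_of_finrank_lt (by simp; omega)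
    obtain ⟨w, hw, hw0⟩ := (Submodule.ne_bot_iff _).1 hf
    refine ⟨w, hw0, ?_⟩
    simpa [f] using hw
  rw [← exists_mulVec_eq_zero_iff]
  refine ⟨Sum.elim 0 w, ?_, ?_⟩
  · intro h0
    apply hw0
    ext a
    exact congrFun h0 (Sum.inr a)
  · ext a
    simp only [mulVec, dotProduct, Fintype.sum_sum_type, Sum.elim_inl, Sum.elim_inr, Pi.zero_apply,
      mul_zero, Finset.sum_const_zero, zero_add]
    rcases a with j | a
    · by_cases hj : j = i
      · subst hj; exact hw
      · exact Finset.sum_eq_zero fun a _ => by rw [h.2 j (by simpa using hj), zero_mul]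
    · exact Finset.sum_eq_zero fun b _ => by rw [h.1, zero_mul]

theorem Good.add {S : List s} {A : Matrix (s ⊕ m) (s ⊕ m) K} (h : Good S A) (i : s) (x : K) :
    Good S (A + single (Sum.inl i) (Sum.inl i) x) := by
  constructor
  · intro a b; simp [h.1 a b]
  · intro j hj a; simp [h.2 j hj a]

theorem Good.rr {S : List s} {A : Matrix (s ⊕ m) (s ⊕ m) K} (i : s) (h : Good (i :: S) A) :
    Good S (rr (Sum.inl i) A) := by
  constructor
  · intro a b; simp [rr_apply, h.1 a b]
  · intro j hj a
    by_cases hji : j = i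
    · subst hji; simp [rr_apply]
    · simp [rr_apply, hji, h.2 j (by simp [hj, hji]) a]

theorem Good.mono {S T : List s} {A : Matrix (s ⊕ m) (s ⊕ m) K} (h : Good S A)
    (hST : S ⊆ T) : Good T A :=
  ⟨h.1, fun i hi => h.2 i fun h' => hi (hST h')⟩

theorem lemA (hm : 2 ≤ Fintype.card m) (i0 : s) (l : List s) (hl : l.Nodup) (hne : l ≠ [])
    (A : Matrix (s ⊕ m) (s ⊕ m) K) (h : Good (l ++ [i0]) A) :
    (Fintype.card K : ℤ) ∣ cnt l zz A := by
  induction l generalizing A with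
  | nil => exact absurd rfl hne
  | cons i l ih =>
    rw [cnt_cons]
    simp only [sum_zz]
    rw [cnt_add, cnt_add, cnt_mul, cnt_mul, cnt_const,
      ← cnt_comm (fun B => rr (Sum.inl i) B) l zz]
    · have hg := Good.rr i h
      by_cases hl0 : l = []
      · subst hl0
        have := Good.det_eq_zero hm hg
        simp [cnt, zz, this]
      · refine dvd_add (dvd_add (dvd_mul_right _ _) ?_)
          (Dvd.dvd.mul_left (ih (List.nodup_cons.1 hl).2 hl0 _ hg) _)
        exact Dvd.dvd.mul_right (dvd_pow_self _ (by simpa using hl0)) _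
    · intro j hj A x
      apply rr_add
      have := (List.nodup_cons.1 hl).1
      rintro h; simp only [Sum.inl.injEq] at h; subst h; exact this hj

theorem lemB (hm : 2 ≤ Fintype.card m) (i : s) (l : List s) (hl : (i :: l).Nodup) (hne : l ≠ [])
    (A : Matrix (s ⊕ m) (s ⊕ m) K) (hA : A.IsSymm) (h : Good (i :: l) A) :
    (Fintype.card K : ℤ) ∣ cnt l (pp i) A := by
  induction l generalizing A with
  | nil => exact absurd rfl hne
  | cons j l ih =>
    have hij : i ≠ j := by rintro rfl; simp at hl
    by_cases hl0 : l = []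
    · subst hl0
      simp only [cnt]
      have h1 : (rr (Sum.inl j) A).det = 0 :=
        Good.det_eq_zero (i := i) hm (Good.rr j (h.mono (by simp)))
      have h2 : ∀ x, (rr (Sum.inl i) (A + single (Sum.inl j) (Sum.inl j) x)).det = 0 := fun x =>
        Good.det_eq_zero (i := j) hm (Good.rr i (h.add j x))
      simp only [pp, h2, det_add_single, h1]
      by_cases hd : A.det = 0 <;> simp [hd]
    · rw [cnt_cons]
      have key := cnt_dvd l (Fintype.card K : ℤ) _ _ (fun B hB => sum_pp (m := m) hij B hB) A hA
      refine (dvd_iff_dvd_of_dvd_sub key).2 ?_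
      rw [cnt_add, cnt_mul]
      have hjl : j ∉ l := fun hj => by simp [hj] at hl
      rw [← cnt_comm (fun B => B.updateRow (Sum.inl j) (Pi.single (Sum.inl i) 1)) l zz,
        ← cnt_comm (fun B => rr (Sum.inl j) B) l (pp i)]
      · refine dvd_add (lemA hm i l (by grind) hl0 _ ?_) (Dvd.dvd.mul_left
          (ih (by grind) hl0 _ (rr_symm _ hA) (Good.rr j (h.mono (by grind)))) _)
        constructor
        · intro a b; simp [h.1 a b]
        · intro k hk a
          by_cases hkj : k = j
          · subst hkj; simp
          · have := h.2 k (by grind) a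
            simp [updateRow_apply, hkj, this]
      · intro k hk A x
        apply rr_add
        rintro h; simp only [Sum.inl.injEq] at h; subst h; exact hjl hk
      · intro k hk A x
        have hkj : (Sum.inl k : s ⊕ m) ≠ Sum.inl j := by
          rintro h; simp only [Sum.inl.injEq] at h; subst h; exact hjl hk
        ext a b
        simp only [updateRow_apply, Matrix.add_apply, single_apply]
        grind

theorem lemC (hm : 2 ≤ Fintype.card m) (l : List s) (hl : l.Nodup) (hlen : 2 ≤ l.length)
    (A : Matrix (s ⊕ m) (s ⊕ m) K) (hA : A.IsSymm) (h : Good l A) :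
    (Fintype.card K : ℤ) ^ 2 ∣ cnt l zz A := by
  induction l generalizing A with
  | nil => simp at hlen
  | cons i l ih =>
    have hil := (List.nodup_cons.1 hl).1
    have hl0 : l ≠ [] := by rintro rfl; simp at hlen
    rw [cnt_cons]
    simp only [sum_zz]
    rw [cnt_add, cnt_add, cnt_mul, cnt_mul, cnt_const,
      ← cnt_comm (fun B => rr (Sum.inl i) B) l zz]
    · have hg := Good.rr i h
      have hB := lemB hm i l hl hl0 A hA h
      have h1 : (Fintype.card K : ℤ) ^ 2 ∣ (Fintype.card K : ℤ) * cnt l (pp i) A := by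
        rw [pow_two]; exact mul_dvd_mul_left _ hB
      by_cases h2 : 2 ≤ l.length
      · refine dvd_add (dvd_add h1 ?_)
          (Dvd.dvd.mul_left (ih (List.nodup_cons.1 hl).2 h2 _ (rr_symm _ hA) hg) _)
        exact Dvd.dvd.mul_right (pow_dvd_pow _ h2) _
      · obtain ⟨j, rfl⟩ : ∃ j, l = [j] := by
          apply List.length_eq_one_iff.1
          simp at hlen; omega
        have h3 : ∀ x, (rr (Sum.inl i) A + single (Sum.inl j) (Sum.inl j) x).det = 0 :=
          fun x => Good.det_eq_zero hm (hg.add j x)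
        have h4 : cnt [j] zz (rr (Sum.inl i) A) = (Fintype.card K : ℤ) := by
          simp [cnt, zz, h3]
        rw [h4]
        simpa using h1
    · intro j hj A x
      apply rr_add
      rintro h; simp only [Sum.inl.injEq] at h; subst h; exact hil hj

theorem cnt_ofFn (n : ℕ) (φ : Fin n → s) (P : Matrix (s ⊕ m) (s ⊕ m) K → ℤ) (A) :
    cnt (List.ofFn φ) P A = ∑ x : Fin n → K,
      P (A + ∑ k, single (Sum.inl (φ k)) (Sum.inl (φ k)) (x k)) := by
  induction n generalizing A with
  | zero => simp [cnt]
  | succ n ih =>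
    rw [List.ofFn_succ, cnt, ← (Fin.consEquiv (fun _ => K)).sum_comp, Fintype.sum_prod_type]
    refine Finset.sum_congr rfl fun x _ => ?_
    rw [ih]
    refine Finset.sum_congr rfl fun y _ => ?_
    simp [Fin.sum_univ_succ, Fin.consEquiv, add_assoc]

theorem mainLin (hm : 2 ≤ Fintype.card m) (hs : 2 ≤ Fintype.card s) (E : Matrix s m K) :
    (Fintype.card K) ^ 2 ∣ Nat.card {x : s → K // (fromBlocks (diagonal x) E Eᵀ 0).det = 0} := by
  let e := (Fintype.equivFin s).symm
  have h := lemC hm (List.ofFn e) (List.nodup_ofFn.2 e.injective) (by simpa using hs)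
    (fromBlocks 0 E Eᵀ 0) (by simp [Matrix.IsSymm, fromBlocks_transpose])
    ⟨by simp, fun i hi => absurd ((List.mem_ofFn' _ _).2 ⟨e.symm i, by simp⟩) hi⟩
  rw [cnt_ofFn] at h
  rw [← Int.natCast_dvd_natCast]
  push_cast
  convert h using 1
  rw [Nat.card_eq_fintype_card, Fintype.card_subtype, Finset.card_filter, Nat.cast_sum]
  rw [← (Equiv.arrowCongr e (Equiv.refl K)).sum_comp]
  refine Finset.sum_congr rfl fun x _ => ?_
  have : fromBlocks (0 : Matrix s s K) E Eᵀ (0 : Matrix m m K) +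
      ∑ k, single (Sum.inl (e k)) (Sum.inl (e k)) (x k) =
      fromBlocks (diagonal ((Equiv.arrowCongr e (Equiv.refl K)) x)) E Eᵀ 0 := by
    rw [← e.symm.sum_comp]
    ext a b
    rw [Matrix.add_apply, Matrix.sum_apply]
    rcases a with a | a <;> rcases b with b | b
    · by_cases hab : a = b
      · subst hab
        simp [single_apply, Equiv.arrowCongr]
      · simp only [single_apply, fromBlocks_apply₁₁, diagonal_apply_ne _ hab]
        simp
        apply Finset.sum_eq_zero
        grind
    all_goals simp [single_apply]
  rw [this, zz]
  simp
end Cnt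
section Expand
variable {K : Type*} [Field K]

/-- Replace rows in `T` by unit vectors. -/
def qq {ι : Type*} [DecidableEq ι] (T : Finset ι) (A : Matrix ι ι K) : Matrix ι ι K :=
  fun i => if i ∈ T then Pi.single i 1 else A i

theorem det_expand {ι : Type*} [Fintype ι] [DecidableEq ι] (x : ι → K) (S : Finset ι)
    (A : Matrix ι ι K) :
    (A + ∑ i ∈ S, single i i (x i)).det =
      ∑ T ∈ S.powerset, (∏ i ∈ T, x i) * (qq T A).det := by
  induction S using Finset.induction_on generalizing A with
  | empty =>
    have : qq ∅ A = A := by ext; simp [qq]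
    simp [this]
  | insert i S hi ih =>
    rw [Finset.sum_insert hi, Finset.sum_powerset_insert hi,
      show A + (single i i (x i) + ∑ i ∈ S, single i i (x i)) =
        (A + ∑ i ∈ S, single i i (x i)) + single i i (x i) by abel, det_add_single, det_rr]
    have h1 : (A + ∑ i ∈ S, single i i (x i)).updateRow i (Pi.single i 1) =
        A.updateRow i (Pi.single i 1) + ∑ i ∈ S, single i i (x i) := by
      ext a b
      by_cases h : a = i
      · subst h
        simp only [updateRow_self, Matrix.add_apply, Matrix.sum_apply]
        rw [Finset.sum_eq_zero, add_zero]
        intro k hk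
        rw [single_apply, if_neg]
        rintro ⟨rfl, _⟩; exact hi hk
      · simp [h]
    rw [h1, ih, ih, Finset.mul_sum]
    congr 1
    refine Finset.sum_congr rfl fun T hT => ?_
    have hiT : i ∉ T := fun h => hi (Finset.mem_powerset.1 hT h)
    rw [Finset.prod_insert hiT, mul_assoc]
    congr 3
    ext a b
    simp only [qq, updateRow_apply, Finset.mem_insert]
    by_cases h : a = i <;> by_cases h2 : a ∈ T <;> simp [h, h2, hiT]

variable {s m : Type*} [Fintype s] [DecidableEq s] [Fintype m] [DecidableEq m]

/-- coefficient matrix -/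
def ww (E : Matrix s m K) (T : Finset s) : Matrix (s ⊕ m) (s ⊕ m) K :=
  fun i => match i with
    | Sum.inl e => if e ∈ T then Sum.elim 0 (E e) else Pi.single (Sum.inl e) 1
    | Sum.inr a => Sum.elim (fun e => E e a) 0

theorem det_expand2 (E : Matrix s m K) (x : s → K) :
    (fromBlocks (diagonal x) E Eᵀ 0).det = ∑ T : Finset s, (∏ i ∈ Tᶜ, x i) * (ww E T).det := by
  have h := det_expand (Sum.elim x 0) (Finset.univ.map ⟨Sum.inl, Sum.inl_injective⟩)
    (fromBlocks 0 E Eᵀ (0 : Matrix m m K))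
  have h0 : fromBlocks 0 E Eᵀ (0 : Matrix m m K) +
      ∑ i ∈ Finset.univ.map ⟨Sum.inl, Sum.inl_injective⟩, single i i (Sum.elim x 0 i)
      = fromBlocks (diagonal x) E Eᵀ 0 := by
    rw [Finset.sum_map]
    ext a b
    rw [Matrix.add_apply, Matrix.sum_apply]
    rcases a with a | a <;> rcases b with b | b
    · by_cases hab : a = b
      · subst hab
        simp [single_apply]
      · simp only [single_apply, fromBlocks_apply₁₁, diagonal_apply_ne _ hab]
        simp
        apply Finset.sum_eq_zero
        grind
    all_goals simp [single_apply]
  rw [h0] at h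
  rw [h]
  symm
  refine Finset.sum_bij (fun T _ => Tᶜ.map ⟨Sum.inl, Sum.inl_injective⟩) ?_ ?_ ?_ ?_
  · intro T _
    simp only [Finset.mem_powerset]
    exact Finset.map_subset_map.2 (Finset.subset_univ _)
  · intro T _ T' _ h
    exact compl_injective (Finset.map_injective _ h)
  · intro U hU
    rw [Finset.mem_powerset, Finset.subset_map_iff] at hU
    obtain ⟨u, _, rfl⟩ := hU
    exact ⟨uᶜ, Finset.mem_univ _, by simp⟩
  · intro T _
    rw [Finset.prod_map]
    congr 2
    ext a b
    rcases a with a | a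
    · by_cases ha : a ∈ T
      · rcases b with b | b <;> simp [ww, qq, ha]
      · simp [ww, qq, ha]
    · rcases b with b | b <;> simp [ww, qq]

theorem ww_zero1 (E : Matrix s m K) (T : Finset s) (w : m → K) (hw0 : w ≠ 0)
    (hw : ∀ e ∈ T, ∑ a, E e a * w a = 0) : (ww E T).det = 0 := by
  rw [← exists_mulVec_eq_zero_iff]
  refine ⟨Sum.elim 0 w, ?_, ?_⟩
  · intro h0
    apply hw0
    ext a
    exact congrFun h0 (Sum.inr a)
  · ext a
    simp only [mulVec, dotProduct, Fintype.sum_sum_type, Sum.elim_inl, Sum.elim_inr, Pi.zero_apply,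
      mul_zero, Finset.sum_const_zero, zero_add]
    rcases a with j | a
    · by_cases hj : j ∈ T
      · simpa [ww, hj] using hw j hj
      · simp [ww, hj]
    · simp [ww]

theorem ww_zero2 (E : Matrix s m K) (T : Finset s) (h : T.card ≠ Fintype.card m) :
    (ww E T).det = 0 := by
  rcases lt_or_gt_of_ne h with h | h
  · let f : (m → K) →ₗ[K] (T → K) := (E.submatrix (fun e : T => (e : s)) id).mulVecLin
    have hf : LinearMap.ker f ≠ ⊥ := f.ker_ne_bot_of_finrank_lt (by simpa using h)
    obtain ⟨w, hw, hw0⟩ := (Submodule.ne_bot_iff _).1 hf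
    refine ww_zero1 E T w hw0 fun e he => ?_
    have := congrFun (LinearMap.mem_ker.1 hw) ⟨e, he⟩
    simpa [f, mulVec, dotProduct] using this
  · let f : (T → K) →ₗ[K] (m → K) := (E.submatrix (fun e : T => (e : s)) id)ᵀ.mulVecLin
    have hf : LinearMap.ker f ≠ ⊥ := f.ker_ne_bot_of_finrank_lt (by simpa using h)
    obtain ⟨u, hu, hu0⟩ := (Submodule.ne_bot_iff _).1 hf
    rw [← exists_mulVec_eq_zero_iff]
    refine ⟨Sum.elim (fun e => if h : e ∈ T then u ⟨e, h⟩ else 0) 0, ?_, ?_⟩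
    · intro h0
      apply hu0
      ext a
      simpa using congrFun h0 (Sum.inl (a : s))
    · ext a
      simp only [mulVec, dotProduct, Fintype.sum_sum_type, Sum.elim_inl, Sum.elim_inr, Pi.zero_apply,
        mul_zero, Finset.sum_const_zero, add_zero]
      rcases a with j | a
      · by_cases hj : j ∈ T
        · simp [ww, hj]
        · rw [Finset.sum_eq_zero]
          intro x _
          by_cases hx : x = j
          · subst hx; simp [hj]
          · simp [ww, hj, Pi.single_apply, hx]
      · have := congrFun (LinearMap.mem_ker.1 hu) a
        simp only [f, mulVecLin_apply, mulVec, dotProduct, transpose_apply, submatrix_apply, id,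
          Pi.zero_apply] at this
        refine Eq.trans ?_ this
        simp only [ww, Sum.elim_inl]
        rw [← Finset.sum_subset (Finset.subset_univ T), ← Finset.sum_coe_sort T]
        · refine Finset.sum_congr rfl fun e _ => ?_
          simp
        · intro e _ he
          simp [he]

/-- sign -/
def sg (K m : Type*) [Field K] [Fintype m] [DecidableEq m] : K :=
  (fromBlocks 0 1 1 0 : Matrix (m ⊕ m) (m ⊕ m) K).det

theorem sg_ne : sg K m ≠ 0 := by
  intro h
  have : sg K m * sg K m = 1 := by
    rw [sg, ← det_mul, fromBlocks_multiply]
    simp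
  simp [h] at this

theorem ww_tree (EZ : Matrix s m ℤ) (T : Finset s) (h : T.card = Fintype.card m)
    (hC : ∀ v : m, ∃ c : s → ℤ, ∀ a, ∑ e ∈ T, c e * EZ e a = if v = a then 1 else 0) :
    (ww (EZ.map (Int.cast : ℤ → K)) T).det = sg K m := by
  have τ : m ≃ T := Fintype.equivOfCardEq (by simpa using h.symm)
  let B : Matrix m m ℤ := Matrix.of fun a b => EZ (τ a) b
  have hB : B.det ^ 2 = 1 := by
    choose c hc using hC
    have h1 : (Matrix.of fun v a => c v (τ a)) * B = 1 := by
      ext v a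
      rw [Matrix.mul_apply, one_apply, ← hc v a, ← Finset.sum_coe_sort T, ← τ.sum_comp]
      rfl
    have h2 := congrArg det h1
    rw [det_mul, det_one] at h2
    have : IsUnit B.det := IsUnit.of_mul_eq_one_right _ h2
    rcases Int.isUnit_iff.1 this with h | h <;> simp [h]
  let p : s ⊕ m → Prop := fun i => ∃ e, e ∉ T ∧ i = Sum.inl e
  rw [twoBlockTriangular_det' _ p]
  · have h1 : toSquareBlockProp (ww (EZ.map (Int.cast : ℤ → K)) T) p = 1 := by
      ext ⟨i, e, he, rfl⟩ ⟨j, e', he', rfl⟩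
      simp [toSquareBlockProp_def, ww, he, one_apply, Pi.single_apply, eq_comm]
    rw [h1, det_one, one_mul]
    let f : m ⊕ m → {i // ¬ p i} := fun i => match i with
      | Sum.inl a => ⟨Sum.inl (τ a), by rintro ⟨e, he, h⟩; simp only [Sum.inl.injEq] at h; exact he (h ▸ (τ a).2)⟩
      | Sum.inr a => ⟨Sum.inr a, by rintro ⟨e, he, h⟩; cases h⟩
    have hf : Function.Bijective f := by
      constructor
      · rintro (a | a) (b | b) hab <;> simp [f] at hab ⊢ <;> exact hab
      · rintro ⟨i | a, hi⟩
        · have : i ∈ T := by by_contra h; exact hi ⟨i, h, rfl⟩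
          exact ⟨Sum.inl (τ.symm ⟨i, this⟩), by simp [f]⟩
        · exact ⟨Sum.inr a, rfl⟩
    rw [← det_submatrix_equiv_self (Equiv.ofBijective f hf)]
    have h2 : (toSquareBlockProp (ww (EZ.map (Int.cast : ℤ → K)) T) fun i => ¬ p i).submatrix
        (Equiv.ofBijective f hf) (Equiv.ofBijective f hf) =
        fromBlocks (B.map (Int.cast : ℤ → K)) 0 0 (B.map (Int.cast : ℤ → K))ᵀ * fromBlocks 0 1 1 0 := by
      rw [fromBlocks_multiply]
      ext (a | a) (b | b) <;> simp [toSquareBlockProp_def, f, ww, B]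
    rw [h2, det_mul, det_fromBlocks_zero₂₁, det_transpose, ← pow_two]
    have h3 : (B.map (Int.cast : ℤ → K)).det = (B.det : K) := by
      rw [Int.cast_det]
    rw [h3, ← Int.cast_pow, hB]
    simp [sg]
  · rintro i ⟨e, he, rfl⟩ j hj
    have : j ≠ Sum.inl e := by rintro rfl; exact hj ⟨e, he, rfl⟩
    simp [ww, he, this]
end Expand
section Gr
variable {V : Type*} [Fintype V] (G : SimpleGraph V)

theorem ends_exist (e : G.edgeSet) : ∃ p : V × V, s(p.1, p.2) = (e : Sym2 V) := by
  obtain ⟨e, he⟩ := e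
  induction e using Sym2.ind with
  | _ x y => exact ⟨(x, y), rfl⟩

/-- an orientation -/
noncomputable def ends (e : G.edgeSet) : V × V := (ends_exist G e).choose

theorem ends_spec (e : G.edgeSet) : s((ends G e).1, (ends G e).2) = (e : Sym2 V) :=
  (ends_exist G e).choose_spec

/-- incidence -/
noncomputable def inc (e : G.edgeSet) (v : V) : ℤ :=
  (if (ends G e).1 = v then 1 else 0) - (if (ends G e).2 = v then 1 else 0)

/-- spanning subgraph -/
def spanG (T : Finset G.edgeSet) : SimpleGraph V :=
  SimpleGraph.fromEdgeSet (Subtype.val '' (T : Set G.edgeSet))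

theorem path_exist (T : Finset G.edgeSet) (r v : V) (h : (spanG G T).Reachable r v) :
    ∃ c : G.edgeSet → ℤ, ∀ a, ∑ e ∈ T, c e * inc G e a =
      (if v = a then 1 else 0) - (if r = a then 1 else 0) := by
  rw [SimpleGraph.reachable_iff_reflTransGen] at h
  induction h with
  | refl => exact ⟨0, by simp⟩
  | @tail u v _ huv ih =>
    obtain ⟨c, hc⟩ := ih
    rw [spanG, SimpleGraph.fromEdgeSet_adj] at huv
    obtain ⟨⟨e, heT, he⟩, hne⟩ := huv
    have heT : e ∈ T := heT
    obtain ⟨t, ht⟩ : ∃ t : ℤ, ∀ a, t * inc G e a = (if v = a then 1 else 0) - (if u = a then 1 else 0) := by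
      have h := ends_spec G e
      rw [he, Sym2.eq_iff] at h
      rcases h with ⟨h1, h2⟩ | ⟨h1, h2⟩
      · refine ⟨-1, fun a => ?_⟩
        simp [inc, h1, h2]
      · refine ⟨1, fun a => ?_⟩
        simp [inc, h1, h2]
    refine ⟨c + Pi.single e t, fun a => ?_⟩
    simp only [Pi.add_apply, add_mul, Finset.sum_add_distrib, hc]
    rw [Finset.sum_eq_single e]
    · simp only [Pi.single_eq_same, ht]; ring
    · intro b _ hb; simp [hb]
    · intro h; exact absurd heT h

theorem spanG_isTree (T : Finset G.edgeSet) :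
    (spanG G T).IsTree ↔ (spanG G T).Connected ∧ T.card + 1 = Fintype.card V := by
  rw [SimpleGraph.isTree_iff_connected_and_card]
  have : (spanG G T).edgeSet = Subtype.val '' (T : Set G.edgeSet) := by
    rw [spanG, SimpleGraph.edgeSet_fromEdgeSet, sdiff_eq_left, Set.disjoint_left]
    rintro _ ⟨e, _, rfl⟩ h
    exact G.not_isDiag_of_mem_edgeSet e.2 h
  rw [this, Nat.card_image_of_injective Subtype.val_injective]
  simp

theorem ww_graph {K : Type*} [Field K] [Fintype G.edgeSet] (r : V) (T : Finset G.edgeSet) :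
    (ww ((Matrix.of fun (e : G.edgeSet) (v : {v : V // v ≠ r}) => inc G e v).map
      (Int.cast : ℤ → K)) T).det = if (spanG G T).IsTree then sg K {v : V // v ≠ r} else 0 := by
  have hcard : Fintype.card {v : V // v ≠ r} + 1 = Fintype.card V := by
    have := Fintype.card_pos_iff.2 ⟨r⟩
    rw [Fintype.card_subtype_compl]
    simp; omega
  rw [spanG_isTree]
  by_cases h : T.card = Fintype.card {v : V // v ≠ r}
  · by_cases hc : (spanG G T).Connected
    · rw [if_pos ⟨hc, by omega⟩]
      apply ww_tree _ _ h
      intro v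
      obtain ⟨c, hc⟩ := path_exist G T r v (hc.preconnected r v)
      refine ⟨c, fun a => ?_⟩
      have := hc a
      simp only [Ne.symm a.2, if_false, sub_zero] at this
      simpa [Subtype.ext_iff] using this
    · rw [if_neg (fun h => hc h.1)]
      have hv : ∃ v, ¬ (spanG G T).Reachable r v := by
        by_contra! hv
        apply hc
        haveI : Nonempty V := ⟨r⟩
        exact ⟨fun a b => (hv a).symm.trans (hv b)⟩
      obtain ⟨v, hv⟩ := hv
      let w : V → K := fun a => if (spanG G T).Reachable r a then 0 else 1
      have hwr : w r = 0 := by simp [w]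
      refine ww_zero1 _ _ (fun a => w a) ?_ ?_
      · intro h0
        have := congrFun h0 ⟨v, by rintro rfl; exact hv (SimpleGraph.Reachable.refl _)⟩
        simp [w, hv] at this
      · intro e he
        have h1 : ∑ a : {v : V // v ≠ r}, (inc G e a : K) * w a = ∑ a : V, (inc G e a : K) * w a := by
          have h3 := Finset.sum_subtype (F := inferInstance) (p := fun v => v ≠ r) (Finset.univ.erase r) (by simp)
            (fun a => (inc G e a : K) * w a)
          rw [← h3]
          exact Finset.sum_erase _ (by simp [hwr])
        have h2 : w (ends G e).1 = w (ends G e).2 := by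
          by_cases hne : (ends G e).1 = (ends G e).2
          · rw [hne]
          · have hadj : (spanG G T).Adj (ends G e).1 (ends G e).2 := by
              rw [spanG, SimpleGraph.fromEdgeSet_adj]
              exact ⟨⟨e, he, (ends_spec G e).symm⟩, hne⟩
            have : (spanG G T).Reachable r (ends G e).1 ↔ (spanG G T).Reachable r (ends G e).2 :=
              ⟨fun h => h.trans hadj.reachable, fun h => h.trans hadj.symm.reachable⟩
            simp [w, this]
        simp only [map_apply, of_apply]
        rw [h1]
        simp [inc, sub_mul, Finset.sum_sub_distrib, h2]
  · rw [ww_zero2 _ _ h, if_neg (fun h' => h (by omega))]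
end Gr

theorem stmt0 {V : Type*} [Fintype V] (G : SimpleGraph V)
    (hconn : G.Connected) (hV : 3 ≤ Fintype.card V)
    (K : Type*) [Field K] [Fintype K] :
    (Fintype.card K) ^ 2 ∣ Xcount G K := by
  letI : Fintype G.edgeSet := Fintype.ofFinite _
  obtain ⟨r⟩ := hconn.nonempty
  have hcard : Fintype.card {v : V // v ≠ r} + 1 = Fintype.card V := by
    rw [Fintype.card_subtype_compl]
    simp; omega
  have hE : 2 ≤ Fintype.card G.edgeSet := by
    have := hconn.card_vert_le_card_edgeSet_add_one
    simp only [Nat.card_eq_fintype_card] at this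
    omega
  have h := mainLin (K := K) (m := {v : V // v ≠ r}) (s := G.edgeSet) (by omega) hE
    ((Matrix.of fun (e : G.edgeSet) (v : {v : V // v ≠ r}) => inc G e v).map (Int.cast : ℤ → K))
  unfold Xcount
  convert h using 3
  funext x
  rw [det_expand2]
  simp only [ww_graph]
  have : MvPolynomial.aeval x (graphPoly G) * sg K {v : V // v ≠ r} =
      ∑ T : Finset G.edgeSet, (∏ i ∈ Tᶜ, x i) *
        (if (spanG G T).IsTree then sg K {v : V // v ≠ r} else 0) := by
    rw [graphPoly, map_sum, Finset.sum_mul]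
    refine Finset.sum_congr rfl fun T _ => ?_
    unfold spanG
    split_ifs
    · simp
    · simp
  rw [← this]
  simp [sg_ne]
end

section
/- Let G be a connected finite simple graph. For any orientation of the edges of G and any choice of deleted vertex v₀, one has det M_G = Ψ_G. -/
open scoped Classical
open Matrix

/-- `(src, tgt)` is an orientation of the edges of `G`. -/
def IsOrientation {V : Type*} (G : SimpleGraph V) (src tgt : G.edgeSet → V) : Prop :=
  ∀ e : G.edgeSet, (e : Sym2 V) = s(src e, tgt e)

theorem det_diag_sub_aux {n R : Type*} [CommRing R] (s : Finset n) (p : n → Prop)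
    [Fintype {i // p i}] [DecidableEq {i // p i}] (hp : ∀ i, i ∈ s ↔ p i) (d : n → R) :
    (diagonal (fun i : {i // p i} => d i.1)).det = ∏ i ∈ s, d i := by
  rw [det_diagonal, Finset.prod_subtype s hp]

theorem det_expand_aux {E W R : Type*} [Fintype E] [DecidableEq E] [Fintype W] [DecidableEq W]
    [CommRing R] (x : E → R) (B : Matrix E W R) (C : Matrix W E R) :
    (fromBlocks (diagonal x) B C 0).det =
      ∑ T : Finset E, (∏ e ∈ Tᶜ, x e) *
        (fromBlocks (0 : Matrix T T R) (B.submatrix (fun e : T => (e : E)) id)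
          (C.submatrix id (fun e : T => (e : E))) 0).det := by
  have h1 : (fromBlocks (diagonal x) B C 0) =
      (fromBlocks (diagonal x) 0 0 0 : Matrix (E ⊕ W) (E ⊕ W) R) + fromBlocks 0 B C 0 := by
    rw [fromBlocks_add]; simp
  rw [h1]
  have h2 := (detRowAlternating (R := R) (n := E ⊕ W)).map_add_univ
    (fromBlocks (diagonal x) 0 0 0 : Matrix (E ⊕ W) (E ⊕ W) R) (fromBlocks 0 B C 0)
  refine h2.trans ?_
  symm
  refine Finset.sum_of_injOn (fun T : Finset E => (Tᶜ).map Function.Embedding.inl) ?_ ?_ ?_ ?_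
  · intro a _ b _ h
    simpa using h
  · intro a _; simp
  · intro s _ hs
    by_cases hw : ∃ w : W, Sum.inr w ∈ s
    · obtain ⟨w, hw⟩ := hw
      refine AlternatingMap.map_coord_zero _ (Sum.inr w) ?_
      refine (Finset.piecewise_eq_of_mem _ _ _ hw).trans ?_
      funext j
      rcases j with j | j <;> simp
    · exfalso
      push Not at hw
      apply hs
      refine ⟨(Finset.univ.filter fun e => Sum.inl e ∈ s)ᶜ, by simp, ?_⟩
      ext j
      rcases j with j | j
      · simp
      · simp [hw]
  · intro T _
    set s : Finset (E ⊕ W) := (Tᶜ).map Function.Embedding.inl with hs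
    set P : Matrix (E ⊕ W) (E ⊕ W) R := s.piecewise
      (fromBlocks (diagonal x) 0 0 0 : Matrix (E ⊕ W) (E ⊕ W) R) (fromBlocks 0 B C 0) with hP
    change _ = P.det
    have hin : ∀ i ∈ s, ∀ j, P i j = diagonal (Sum.elim x (fun _ => 0)) i j := by
      intro i hi j
      have : P i = _ := Finset.piecewise_eq_of_mem _ _ _ hi
      rw [this]
      rcases i with i | i
      · rcases j with j | j <;> simp [diagonal_apply]
      · simp [hs] at hi
    have hout : ∀ i ∉ s, ∀ j, P i j = fromBlocks 0 B C 0 i j := by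
      intro i hi j
      have : P i = _ := Finset.piecewise_eq_of_notMem _ _ _ hi
      rw [this]
    obtain ⟨p, hp⟩ : ∃ p : E ⊕ W → Prop, ∀ i, i ∈ s ↔ p i := ⟨fun i => i ∈ s, fun _ => Iff.rfl⟩
    rw [twoBlockTriangular_det' P p]
    · congr 1
      · have : P.toSquareBlockProp p =
            diagonal (fun i : {i // p i} => Sum.elim x (fun _ => 0) i.1) := by
          ext i j
          rw [toSquareBlockProp_def, of_apply, hin _ ((hp _).2 i.2)]
          by_cases h : i = j
          · subst h; rw [diagonal_apply_eq, diagonal_apply_eq]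
          · rw [diagonal_apply_ne _ h, diagonal_apply_ne _ (fun h' => h (Subtype.ext h'))]
        rw [this, det_diag_sub_aux s p hp, hs, Finset.prod_map]
        simp
      · let f : (T ⊕ W) → {i // ¬ p i} :=
          Sum.elim (fun e => ⟨Sum.inl e.1, by rw [← hp]; simp [hs]⟩)
            (fun w => ⟨Sum.inr w, by rw [← hp]; simp [hs]⟩)
        have hf : Function.Bijective f := by
          constructor
          · intro a b h
            have h' : (f a).1 = (f b).1 := congrArg Subtype.val h
            rcases a with a | a <;> rcases b with b | b
            · exact congrArg Sum.inl (Subtype.ext (Sum.inl.inj h'))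
            · cases h'
            · cases h'
            · exact congrArg Sum.inr (Sum.inr.inj h')
          · rintro ⟨i | i, hi⟩
            · have hi' : i ∈ T := by
                rw [← hp] at hi
                simpa [hs] using hi
              exact ⟨Sum.inl ⟨i, hi'⟩, rfl⟩
            · exact ⟨Sum.inr i, rfl⟩
        rw [← det_submatrix_equiv_self (Equiv.ofBijective f hf)]
        congr 1
        ext i j
        rw [submatrix_apply, toSquareBlockProp_def, of_apply,
          hout _ (fun h => (Equiv.ofBijective f hf i).2 ((hp _).1 h))]
        rcases i with i | i <;> rcases j with j | j <;> simp [f]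
    · intro i hi j hj
      rw [hin i ((hp _).2 hi), diagonal_apply_ne]
      rintro rfl
      exact hj hi

theorem det_sq_aux {n R : Type*} [Fintype n] [DecidableEq n] [CommRing R] (B C : Matrix n n R) :
    (fromBlocks 0 B (-C) 0).det = B.det * C.det := by
  have h : fromBlocks 0 B (-C) 0 * (fromBlocks 1 (-1) 0 1 * fromBlocks 1 0 1 1 *
      fromBlocks 1 (-1) 0 1 : Matrix (n ⊕ n) (n ⊕ n) R) = fromBlocks B 0 0 C := by
    simp [fromBlocks_multiply]
  have h2 := congrArg det h
  simpa [det_mul] using h2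

theorem det_wide_aux {m n : Type*} [Fintype n] [DecidableEq n] [Fintype m] [DecidableEq m]
    (B : Matrix m n ℤ) (C : Matrix n m ℤ) (h : Fintype.card n < Fintype.card m) :
    (fromBlocks 0 B C 0).det = 0 := by
  have : LinearMap.ker C.mulVecLin ≠ ⊥ := by
    intro hb
    have := LinearMap.finrank_le_finrank_of_injective (LinearMap.ker_eq_bot.1 hb)
    simp at this
    omega
  obtain ⟨y, hy, hy0⟩ := Submodule.exists_mem_ne_zero_of_ne_bot this
  rw [← exists_mulVec_eq_zero_iff]
  refine ⟨Sum.elim y 0, ?_, ?_⟩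
  · intro h0
    apply hy0
    funext i
    exact congrFun h0 (Sum.inl i)
  · rw [fromBlocks_mulVec]
    have hy' : C *ᵥ y = 0 := by simpa using hy
    funext i
    rcases i with i | i
    · simp
    · simp [hy']

def incM {E V : Type*} [DecidableEq V] (s t : E → V) (v₀ : V) : Matrix E {u : V // u ≠ v₀} ℤ :=
  of fun e w => (if s e = w then 1 else 0) - (if t e = w then 1 else 0)

theorem det_disc_aux {E V : Type*} [Fintype E] [DecidableEq E] [Fintype V] [DecidableEq V]
    (s t : E → V) (v₀ : V) (H : SimpleGraph V) (hH : ∀ e, H.Adj (s e) (t e))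
    (hc : ¬ H.Connected) (C : Matrix {u : V // u ≠ v₀} E ℤ) :
    (fromBlocks 0 (incM s t v₀) C 0).det = 0 := by
  have : ∃ u, ¬ H.Reachable v₀ u := by
    by_contra! hcon
    exact hc ((SimpleGraph.connected_iff_exists_forall_reachable H).2 ⟨v₀, hcon⟩)
  obtain ⟨u, hu⟩ := this
  let g : V → ℤ := fun w => if H.Reachable v₀ w then 0 else 1
  have hg0 : g v₀ = 0 := by simp [g]
  have key : ∀ a : V, ∑ w : {u : V // u ≠ v₀}, (if a = w then 1 else 0) * g w = g a := by
    intro a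
    by_cases ha : a = v₀
    · subst ha
      rw [hg0]
      refine Finset.sum_eq_zero fun w _ => ?_
      rw [if_neg (fun h => w.2 h.symm), zero_mul]
    · rw [Finset.sum_eq_single (⟨a, ha⟩ : {u : V // u ≠ v₀})]
      · simp
      · intro b _ hb
        rw [if_neg (fun h => hb (Subtype.ext h.symm)), zero_mul]
      · simp
  rw [← exists_mulVec_eq_zero_iff]
  refine ⟨Sum.elim 0 (fun w => g w), ?_, ?_⟩
  · intro h0
    have hu0 : u ≠ v₀ := by rintro rfl; exact hu (SimpleGraph.Reachable.refl _)
    have := congrFun h0 (Sum.inr ⟨u, hu0⟩)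
    simp [g, hu] at this
  · rw [fromBlocks_mulVec]
    funext i
    rcases i with i | i
    · have : g (s i) = g (t i) := by
        have : H.Reachable v₀ (s i) ↔ H.Reachable v₀ (t i) :=
          ⟨fun h => h.trans (hH i).reachable, fun h => h.trans (hH i).symm.reachable⟩
        simp [g, this]
      simp only [Sum.elim_inl, Pi.zero_apply, Sum.elim_comp_inl, Sum.elim_comp_inr]
      simp only [mulVec, dotProduct, Pi.add_apply, incM, of_apply, sub_mul,
        Finset.sum_sub_distrib, key, this]
      simp
    · simp

theorem det_tree_aux {E V : Type*} [Fintype E] [DecidableEq E] [Fintype V] [DecidableEq V]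
    (s t : E → V) (v₀ : V) (H : SimpleGraph V)
    (hH : ∀ a b, H.Adj a b → ∃ e, s(a, b) = s(s e, t e))
    (hc : H.Connected) (hcard : Fintype.card E = Fintype.card {u : V // u ≠ v₀}) :
    (fromBlocks 0 (incM s t v₀) (-(incM s t v₀)ᵀ) 0).det = 1 := by
  let δ : V → {u : V // u ≠ v₀} → ℤ := fun a w => if a = w then 1 else 0
  have hδ0 : δ v₀ = 0 := by
    funext w
    simp only [δ, Pi.zero_apply, ite_eq_right_iff, one_ne_zero, imp_false]
    exact fun h => w.2 h.symm
  have hrow : ∀ e, Pi.single e 1 ᵥ* incM s t v₀ = δ (s e) - δ (t e) := by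
    intro e; funext w; simp [incM, δ]
  have hreach : ∀ a b, H.Reachable a b → ∃ y : E → ℤ, y ᵥ* incM s t v₀ = δ a - δ b := by
    rintro a b ⟨p⟩
    induction p with
    | nil => exact ⟨0, by simp⟩
    | cons h p ih =>
      obtain ⟨y, hy⟩ := ih
      obtain ⟨e, he⟩ := hH _ _ h
      rcases Sym2.eq_iff.1 he with ⟨h1, h2⟩ | ⟨h1, h2⟩
      · refine ⟨Pi.single e 1 + y, ?_⟩
        rw [add_vecMul, hrow, hy, h1, h2]; abel
      · refine ⟨-Pi.single e 1 + y, ?_⟩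
        rw [add_vecMul, neg_vecMul, hrow, hy, h1, h2]; abel
  choose y hy using fun a => hreach a v₀ (hc.preconnected a v₀)
  let σ : {u : V // u ≠ v₀} ≃ E := Fintype.equivOfCardEq hcard.symm
  let B' : Matrix {u : V // u ≠ v₀} {u : V // u ≠ v₀} ℤ := (incM s t v₀).submatrix σ id
  let Y : Matrix {u : V // u ≠ v₀} {u : V // u ≠ v₀} ℤ := of fun a b => y a (σ b)
  have hYB : Y * B' = 1 := by
    ext a w
    have h := congrFun (hy a) w
    rw [hδ0, sub_zero] at h
    rw [mul_apply]
    simp only [Y, B', of_apply, submatrix_apply, id]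
    rw [Equiv.sum_comp σ (fun e => y a e * incM s t v₀ e w)]
    refine h.trans ?_
    simp [δ, one_apply, Subtype.ext_iff]
  have hdet : Y.det * B'.det = 1 := by rw [← det_mul, hYB, det_one]
  have hu : B'.det = 1 ∨ B'.det = -1 := Int.isUnit_iff.1 (IsUnit.of_mul_eq_one _ (by rw [mul_comm]; exact hdet))
  rw [← det_submatrix_equiv_self (σ.sumCongr (Equiv.refl _))]
  have : (fromBlocks 0 (incM s t v₀) (-(incM s t v₀)ᵀ) 0).submatrix (σ.sumCongr (Equiv.refl _))
      (σ.sumCongr (Equiv.refl _)) = fromBlocks 0 B' (-B'ᵀ) 0 := by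
    ext i j
    rcases i with i | i <;> rcases j with j | j <;> simp [B']
  rw [this, det_sq_aux, det_transpose]
  rcases hu with h | h <;> rw [h] <;> norm_num

theorem stmt1 {V : Type*} [Fintype V] [DecidableEq V] (G : SimpleGraph V)
    [DecidableRel G.Adj] (hG : G.Connected) (v₀ : V)
    (src tgt : G.edgeSet → V) (ho : IsOrientation G src tgt) :
    (Matrix.fromBlocks
        (Matrix.diagonal fun e : G.edgeSet =>
          (MvPolynomial.X e : MvPolynomial G.edgeSet ℤ))
        (Matrix.of fun (e : G.edgeSet) (w : {u : V // u ≠ v₀}) =>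
          if src e = ↑w then 1 else if tgt e = ↑w then -1 else 0)
        (-(Matrix.of fun (e : G.edgeSet) (w : {u : V // u ≠ v₀}) =>
          if src e = ↑w then 1 else if tgt e = ↑w then -1 else 0)ᵀ)
        0).det = graphPoly G := by
  have hne : ∀ e, src e ≠ tgt e := by
    intro e h
    have h1 := ho e
    have h2 := e.2
    rw [h1, SimpleGraph.mem_edgeSet] at h2
    exact h2.ne h
  rw [det_expand_aux, graphPoly]
  have hinst : (Fintype.ofFinite G.edgeSet) = (inferInstance : Fintype G.edgeSet) :=
    Subsingleton.elim _ _
  rw [hinst]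
  refine Finset.sum_congr (by congr) fun T _ => ?_
  set H := SimpleGraph.fromEdgeSet (Subtype.val '' (T : Set G.edgeSet)) with hHdef
  let s : T → V := fun e => src e
  let t : T → V := fun e => tgt e
  have hmat : (fromBlocks (0 : Matrix T T (MvPolynomial G.edgeSet ℤ))
      ((Matrix.of fun (e : G.edgeSet) (w : {u : V // u ≠ v₀}) =>
          if src e = ↑w then (1 : MvPolynomial G.edgeSet ℤ) else
            if tgt e = ↑w then -1 else 0).submatrix (fun e : T => (e : G.edgeSet)) id)
      ((-(Matrix.of fun (e : G.edgeSet) (w : {u : V // u ≠ v₀}) =>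
          if src e = ↑w then (1 : MvPolynomial G.edgeSet ℤ) else
            if tgt e = ↑w then -1 else 0)ᵀ).submatrix id (fun e : T => (e : G.edgeSet))) 0) =
      (Int.castRingHom (MvPolynomial G.edgeSet ℤ)).mapMatrix
        (fromBlocks 0 (incM s t v₀) (-(incM s t v₀)ᵀ) 0) := by
    have hent : ∀ (e : T) (w : {u : V // u ≠ v₀}),
        (if src e = ↑w then (1 : MvPolynomial G.edgeSet ℤ) else
            if tgt e = ↑w then -1 else 0) = ((incM s t v₀ e w : ℤ) : MvPolynomial G.edgeSet ℤ) := by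
      intro e w
      simp only [incM, of_apply, s, t]
      by_cases h1 : src e = w
      · have h2 : tgt e ≠ w := fun h => hne e (h1.trans h.symm)
        simp [h1, h2]
      · by_cases h2 : tgt e = w <;> simp [h1, h2]
    ext1 i j
    rcases i with i | i <;> rcases j with j | j
    · simp
    · simpa using hent i j
    · simpa using hent j i
    · simp
  rw [hmat, ← RingHom.map_det]
  have hmem : ∀ e : T, s(s e, t e) = (e : G.edgeSet).1 := fun e => (ho e).symm
  have hadj : ∀ e, H.Adj (s e) (t e) := by
    intro e
    rw [hHdef, SimpleGraph.fromEdgeSet_adj]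
    exact ⟨⟨e, e.2, (hmem e).symm⟩, hne e⟩
  have hadj' : ∀ a b, H.Adj a b → ∃ e, s(a, b) = s(s e, t e) := by
    intro a b h
    rw [hHdef, SimpleGraph.fromEdgeSet_adj] at h
    obtain ⟨⟨e, he, heq⟩, -⟩ := h
    exact ⟨⟨e, he⟩, by rw [hmem]; exact heq.symm⟩
  have hedge : H.edgeSet = Subtype.val '' (T : Set G.edgeSet) := by
    rw [hHdef, SimpleGraph.edgeSet_fromEdgeSet, sdiff_eq_left, Set.disjoint_left]
    rintro _ ⟨e, -, rfl⟩ hd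
    exact G.not_isDiag_of_mem_edgeSet e.2 hd
  have hcE : Nat.card H.edgeSet = Fintype.card T := by
    rw [hedge, Nat.card_image_of_injective Subtype.val_injective]
    simp
  have hcV : Fintype.card {u : V // u ≠ v₀} + 1 = Nat.card V := by
    have : 0 < Fintype.card V := Fintype.card_pos_iff.2 ⟨v₀⟩
    simp [Fintype.card_subtype_compl]
    omega
  split_ifs with hT
  · rw [det_tree_aux s t v₀ H hadj' hT.connected]
    · rw [map_one, mul_one]
      refine Finset.prod_congr ?_ (fun _ _ => rfl)
      ext e
      simp
    · have := (SimpleGraph.isTree_iff_connected_and_card.1 hT).2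
      omega
  · have : (fromBlocks 0 (incM s t v₀) (-(incM s t v₀)ᵀ) 0).det = 0 := by
      by_cases hc : H.Connected
      · apply det_wide_aux
        have h1 := hc.card_vert_le_card_edgeSet_add_one
        have h2 : ¬ (Nat.card H.edgeSet + 1 = Nat.card V) := fun h =>
          hT (SimpleGraph.isTree_iff_connected_and_card.2 ⟨hc, h⟩)
        omega
      · exact det_disc_aux s t v₀ H hadj hc _
    rw [this]
    simp
end

section
/- Let Γ be a completed primitive graph and v any vertex of Γ. Then the graph Γ∖v obtained by deleting v and all edges incident to it is connected, lies in φ⁴ theory, and is primitive-divergent. -/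
open scoped Classical
open Matrix

/-- The first Betti number of the subgraph spanned by an edge set `S`
(isolated vertices of `fromEdgeSet S` cancel in `|S| - |V| + #components`). -/
noncomputable def edgeBetti {V : Type*} [Fintype V] (S : Set (Sym2 V)) : ℤ :=
  (Nat.card S : ℤ) - (Fintype.card V : ℤ) +
    (Nat.card (SimpleGraph.fromEdgeSet S).ConnectedComponent : ℤ)

/-- A connected graph is primitive-divergent if `N_G = 2 h_G` and every subgraph spanned
by a proper non-empty subset of the edges satisfies `N_γ > 2 h_γ`. -/
def IsPrimitiveDivergent {V : Type*} [Fintype V] (G : SimpleGraph V) : Prop :=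
  G.Connected ∧
  (Nat.card G.edgeSet : ℤ) = 2 * ((Nat.card G.edgeSet : ℤ) - (Fintype.card V : ℤ) + 1) ∧
  ∀ S : Set (Sym2 V), S ⊆ G.edgeSet → S.Nonempty → S ≠ G.edgeSet →
    2 * edgeBetti S < (Nat.card S : ℤ)

/-- A graph is in φ⁴ theory if every vertex has degree at most 4. -/
def InPhi4 {V : Type*} (G : SimpleGraph V) : Prop :=
  ∀ v : V, Nat.card (G.neighborSet v) ≤ 4

/-- A connected 4-regular simple graph with at least 5 vertices is completed primitive if
removing any 4 edges leaves it either connected or with an isolated vertex. -/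
def IsCompletedPrimitive {W : Type*} [Fintype W] (Γ : SimpleGraph W) : Prop :=
  Γ.Connected ∧ (∀ w : W, Nat.card (Γ.neighborSet w) = 4) ∧ 5 ≤ Fintype.card W ∧
  ∀ C : Set (Sym2 W), C ⊆ Γ.edgeSet → Nat.card C = 4 →
    (Γ.deleteEdges C).Connected ∨ ∃ w : W, ∀ u : W, ¬ (Γ.deleteEdges C).Adj w u

/-- `Γ ∖ v`: delete the vertex `v` and all incident edges. -/
def delVert {W : Type*} (Γ : SimpleGraph W) (v : W) : SimpleGraph ↥{u : W | u ≠ v} :=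
  SimpleGraph.induce {u : W | u ≠ v} Γ


noncomputable def cutD {W : Type*} [Fintype W] (Γ : SimpleGraph W) (A : Finset W) : ℕ :=
  ∑ u ∈ A, ∑ w ∈ Aᶜ, if Γ.Adj u w then 1 else 0

noncomputable def cutE {W : Type*} [Fintype W] (Γ : SimpleGraph W) (A : Finset W) :
    Finset (Sym2 W) :=
  ((A ×ˢ Aᶜ).filter (fun p => Γ.Adj p.1 p.2)).image (fun p => s(p.1, p.2))

lemma mem_cutE {W : Type*} [Fintype W] (Γ : SimpleGraph W) (A : Finset W) (e : Sym2 W) :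
    e ∈ cutE Γ A ↔ ∃ a b, a ∈ A ∧ b ∉ A ∧ Γ.Adj a b ∧ s(a, b) = e := by
  simp [cutE, and_assoc]

lemma card_cutE {W : Type*} [Fintype W] (Γ : SimpleGraph W) (A : Finset W) :
    (cutE Γ A).card = cutD Γ A := by
  unfold cutE cutD
  rw [Finset.card_image_of_injOn, Finset.card_filter, Finset.sum_product]
  rintro ⟨a, b⟩ h ⟨c, d⟩ h' heq
  simp at h h' heq
  rcases heq with ⟨rfl, rfl⟩ | ⟨rfl, rfl⟩
  · rfl
  · tauto

lemma cutD_compl {W : Type*} [Fintype W] (Γ : SimpleGraph W) (A : Finset W) :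
    cutD Γ Aᶜ = cutD Γ A := by
  unfold cutD
  rw [Finset.sum_comm, compl_compl]
  simp only [Γ.adj_comm]

lemma conn_closed {V : Type*} {G : SimpleGraph V} (hG : G.Connected) (P : V → Prop)
    (hP : ∀ x y, G.Adj x y → P x → P y) (a b : V) (ha : P a) : P b := by
  obtain ⟨p⟩ := hG.preconnected a b
  induction p with
  | nil => exact ha
  | cons h p ih => exact ih (hP _ _ h ha)

lemma sum_adj {W : Type*} [Fintype W] {Γ : SimpleGraph W}
    (hr : ∀ w : W, Nat.card (Γ.neighborSet w) = 4) (w : W) :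
    ∑ u, (if Γ.Adj w u then 1 else 0) = 4 := by
  rw [← Finset.card_filter, ← hr w, Nat.card_eq_fintype_card, ← Set.toFinset_card]
  congr 1
  ext; simp

lemma deg_four {W : Type*} [Fintype W] {Γ : SimpleGraph W}
    (hr : ∀ w : W, Nat.card (Γ.neighborSet w) = 4) (w : W) : Γ.degree w = 4 := by
  rw [← hr w, Nat.card_eq_fintype_card, SimpleGraph.card_neighborSet_eq_degree]

lemma sum_inner_cut {W : Type*} [Fintype W] {Γ : SimpleGraph W}
    (hr : ∀ w : W, Nat.card (Γ.neighborSet w) = 4) (A : Finset W) :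
    ∑ u ∈ A, ∑ w ∈ A, (if Γ.Adj u w then 1 else 0) + cutD Γ A = 4 * A.card := by
  unfold cutD
  rw [← Finset.sum_add_distrib]
  simp only [Finset.sum_add_sum_compl, sum_adj hr]
  simp [mul_comm]

lemma star {W : Type*} [Fintype W] {Γ : SimpleGraph W} (hΓ : IsCompletedPrimitive Γ)
    (A : Finset W) (hA : A.Nonempty) (hA' : Aᶜ.Nonempty) (X : Finset (Sym2 W))
    (hX : X ⊆ Γ.edgeFinset) (hc : X.card ≤ 4) (hT : cutE Γ A ⊆ X) :
    ∃ w, (∀ e ∈ X, w ∈ e) ∧ (X.card = 4 → ∀ u, Γ.Adj w u → s(w, u) ∈ X) := by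
  obtain ⟨hcon, hr, h5, hcut⟩ := hΓ
  have hE : 4 ≤ Γ.edgeFinset.card := by
    have := Γ.sum_degrees_eq_twice_card_edges
    simp [deg_four hr] at this
    omega
  obtain ⟨C, hXC, hCE, hC4⟩ := Finset.exists_subsuperset_card_eq hX hc hE
  obtain ⟨a, ha⟩ := hA
  obtain ⟨b, hb⟩ := hA'
  rw [Finset.mem_compl] at hb
  rcases hcut (C : Set (Sym2 W)) (by intro e he; simpa using hCE he) (by simpa using hC4) with h | ⟨w, hw⟩
  · exfalso
    refine hb (conn_closed h (· ∈ A) ?_ a b ha)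
    intro x y hxy hx
    by_contra hy
    rw [SimpleGraph.deleteEdges_adj] at hxy
    exact hxy.2 (hXC (hT ((mem_cutE _ _ _).2 ⟨x, y, hx, hy, hxy.1, rfl⟩)))
  · have hsub : ∀ u, Γ.Adj w u → s(w, u) ∈ C := by
      intro u hu
      by_contra hn
      exact hw u (by rw [SimpleGraph.deleteEdges_adj]; exact ⟨hu, hn⟩)
    have hinc : Γ.incidenceFinset w = C := by
      apply Finset.eq_of_subset_of_card_le
      · intro e he
        rw [SimpleGraph.mem_incidenceFinset] at he
        induction e with | _ p q =>
        obtain ⟨h1, h2⟩ := he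
        simp at h1 h2
        rcases h2 with rfl | rfl
        · exact hsub _ h1
        · rw [Sym2.eq_swap]; exact hsub _ h1.symm
      · rw [hC4, SimpleGraph.card_incidenceFinset_eq_degree, deg_four hr]
    refine ⟨w, fun e he => ?_, fun h4 => ?_⟩
    · have := hXC he
      rw [← hinc, SimpleGraph.mem_incidenceFinset] at this
      exact this.2
    · have : X = C := Finset.eq_of_subset_of_card_le hXC (by omega)
      rw [this]; exact hsub

lemma cut_ge_four {W : Type*} [Fintype W] {Γ : SimpleGraph W} (hΓ : IsCompletedPrimitive Γ)
    (A : Finset W) (hA : A.Nonempty) (hA' : Aᶜ.Nonempty) : 4 ≤ cutD Γ A := by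
  by_contra hlt
  rw [← card_cutE] at hlt
  have hTE : cutE Γ A ⊆ Γ.edgeFinset := by
    intro e he
    obtain ⟨a, b, -, -, h, rfl⟩ := (mem_cutE _ _ _).1 he
    simpa using h
  -- a crossing edge
  obtain ⟨a, b, ha, hb, hab⟩ : ∃ a b, a ∈ A ∧ b ∉ A ∧ Γ.Adj a b := by
    by_contra hno
    push Not at hno
    obtain ⟨a, ha⟩ := hA
    obtain ⟨b, hb⟩ := hA'
    rw [Finset.mem_compl] at hb
    refine hb (conn_closed hΓ.1 (· ∈ A) ?_ a b ha)
    intro x y hxy hx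
    by_contra hy
    exact hno x y hx hy hxy
  have habT : s(a, b) ∈ cutE Γ A := (mem_cutE _ _ _).2 ⟨a, b, ha, hb, hab, rfl⟩
  have key : ∀ p : W, ∃ x, Γ.Adj p x ∧ s(p, x) ∉ cutE Γ A := by
    intro p
    by_contra hno
    push Not at hno
    have : Γ.incidenceFinset p ⊆ cutE Γ A := by
      intro e he
      rw [SimpleGraph.mem_incidenceFinset] at he
      induction e with | _ r q =>
      obtain ⟨h1, h2⟩ := he
      simp at h1 h2
      rcases h2 with rfl | rfl
      · exact hno _ h1
      · rw [Sym2.eq_swap]; exact hno _ h1.symm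
    have := Finset.card_le_card this
    rw [SimpleGraph.card_incidenceFinset_eq_degree, deg_four hΓ.2.1] at this
    omega
  have key2 : ∀ p q : W, s(p, q) ∈ cutE Γ A → ∀ e ∈ cutE Γ A, p ∈ e := by
    intro p q hpq e he
    obtain ⟨x, hx, hxT⟩ := key p
    obtain ⟨w, hw, -⟩ := star hΓ A hA hA' (insert s(p, x) (cutE Γ A))
      (by
        intro e he
        rcases Finset.mem_insert.1 he with rfl | he
        · simpa using hx
        · exact hTE he)
      (by have := Finset.card_insert_le s(p, x) (cutE Γ A); omega)
      (Finset.subset_insert _ _)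
    have h1 := hw _ (Finset.mem_insert_self _ _)
    have h2 := hw _ (Finset.mem_insert_of_mem hpq)
    have h3 := hw _ (Finset.mem_insert_of_mem he)
    have hxq : x ≠ q := by rintro rfl; exact hxT hpq
    simp at h1 h2
    have : w = p := by
      rcases h1 with h1 | h1
      · exact h1
      · rcases h2 with h2 | h2
        · exact h2
        · exact absurd (h1.symm.trans h2) hxq
    exact this ▸ h3
  have hT1 : cutE Γ A ⊆ {s(a, b)} := by
    intro e he
    have h1 := key2 a b habT e he
    have h2 := key2 b a (Sym2.eq_swap ▸ habT) e he
    rw [Finset.mem_singleton]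
    exact ((Sym2.mem_and_mem_iff hab.ne).1 ⟨h1, h2⟩)
  obtain ⟨x, hx, hxT⟩ := key a
  obtain ⟨y, hy, hyT⟩ := key b
  obtain ⟨w, hw, -⟩ := star hΓ A hA hA' {s(a, b), s(a, x), s(b, y)}
      (by
        intro e he
        simp only [Finset.mem_insert, Finset.mem_singleton] at he
        rcases he with rfl | rfl | rfl
        · simpa using hab
        · simpa using hx
        · simpa using hy)
      (Finset.card_le_three.trans (by norm_num))
      (hT1.trans (by simp))
  have h1 := hw s(a, b) (by simp)
  have h2 := hw s(a, x) (by simp)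
  have h3 := hw s(b, y) (by simp)
  have hxb : x ≠ b := by rintro rfl; exact hxT habT
  have hya : y ≠ a := by rintro rfl; exact hyT (Sym2.eq_swap ▸ habT)
  have := hab.ne
  simp at h1 h2 h3
  grind

lemma cut_ge_five_aux {W : Type*} [Fintype W] {Γ : SimpleGraph W} (hΓ : IsCompletedPrimitive Γ)
    (A : Finset W) (hA : 2 ≤ A.card) (hA' : Aᶜ.Nonempty) (w : W) (hwA : w ∈ A)
    (hw : ∀ e ∈ cutE Γ A, w ∈ e) (hw' : ∀ u, Γ.Adj w u → s(w, u) ∈ cutE Γ A) : False := by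
  have h4 : 4 ≤ cutD Γ (A.erase w) := by
    apply cut_ge_four hΓ
    · rw [← Finset.card_pos, Finset.card_erase_of_mem hwA]; omega
    · exact ⟨w, by simp⟩
  have h0 : cutD Γ (A.erase w) = 0 := by
    rw [← card_cutE, Finset.card_eq_zero, Finset.eq_empty_iff_forall_notMem]
    intro e he
    obtain ⟨a, b, ha, hb, hab, rfl⟩ := (mem_cutE _ _ _).1 he
    rw [Finset.mem_erase] at ha hb
    by_cases hbw : b = w
    · subst hbw
      obtain ⟨p, q, hp, hq, hpq, heq⟩ := (mem_cutE _ _ _).1 (hw' a hab.symm)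
      simp at heq
      grind
    · have := hw s(a, b) ((mem_cutE _ _ _).2 ⟨a, b, ha.2, by tauto, hab, rfl⟩)
      simp at this
      grind
  omega

lemma cutE_compl {W : Type*} [Fintype W] (Γ : SimpleGraph W) (A : Finset W) :
    cutE Γ Aᶜ = cutE Γ A := by
  ext e
  simp only [mem_cutE, Finset.mem_compl, not_not]
  constructor <;> rintro ⟨a, b, h1, h2, h3, h4⟩ <;>
    exact ⟨b, a, h2, h1, h3.symm, Sym2.eq_swap.trans h4⟩

lemma cut_ge_five {W : Type*} [Fintype W] {Γ : SimpleGraph W} (hΓ : IsCompletedPrimitive Γ)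
    (A : Finset W) (hA : 2 ≤ A.card) (hA' : 2 ≤ Aᶜ.card) : 5 ≤ cutD Γ A := by
  have n1 : A.Nonempty := Finset.card_pos.1 (by omega)
  have n2 : Aᶜ.Nonempty := Finset.card_pos.1 (by omega)
  have h4 := cut_ge_four hΓ A n1 n2
  by_contra hlt
  have hc : (cutE Γ A).card = 4 := by rw [card_cutE]; omega
  have hTE : cutE Γ A ⊆ Γ.edgeFinset := by
    intro e he
    obtain ⟨a, b, -, -, h, rfl⟩ := (mem_cutE _ _ _).1 he
    simpa using h
  obtain ⟨w, hw, hw'⟩ := star hΓ A n1 n2 (cutE Γ A) hTE hc.le subset_rfl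
  by_cases hwA : w ∈ A
  · exact cut_ge_five_aux hΓ A hA n2 w hwA hw (hw' hc)
  · refine cut_ge_five_aux hΓ Aᶜ hA' (by simpa using n1) w (by simpa using hwA) ?_ ?_
    · rw [cutE_compl]; exact hw
    · rw [cutE_compl]; exact hw' hc

lemma cutD_single {W : Type*} [Fintype W] {Γ : SimpleGraph W}
    (hr : ∀ w : W, Nat.card (Γ.neighborSet w) = 4) (v : W) : cutD Γ {v} = 4 := by
  have := sum_inner_cut hr {v}
  simp [Finset.filter_singleton] at this
  exact this

/-- Embedding of vertex sets. -/
noncomputable def up {W : Type*} (v : W) (K : Finset ↥{u : W | u ≠ v}) : Finset W :=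
  K.map (Function.Embedding.subtype _)

lemma del_conn {W : Type*} [Fintype W] {Γ : SimpleGraph W} (hΓ : IsCompletedPrimitive Γ) (v : W) :
    (delVert Γ v).Connected := by
  have h5 := hΓ.2.2.1
  have hne : Nonempty ↥{u : W | u ≠ v} := by
    have : Nontrivial W := Fintype.one_lt_card_iff_nontrivial.1 (by omega)
    obtain ⟨u, hu⟩ := exists_ne v
    exact ⟨⟨u, hu⟩⟩
  rw [SimpleGraph.connected_iff]
  refine ⟨fun a b => ?_, hne⟩
  by_contra hab
  let A : Finset W := Finset.univ.filter (fun u => ∃ h : u ≠ v, (delVert Γ v).Reachable a ⟨u, h⟩)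
  let B : Finset W := Finset.univ.filter (fun u => ∃ h : u ≠ v, ¬ (delVert Γ v).Reachable a ⟨u, h⟩)
  have hAm : ∀ u, u ∈ A ↔ ∃ h : u ≠ v, (delVert Γ v).Reachable a ⟨u, h⟩ := by simp [A]
  have hBm : ∀ u, u ∈ B ↔ ∃ h : u ≠ v, ¬ (delVert Γ v).Reachable a ⟨u, h⟩ := by simp [B]
  have hvA : v ∉ A := by rw [hAm]; rintro ⟨h, -⟩; exact h rfl
  have hvB : v ∉ B := by rw [hBm]; rintro ⟨h, -⟩; exact h rfl
  have haA : (a : W) ∈ A := (hAm _).2 ⟨a.2, SimpleGraph.Reachable.refl _⟩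
  have hbB : (b : W) ∈ B := (hBm _).2 ⟨b.2, hab⟩
  have hd : Disjoint A B := by
    rw [Finset.disjoint_left]
    intro u h1 h2
    obtain ⟨h, h1⟩ := (hAm _).1 h1
    obtain ⟨_, h2⟩ := (hBm _).1 h2
    exact h2 h1
  have hAB : ∀ x ∈ A, ∀ y, y ≠ v → Γ.Adj x y → y ∈ A := by
    intro x hx y hy hxy
    obtain ⟨h, h1⟩ := (hAm _).1 hx
    refine (hAm _).2 ⟨hy, h1.trans (SimpleGraph.Adj.reachable ?_)⟩
    simpa [delVert] using hxy
  have hBA : ∀ x ∈ B, ∀ y, y ≠ v → Γ.Adj x y → y ∈ B := by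
    intro x hx y hy hxy
    obtain ⟨h, h1⟩ := (hBm _).1 hx
    refine (hBm _).2 ⟨hy, fun h2 => ?_⟩
    have := hAB y ((hAm _).2 ⟨hy, h2⟩) x h hxy.symm
    exact h1 ((hAm _).1 this).2
  have e : ∀ D : Finset W, v ∉ D → (∀ x ∈ D, ∀ y, y ≠ v → Γ.Adj x y → y ∈ D) →
      cutD Γ D = ∑ u ∈ D, if Γ.Adj v u then 1 else 0 := by
    intro D hv hD
    unfold cutD
    refine Finset.sum_congr rfl fun u hu => ?_
    rw [Finset.sum_eq_single v]
    · simp only [Γ.adj_comm]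
    · intro y hy hyv
      rw [if_neg]
      intro h
      exact (Finset.mem_compl.1 hy) (hD u hu y hyv h)
    · intro h; simp at h; exact absurd h hv
  have hA4 := cut_ge_four hΓ A ⟨_, haA⟩ ⟨v, by simpa using hvA⟩
  have hB4 := cut_ge_four hΓ B ⟨_, hbB⟩ ⟨v, by simpa using hvB⟩
  rw [e A hvA hAB] at hA4
  rw [e B hvB hBA] at hB4
  have hs : ∑ u ∈ A ∪ B, (if Γ.Adj v u then 1 else 0) ≤ 4 := by
    rw [← sum_adj hΓ.2.1 v]
    exact Finset.sum_le_sum_of_subset (Finset.subset_univ _)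
  rw [Finset.sum_union hd] at hs
  omega

lemma card_edges {V : Type*} [Fintype V] (G : SimpleGraph V) :
    2 * Nat.card G.edgeSet = ∑ u, ∑ w, (if G.Adj u w then 1 else 0) := by
  have := G.sum_degrees_eq_twice_card_edges
  rw [Nat.card_eq_fintype_card, ← SimpleGraph.edgeFinset_card]
  rw [← this]
  refine Finset.sum_congr rfl fun u _ => ?_
  rw [← Finset.card_filter, ← SimpleGraph.card_neighborFinset_eq_degree]
  congr 1
  ext; simp

lemma inner_up {W : Type*} [Fintype W] {Γ : SimpleGraph W} (hΓ : IsCompletedPrimitive Γ) (v : W)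
    (K : Finset ↥{u : W | u ≠ v}) :
    ∑ u ∈ K, ∑ w ∈ K, (if (delVert Γ v).Adj u w then 1 else 0) + cutD Γ (up v K) = 4 * K.card := by
  have := sum_inner_cut hΓ.2.1 (up v K)
  simp only [up, Finset.sum_map, Finset.card_map] at this ⊢
  convert this using 2
  refine Finset.sum_congr rfl fun u _ => Finset.sum_congr rfl fun w _ => ?_
  simp only [delVert, SimpleGraph.comap_adj]

lemma del_edges {W : Type*} [Fintype W] {Γ : SimpleGraph W} (hΓ : IsCompletedPrimitive Γ) (v : W) :
    2 * Nat.card (delVert Γ v).edgeSet + 4 = 4 * Fintype.card ↥{u : W | u ≠ v} := by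
  have h := inner_up hΓ v Finset.univ
  have : up v Finset.univ = {v}ᶜ := by ext; simp [up]
  rw [this, cutD_compl, cutD_single hΓ.2.1, ← card_edges] at h
  exact h

lemma del_sub {W : Type*} [Fintype W] {Γ : SimpleGraph W} (hΓ : IsCompletedPrimitive Γ) (v : W)
    (S : Set (Sym2 ↥{u : W | u ≠ v})) (hS : S ⊆ (delVert Γ v).edgeSet) (hne : S.Nonempty)
    (hp : S ≠ (delVert Γ v).edgeSet) : 2 * edgeBetti S < (Nat.card S : ℤ) := by
  unfold edgeBetti
  have hE := del_edges hΓ v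
  set H := SimpleGraph.fromEdgeSet S with hH
  have hHS : H.edgeSet = S := by
    rw [hH, SimpleGraph.edgeSet_fromEdgeSet]
    ext e
    simp only [Set.mem_sdiff]
    refine ⟨fun h => h.1, fun h => ⟨h, ?_⟩⟩
    exact (delVert Γ v).not_isDiag_of_mem_edgeSet (hS h)
  have hHle : ∀ a b, H.Adj a b → (delVert Γ v).Adj a b := by
    intro a b h
    have h' : s(a, b) ∈ H.edgeSet := h
    rw [hHS] at h'
    exact hS h'
  have hHE := card_edges H
  rw [hHS] at hHE
  by_cases hc : H.Connected
  · have h1 : Nat.card H.ConnectedComponent = 1 := by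
      have := hc.preconnected.subsingleton_connectedComponent
      have := hc.nonempty
      obtain ⟨x⟩ := this
      rw [Nat.card_eq_one_iff_unique]
      exact ⟨inferInstance, ⟨H.connectedComponentMk x⟩⟩
    have h2 : Nat.card S < Nat.card (delVert Γ v).edgeSet := by
      rw [Nat.card_coe_set_eq, Nat.card_coe_set_eq]
      exact Set.ncard_lt_ncard (lt_of_le_of_ne hS hp) (Set.toFinite _)
    rw [h1]
    push_cast
    omega
  · let K : H.ConnectedComponent → Finset ↥{u : W | u ≠ v} := fun c =>
      Finset.univ.filter (fun u => H.connectedComponentMk u = c)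
    have hKm : ∀ c u, u ∈ K c ↔ H.connectedComponentMk u = c := by simp [K]
    have hKne : ∀ c, (K c).Nonempty := by
      intro c
      induction c using SimpleGraph.ConnectedComponent.ind with | _ u =>
      exact ⟨u, by simp [K]⟩
    have hvK : ∀ c, v ∈ (up v (K c))ᶜ := by intro c; simp [up]
    have hKc : ∀ c, 2 ≤ (up v (K c))ᶜ.card := by
      intro c
      obtain ⟨x, hx⟩ : ∃ x, x ∉ K c := by
        by_contra hno
        push Not at hno
        apply hc
        obtain ⟨a, ha⟩ := hKne c
        rw [SimpleGraph.connected_iff]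
        refine ⟨fun p q => ?_, ⟨a⟩⟩
        rw [← SimpleGraph.ConnectedComponent.eq, (hKm _ _).1 (hno p), (hKm _ _).1 (hno q)]
      have hx' : (x : W) ∈ (up v (K c))ᶜ := by
        simp only [up, Finset.mem_compl, Finset.mem_map, not_exists, not_and]
        rintro y hy h
        exact hx (Subtype.ext h ▸ hy)
      exact Finset.one_lt_card.2 ⟨x, hx', v, hvK c, x.2⟩
    have hupne : ∀ c, (up v (K c)).Nonempty := by intro c; simpa [up] using hKne c
    have hupc : ∀ c, (up v (K c)).card = (K c).card := by intro c; simp [up]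
    have hin : ∀ c, ∑ u ∈ K c, ∑ w, (if H.Adj u w then 1 else 0) ≤
        ∑ u ∈ K c, ∑ w ∈ K c, (if (delVert Γ v).Adj u w then 1 else 0) := by
      intro c
      refine Finset.sum_le_sum fun u hu => ?_
      rw [← Finset.sum_subset (Finset.subset_univ (K c))]
      · refine Finset.sum_le_sum fun w _ => ?_
        by_cases h : H.Adj u w
        · simp [h, hHle _ _ h]
        · simp [h]
      · intro w _ hw
        rw [if_neg]
        intro h
        apply hw
        rw [hKm] at hu ⊢
        rw [← hu]
        exact (SimpleGraph.ConnectedComponent.eq.2 h.reachable).symm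
    have hle : ∀ c, ∑ u ∈ K c, ∑ w, (if H.Adj u w then 1 else 0) + 4 ≤ 4 * (K c).card := by
      intro c
      have h1 := inner_up hΓ v (K c)
      have h2 := cut_ge_four hΓ (up v (K c)) (hupne c) ⟨v, hvK c⟩
      have := hin c
      omega
    have hlt : ∃ c, ∑ u ∈ K c, ∑ w, (if H.Adj u w then 1 else 0) + 4 < 4 * (K c).card := by
      obtain ⟨e, he⟩ := hne
      induction e with | _ p q =>
      have hpq : H.Adj p q := by
        rw [← hHS] at he; exact he
      refine ⟨H.connectedComponentMk p, ?_⟩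
      have h1 := inner_up hΓ v (K (H.connectedComponentMk p))
      have h3 : 2 ≤ (K (H.connectedComponentMk p)).card :=
        Finset.one_lt_card.2 ⟨p, by simp [K], q, by
          rw [hKm]; exact (SimpleGraph.ConnectedComponent.eq.2 hpq.reachable).symm, hpq.ne⟩
      have h2 := cut_ge_five hΓ (up v (K (H.connectedComponentMk p))) (by rw [hupc]; exact h3) (hKc _)
      have := hin (H.connectedComponentMk p)
      omega
    obtain ⟨c, hlt⟩ := hlt
    have hsum := Finset.sum_lt_sum (fun c _ => hle c) ⟨c, Finset.mem_univ c, hlt⟩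
    have hf1 : ∑ c, ∑ u ∈ K c, ∑ w, (if H.Adj u w then 1 else 0) =
        ∑ u, ∑ w, (if H.Adj u w then 1 else 0) :=
      Finset.sum_fiberwise _ _ _
    have hf2 : ∑ c, (K c).card = Fintype.card ↥{u : W | u ≠ v} := by
      rw [← Finset.card_univ]
      exact (Finset.card_eq_sum_card_fiberwise (fun _ _ => Finset.mem_coe.2 (Finset.mem_univ _))).symm
    rw [Finset.sum_add_distrib, hf1, ← Finset.mul_sum, hf2] at hsum
    have hHE' : 2 * Nat.card S = ∑ u, ∑ w, (if H.Adj u w then 1 else 0) := by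
      convert hHE
    rw [← hHE'] at hsum
    simp only [Finset.sum_const, Finset.card_univ, smul_eq_mul] at hsum
    rw [Nat.card_eq_fintype_card (α := H.ConnectedComponent)]
    omega

theorem stmt2 {W : Type*} [Fintype W] (Γ : SimpleGraph W)
    (hΓ : IsCompletedPrimitive Γ) (v : W) :
    (delVert Γ v).Connected ∧ InPhi4 (delVert Γ v) ∧ IsPrimitiveDivergent (delVert Γ v) := by
  refine ⟨del_conn hΓ v, ?_, del_conn hΓ v, ?_, ?_⟩
  · intro u
    rw [← hΓ.2.1 (u : W)]
    refine Nat.card_le_card_of_injective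
      (fun w => ⟨(w.1 : W), by have := w.2; simpa [delVert] using this⟩) ?_
    intro x y h
    simpa [Subtype.ext_iff] using h
  · have := del_edges hΓ v
    omega
  · intro S h1 h2 h3
    convert del_sub hΓ v S h1 h2 h3
end

section
/- Let Γ be a completed primitive graph and let v, w be any two vertices of Γ. Then the integrand of the period integral of Γ∖v is Lebesgue integrable over the open positive orthant (so P(Γ∖v) converges to a positive real number), the value P(Γ∖v) does not depend on which edge is chosen as the last edge e_N (set equal to 1), and P(Γ∖v) = P(Γ∖w). -/
open scoped Classical
open Matrix

/-- The period integral of `G` with the variable of the edge `e₀` set to `1`,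
integrated over the open positive orthant in the remaining edge variables. -/
noncomputable def graphPeriod {V : Type*} [Fintype V] (G : SimpleGraph V)
    (e₀ : G.edgeSet) : ℝ :=
  letI : Fintype G.edgeSet := Fintype.ofFinite _
  ∫ x in (Set.univ.pi fun _ : {e : G.edgeSet // e ≠ e₀} => Set.Ioi (0 : ℝ)),
    1 / (MvPolynomial.aeval (fun e : G.edgeSet =>
      if h : e = e₀ then (1 : ℝ) else x ⟨e, h⟩) (graphPoly G)) ^ 2

/-- Lebesgue integrability of the period integrand over the open positive orthant. -/
def PeriodIntegrable {V : Type*} [Fintype V] (G : SimpleGraph V) (e₀ : G.edgeSet) : Prop :=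
  letI : Fintype G.edgeSet := Fintype.ofFinite _
  MeasureTheory.IntegrableOn
    (fun x : {e : G.edgeSet // e ≠ e₀} → ℝ =>
      1 / (MvPolynomial.aeval (fun e : G.edgeSet =>
        if h : e = e₀ then (1 : ℝ) else x ⟨e, h⟩) (graphPoly G)) ^ 2)
    (Set.univ.pi fun _ => Set.Ioi (0 : ℝ))


theorem cb_expand {R E U : Type*} [CommRing R] [Fintype E] [DecidableEq E] [Fintype U]
    (b : E → U → R) (α : E → R) :
    (Matrix.of fun i k => ∑ e, α e * (b e i * b e k)).det =
      ∑ S : Finset E, (∏ e ∈ S, α e) *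
        ∑ p : U → E with Function.Injective p ∧ Finset.univ.image p = S,
          (∏ i, b (p i) i) * (Matrix.of fun i => b (p i)).det := by
  have h1 : (Matrix.of fun i k => ∑ e, α e * (b e i * b e k)).det =
      ∑ p : U → E, (∏ i, α (p i) * b (p i) i) * (Matrix.of fun i => b (p i)).det := by
    have : (Matrix.of fun i k => ∑ e, α e * (b e i * b e k)) =
        fun i => ∑ e, (α e * b e i) • b e := by
      ext i k
      simp [Finset.sum_apply, mul_assoc]
    rw [this]
    change Matrix.detRowAlternating.toMultilinearMap _ = _
    rw [MultilinearMap.map_sum]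
    refine Finset.sum_congr rfl fun p _ => ?_
    rw [MultilinearMap.map_smul_univ]
    rfl
  rw [h1]
  have h2 : ∀ p : U → E, ¬ Function.Injective p →
      (∏ i, α (p i) * b (p i) i) * (Matrix.of fun i => b (p i)).det = 0 := by
    intro p hp
    rw [Function.not_injective_iff] at hp
    obtain ⟨i, k, h, hne⟩ := hp
    rw [Matrix.det_zero_of_row_eq hne, mul_zero]
    ext u; simp [h]
  rw [← Finset.sum_filter_add_sum_filter_not Finset.univ (fun p : U → E => Function.Injective p)]
  rw [Finset.sum_eq_zero (s := Finset.univ.filter (fun p : U → E => ¬ Function.Injective p))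
    (fun p hp => h2 p (Finset.mem_filter.1 hp).2), add_zero]
  rw [← Finset.sum_fiberwise _ (fun p : U → E => Finset.univ.image p)]
  refine Finset.sum_congr rfl fun S _ => ?_
  rw [Finset.mul_sum, Finset.filter_filter]
  refine Finset.sum_congr rfl fun p hp => ?_
  obtain ⟨hp1, hp2⟩ := (Finset.mem_filter.1 hp).2
  rw [Finset.prod_mul_distrib, ← hp2, Finset.prod_image hp1.injOn, mul_assoc]

theorem cb_coeff {R E U : Type*} [CommRing R] [Fintype E] [DecidableEq E] [Fintype U]
    (b : E → U → R) (p₀ : U → E) (hp₀ : Function.Injective p₀) :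
    (∑ p : U → E with Function.Injective p ∧ Finset.univ.image p = Finset.univ.image p₀,
          (∏ i, b (p i) i) * (Matrix.of fun i => b (p i)).det) =
      (Matrix.of fun i => b (p₀ i)).det ^ 2 := by
  have h : (Matrix.of fun i => b (p₀ i)).det ^ 2 = ∑ σ : Equiv.Perm U,
      (∏ i, b (p₀ (σ i)) i) * (Matrix.of fun i => b (p₀ (σ i))).det := by
    rw [sq]
    nth_rw 1 [Matrix.det_apply]
    rw [Finset.sum_mul]
    refine Finset.sum_congr rfl fun σ _ => ?_
    have := Matrix.det_permute σ (Matrix.of fun i => b (p₀ i))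
    have h3 : (Matrix.of fun i => b (p₀ (σ i))) = (Matrix.of fun i => b (p₀ i)).submatrix σ id := rfl
    rw [h3, this]
    simp only [Matrix.of_apply, Units.smul_def, zsmul_eq_mul]
    ring
  rw [h]
  symm
  refine Finset.sum_bij (fun σ _ => p₀ ∘ σ) ?_ ?_ ?_ ?_
  · intro σ _
    simp only [Finset.mem_filter, Finset.mem_univ, true_and]
    refine ⟨hp₀.comp σ.injective, ?_⟩
    ext x
    simp only [Finset.mem_image, Finset.mem_univ, true_and, Function.comp]
    exact ⟨fun ⟨a, h⟩ => ⟨_, h⟩, fun ⟨a, h⟩ => ⟨σ.symm a, by simpa using h⟩⟩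
  · intro σ _ τ _ h
    ext i
    exact hp₀ (congrFun h i)
  · intro p hp
    obtain ⟨hp1, hp2⟩ := (Finset.mem_filter.1 hp).2
    have : ∀ i, ∃ k, p₀ k = p i := fun i => by
      have : p i ∈ Finset.univ.image p₀ := hp2 ▸ Finset.mem_image_of_mem _ (Finset.mem_univ _)
      simpa using this
    choose f hf using this
    have hinj : Function.Injective f := fun i k h => hp1 (by rw [← hf, ← hf, h])
    refine ⟨Equiv.ofBijective f (Finite.injective_iff_bijective.1 hinj), Finset.mem_univ _, ?_⟩
    ext i; simp [hf]
  · intro σ _; rfl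


noncomputable def eSrc {V : Type*} {G : SimpleGraph V} (e : G.edgeSet) : V := (Quot.out e.1).1
noncomputable def eTgt {V : Type*} {G : SimpleGraph V} (e : G.edgeSet) : V := (Quot.out e.1).2

theorem eMk {V : Type*} {G : SimpleGraph V} (e : G.edgeSet) : s(eSrc e, eTgt e) = e.1 :=
  Quot.out_eq e.1

theorem eAdj {V : Type*} {G : SimpleGraph V} (e : G.edgeSet) : G.Adj (eSrc e) (eTgt e) := by
  rw [← SimpleGraph.mem_edgeSet, eMk]; exact e.2

/-- subgraph spanned by a set of edges -/
def subG {V : Type*} {G : SimpleGraph V} (S : Finset G.edgeSet) : SimpleGraph V :=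
  SimpleGraph.fromEdgeSet (Subtype.val '' (S : Set G.edgeSet))

theorem subG_edgeSet {V : Type*} {G : SimpleGraph V} (S : Finset G.edgeSet) :
    (subG S).edgeSet = Subtype.val '' (S : Set G.edgeSet) := by
  unfold subG
  rw [SimpleGraph.edgeSet_fromEdgeSet]
  ext e
  simp only [Set.mem_sdiff]
  constructor
  · exact fun h => h.1
  · intro h
    refine ⟨h, ?_⟩
    obtain ⟨f, _, rfl⟩ := h
    exact G.not_isDiag_of_mem_edgeSet f.2

theorem subG_card {V : Type*} {G : SimpleGraph V} (S : Finset G.edgeSet) :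
    Nat.card (subG S).edgeSet = S.card := by
  rw [subG_edgeSet, Nat.card_image_of_injective Subtype.val_injective]
  simp

theorem subG_adj {V : Type*} {G : SimpleGraph V} {S : Finset G.edgeSet} {x y : V} :
    (subG S).Adj x y ↔ ∃ e ∈ S, e.1 = s(x, y) := by
  rw [← SimpleGraph.mem_edgeSet, subG_edgeSet]
  simp

theorem subG_adj_of_mem {V : Type*} {G : SimpleGraph V} {S : Finset G.edgeSet} {e : G.edgeSet}
    (he : e ∈ S) : (subG S).Adj (eSrc e) (eTgt e) :=
  subG_adj.2 ⟨e, he, (eMk e).symm⟩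

theorem subG_isTree {V : Type*} [Fintype V] {G : SimpleGraph V} (S : Finset G.edgeSet) :
    (subG S).IsTree ↔ (subG S).Connected ∧ S.card + 1 = Fintype.card V := by
  rw [SimpleGraph.isTree_iff_connected_and_card, subG_card, Nat.card_eq_fintype_card]

/-- delta vector of a vertex -/
noncomputable def dVec {V U : Type*} (j : U → V) (x : V) : U → ℤ := fun u => if j u = x then 1 else 0

noncomputable def bVec {V U : Type*} (j : U → V) {G : SimpleGraph V} (e : G.edgeSet) : U → ℤ :=
  dVec j (eSrc e) - dVec j (eTgt e)

structure IsPin {V U : Type*} (j : U → V) (a : V) : Prop where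
  inj : Function.Injective j
  na : ∀ u, j u ≠ a
  surj : ∀ x, x ≠ a → ∃ u, j u = x

theorem IsPin.card {V U : Type*} [Fintype V] [Fintype U] {j : U → V} {a : V} (h : IsPin j a) :
    Fintype.card U + 1 = Fintype.card V := by
  rw [← Fintype.card_option]
  refine Fintype.card_congr (Equiv.ofBijective (fun o : Option U => o.elim a j) ⟨?_, ?_⟩)
  · rintro (_ | x) (_ | y) hxy
    · rfl
    · exact absurd hxy.symm (h.na y)
    · exact absurd hxy (h.na x)
    · exact congrArg some (h.inj hxy)
  · intro x
    by_cases hx : x = a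
    · exact ⟨none, hx.symm⟩
    · obtain ⟨u, hu⟩ := h.surj x hx
      exact ⟨some u, hu⟩

theorem det_unit {V U : Type*} [Fintype V] [Fintype U] {G : SimpleGraph V} {j : U → V} {a : V}
    (h : IsPin j a) (S : Finset G.edgeSet) (p : U → G.edgeSet)
    (hS : Finset.univ.image p = S) (hc : (subG S).Connected) :
    IsUnit (Matrix.of fun i => bVec j (p i)).det := by
  rw [← Matrix.isUnit_iff_isUnit_det, ← Matrix.vecMul_surjective_iff_isUnit]
  set B := (Matrix.of fun i => bVec j (p i)) with hB
  have key : ∀ x y, (subG S).Reachable x y → dVec j x - dVec j y ∈ LinearMap.range B.vecMulLinear := by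
    rintro x y ⟨w⟩
    induction w with
    | nil => simp
    | cons hadj _ ih =>
      rename_i x y z _
      have : dVec j x - dVec j y ∈ LinearMap.range B.vecMulLinear := by
        obtain ⟨e, he, hxy⟩ := subG_adj.1 hadj
        rw [← hS] at he
        obtain ⟨i, _, hi⟩ := Finset.mem_image.1 he
        have hr : bVec j e ∈ LinearMap.range B.vecMulLinear := by
          refine ⟨Pi.single i 1, ?_⟩
          simp only [Matrix.vecMulLinear_apply, Matrix.single_one_vecMul]
          rw [← hi]; rfl
        rw [← eMk, Sym2.eq_iff] at hxy
        rcases hxy with ⟨h1, h2⟩ | ⟨h1, h2⟩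
        · rw [← h1, ← h2]; exact hr
        · rw [← h1, ← h2, ← neg_sub]; exact neg_mem hr
      have := add_mem this ih
      simpa using this
  have hda : dVec j a = 0 := by
    ext u; simp [dVec, h.na u]
  intro y
  have hy : y ∈ LinearMap.range B.vecMulLinear := by
    have : y = ∑ u, y u • (dVec j (j u) - dVec j a) := by
      ext k
      simp [hda, dVec, Finset.sum_apply, h.inj.eq_iff]
    rw [this]
    exact sum_mem fun u _ => Submodule.smul_mem _ _ (key _ _ (hc.preconnected _ _))
  obtain ⟨z, hz⟩ := hy
  exact ⟨z, by simpa using hz⟩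

theorem dVec_dot {V U R : Type*} [CommRing R] [Fintype U] {j : U → V} {a : V}
    (h : IsPin j a) (Y : V → R) (hY : Y a = 0) (x : V) :
    ∑ u, (dVec j x u : R) * Y (j u) = Y x := by
  by_cases hx : x = a
  · subst hx; simp [dVec, h.na, hY]
  · obtain ⟨u, rfl⟩ := h.surj x hx
    rw [Finset.sum_eq_single u]
    · simp [dVec]
    · intro k _ hk; simp [dVec, h.inj.ne hk]
    · simp

theorem det_zero {V U : Type*} [Fintype V] [Fintype U] {G : SimpleGraph V} {j : U → V} {a : V}
    (h : IsPin j a) (S : Finset G.edgeSet) (p : U → G.edgeSet)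
    (hS : Finset.univ.image p = S) (hc : ¬ (subG S).Connected) :
    (Matrix.of fun i => bVec j (p i)).det = 0 := by
  have : ∃ x, ¬ (subG S).Reachable a x := by
    by_contra hcon
    push Not at hcon
    apply hc
    rw [SimpleGraph.connected_iff]
    exact ⟨fun x y => (hcon x).symm.trans (hcon y), ⟨a⟩⟩
  obtain ⟨x, hx⟩ := this
  set Y : V → ℤ := fun z => if (subG S).Reachable a z then 0 else 1 with hYdef
  have hYa : Y a = 0 := by simp [hYdef]
  rw [← Matrix.exists_mulVec_eq_zero_iff]
  refine ⟨fun u => Y (j u), ?_, ?_⟩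
  · have hxa : x ≠ a := by rintro rfl; exact hx (SimpleGraph.Reachable.refl _)
    obtain ⟨u, rfl⟩ := h.surj x hxa
    intro h0
    have := congrFun h0 u
    simp [hYdef, hx] at this
  · ext i
    have hadj : (subG S).Adj (eSrc (p i)) (eTgt (p i)) :=
      subG_adj_of_mem (hS ▸ Finset.mem_image_of_mem _ (Finset.mem_univ _))
    have h1 := dVec_dot h Y hYa (eSrc (p i))
    have h2 := dVec_dot h Y hYa (eTgt (p i))
    have h3 : Y (eSrc (p i)) = Y (eTgt (p i)) := by
      simp only [hYdef]
      congr 1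
      exact propext ⟨fun q => q.trans hadj.reachable, fun q => q.trans hadj.symm.reachable⟩
    simp only [Matrix.mulVec, dotProduct, Matrix.of_apply, bVec, Pi.sub_apply, sub_mul,
      Finset.sum_sub_distrib, Pi.zero_apply]
    simp only [Int.cast_id] at h1 h2
    rw [h1, h2, h3, sub_self]

noncomputable def kPoly {V : Type*} (G : SimpleGraph V) [Fintype G.edgeSet] (α : G.edgeSet → ℝ) : ℝ :=
  ∑ T : Finset G.edgeSet, if (subG T).IsTree then ∏ e ∈ T, α e else 0

noncomputable def lap {V U : Type*} (j : U → V) (G : SimpleGraph V) [Fintype G.edgeSet]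
    (α : G.edgeSet → ℝ) : Matrix U U ℝ :=
  Matrix.of fun i k => ∑ e : G.edgeSet, α e * ((bVec j e i : ℝ) * (bVec j e k : ℝ))

theorem matrix_tree {V U : Type*} [Fintype V] [Fintype U] {G : SimpleGraph V} [Fintype G.edgeSet]
    {j : U → V} {a : V} (h : IsPin j a) (α : G.edgeSet → ℝ) :
    (lap j G α).det = kPoly G α := by
  unfold lap kPoly
  rw [cb_expand (fun (e : G.edgeSet) i => (bVec j e i : ℝ)) α]
  refine Finset.sum_congr rfl fun S _ => ?_
  by_cases hcard : S.card = Fintype.card U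
  · obtain ⟨p₀, hp⟩ : ∃ p₀ : U → G.edgeSet, Function.Injective p₀ ∧ Finset.univ.image p₀ = S := by
      have e : U ≃ S := Fintype.equivOfCardEq (by simp [hcard])
      refine ⟨fun u => (e u).1, fun x y hxy => e.injective (Subtype.ext hxy), ?_⟩
      ext x
      simp only [Finset.mem_image, Finset.mem_univ, true_and]
      exact ⟨fun ⟨u, hu⟩ => hu ▸ (e u).2, fun hx => ⟨e.symm ⟨x, hx⟩, by simp⟩⟩
    have := cb_coeff (fun (e : G.edgeSet) i => (bVec j e i : ℝ)) p₀ hp.1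
    rw [hp.2] at this
    rw [this]
    have hmap : (Matrix.of fun i => (fun k => (bVec j (p₀ i) k : ℝ))) =
        (Matrix.of fun i => bVec j (p₀ i)).map (Int.castRingHom ℝ) := by
      ext i k; rfl
    have hdet : (Matrix.of fun i => (fun k => (bVec j (p₀ i) k : ℝ))).det =
        (((Matrix.of fun i => bVec j (p₀ i)).det : ℤ) : ℝ) := by
      rw [hmap]
      exact ((Int.castRingHom ℝ).map_det _).symm
    rw [hdet]
    by_cases hc : (subG S).Connected
    · have ht : (subG S).IsTree := (subG_isTree S).2 ⟨hc, by rw [hcard, h.card]⟩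
      have hu := det_unit h S p₀ hp.2 hc
      have h2 : (Matrix.of fun i => bVec j (p₀ i)).det ^ 2 = 1 := by
        rcases Int.isUnit_iff.1 hu with h | h <;> simp [h]
      rw [if_pos ht]
      have : (((Matrix.of fun i => bVec j (p₀ i)).det : ℤ) : ℝ) ^ 2 = 1 := by exact_mod_cast h2
      rw [this, mul_one]
    · rw [det_zero h S p₀ hp.2 hc, if_neg (fun ht => hc ((subG_isTree S).1 ht).1)]
      simp
  · rw [if_neg]
    · rw [Finset.sum_eq_zero, mul_zero]
      intro p hp
      exfalso
      obtain ⟨hp1, hp2⟩ := (Finset.mem_filter.1 hp).2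
      apply hcard
      rw [← hp2, Finset.card_image_of_injective _ hp1, Finset.card_univ]
    · intro ht
      have := ((subG_isTree S).1 ht).2
      rw [← h.card] at this
      omega


open MeasureTheory in
theorem lintegral_fin_prod' {n : ℕ} {X : Type*} [MeasurableSpace X] (μ : Fin n → Measure X)
    [∀ i, SigmaFinite (μ i)] (f : Fin n → X → ENNReal) (hf : ∀ i, Measurable (f i)) :
    ∫⁻ x, ∏ i, f i (x i) ∂(Measure.pi μ) = ∏ i, ∫⁻ x, f i x ∂(μ i) := by
  induction n with
  | zero => simp
  | succ n ih =>
    rw [← ((measurePreserving_piFinSuccAbove μ 0).symm).lintegral_comp_emb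
      (MeasurableEquiv.measurableEmbedding _)]
    simp_rw [MeasurableEquiv.piFinSuccAbove_symm_apply, Fin.insertNthEquiv,
            Fin.prod_univ_succ, Fin.insertNth_zero, Equiv.coe_fn_mk, Fin.cons_succ, Fin.cons_zero]
    rw [← ih (fun i => μ i.succ) (fun i => f i.succ) (fun i => hf _)]
    rw [← lintegral_prod_mul (hf 0).aemeasurable]
    · rfl
    · exact (Finset.measurable_prod _ fun i _ => (hf _).comp (measurable_pi_apply _)).aemeasurable

open MeasureTheory in
theorem lintegral_fintype_prod' {ι X : Type*} [Fintype ι] [MeasurableSpace X] (μ : ι → Measure X)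
    [∀ i, SigmaFinite (μ i)] (f : ι → X → ENNReal) (hf : ∀ i, Measurable (f i)) :
    ∫⁻ x, ∏ i, f i (x i) ∂(Measure.pi μ) = ∏ i, ∫⁻ x, f i x ∂(μ i) := by
  let e := (Fintype.equivFin ι).symm
  rw [← (measurePreserving_piCongrLeft μ e).lintegral_comp_emb
      (MeasurableEquiv.measurableEmbedding _)]
  simp_rw [← e.prod_comp, MeasurableEquiv.coe_piCongrLeft]
  have : ∀ (x : Fin (Fintype.card ι) → X) i,
      (Equiv.piCongrLeft (fun _ : ι => X) e) x (e i) = x i := fun x i =>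
    Equiv.piCongrLeft_apply_apply (fun _ : ι => X) e x i
  simp_rw [this]
  exact lintegral_fin_prod' (fun i => μ (e i)) (fun i => f (e i)) (fun i => hf _)

open MeasureTheory in
theorem pi_withDensity' {ι X : Type*} [Fintype ι] [MeasurableSpace X] (μ : Measure X)
    [SigmaFinite μ] (f : X → ENNReal) (hf : Measurable f) [SigmaFinite (μ.withDensity f)] :
    Measure.pi (fun _ : ι => μ.withDensity f) =
      (Measure.pi (fun _ : ι => μ)).withDensity (fun x => ∏ i, f (x i)) := by
  refine Measure.pi_eq fun s hs => ?_
  rw [withDensity_apply _ (MeasurableSet.univ_pi hs), ← lintegral_indicator (MeasurableSet.univ_pi hs)]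
  have : (fun x : ι → X => (Set.univ.pi s).indicator (fun x => ∏ i, f (x i)) x) =
      fun x => ∏ i, (s i).indicator f (x i) := by
    ext x
    by_cases hx : x ∈ Set.univ.pi s
    · rw [Set.indicator_of_mem hx]
      exact Finset.prod_congr rfl fun i _ => (Set.indicator_of_mem (hx i trivial) _).symm
    · rw [Set.indicator_of_notMem hx]
      simp only [Set.mem_univ_pi, not_forall] at hx
      obtain ⟨i, hi⟩ := hx
      exact (Finset.prod_eq_zero (Finset.mem_univ i) (Set.indicator_of_notMem hi _)).symm
  rw [this, lintegral_fintype_prod' _ _ fun i => hf.indicator (hs i)]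
  exact Finset.prod_congr rfl fun i _ => by
    rw [lintegral_indicator (hs i), withDensity_apply _ (hs i)]

abbrev E4 := EuclideanSpace ℝ (Fin 4)

noncomputable def inv4 (x : E4) : E4 := (‖x‖ ^ 2)⁻¹ • x

theorem inv4_eq : inv4 = EuclideanGeometry.inversion (0 : E4) 1 := by
  ext1 x
  simp [inv4, EuclideanGeometry.inversion, dist_zero_right]

theorem inv4_inv4 (x : E4) : inv4 (inv4 x) = x := by
  rw [inv4_eq]
  exact EuclideanGeometry.inversion_inversion _ one_ne_zero _

theorem inv4_zero : inv4 0 = 0 := by simp [inv4]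

theorem inv4_ne {x : E4} (hx : x ≠ 0) : inv4 x ≠ 0 := fun h => hx (by rw [← inv4_inv4 x, h, inv4_zero])

theorem inv4_measurable : Measurable inv4 := by
  unfold inv4; fun_prop

theorem inv4_norm (x : E4) : ‖inv4 x‖ ^ 2 = (‖x‖ ^ 2)⁻¹ := by
  unfold inv4
  by_cases hx : x = 0
  · simp [hx]
  have : ‖x‖ ≠ 0 := norm_ne_zero_iff.2 hx
  rw [norm_smul, Real.norm_of_nonneg (by positivity)]
  field_simp

theorem inv4_dist {x y : E4} (hx : x ≠ 0) (hy : y ≠ 0) :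
    ‖inv4 x - inv4 y‖ ^ 2 = ‖x - y‖ ^ 2 * ((‖x‖ ^ 2)⁻¹ * (‖y‖ ^ 2)⁻¹) := by
  have := EuclideanGeometry.dist_inversion_inversion hx hy 1
  rw [← inv4_eq, dist_zero_right, dist_zero_right, dist_eq_norm, dist_eq_norm] at this
  rw [this]
  have : ‖x‖ ≠ 0 := norm_ne_zero_iff.2 hx
  have : ‖y‖ ≠ 0 := norm_ne_zero_iff.2 hy
  field_simp

theorem inv4_smul (t : ℝ) (x : E4) : inv4 (t⁻¹ • x) = t • inv4 x := by
  unfold inv4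
  by_cases ht : t = 0
  · simp [ht]
  by_cases hx : x = 0
  · simp [hx]
  have : ‖x‖ ≠ 0 := norm_ne_zero_iff.2 hx
  rw [norm_smul, smul_smul, smul_smul]
  congr 1
  simp only [norm_inv, Real.norm_eq_abs, mul_pow, inv_pow, sq_abs]
  field_simp

/-- density for the inversion -/
noncomputable def rho4 (x : E4) : ENNReal := ENNReal.ofReal (((‖x‖ ^ 2)⁻¹) ^ 4)

theorem rho4_measurable : Measurable rho4 := by unfold rho4; fun_prop

open MeasureTheory in
theorem inv4_mp : MeasurePreserving inv4 ((volume : Measure E4).withDensity rho4) volume := by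
  refine ⟨inv4_measurable, ?_⟩
  ext s hs
  rw [Measure.map_apply inv4_measurable hs, withDensity_apply _ (inv4_measurable hs)]
  have hinj : Function.Injective inv4 := fun x y h => by rw [← inv4_inv4 x, h, inv4_inv4]
  set t : Set E4 := inv4 ⁻¹' s \ {0} with ht
  have htm : MeasurableSet t := (inv4_measurable hs).diff (measurableSet_singleton 0)
  have h1 : ∫⁻ a in inv4 ⁻¹' s, rho4 a = ∫⁻ a in t, rho4 a := by
    refine setLIntegral_congr ?_
    rw [ht]
    exact (sdiff_null_ae_eq_self (by simp)).symm
  have h2 : inv4 '' t = s \ {0} := by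
    ext y
    constructor
    · rintro ⟨x, ⟨hx1, hx2⟩, rfl⟩
      exact ⟨hx1, inv4_ne hx2⟩
    · rintro ⟨hy1, hy2⟩
      exact ⟨inv4 y, ⟨by simpa [inv4_inv4] using hy1, inv4_ne hy2⟩, inv4_inv4 y⟩
  have h3 := lintegral_abs_det_fderiv_eq_addHaar_image (volume : Measure E4) htm
    (f := inv4) (f' := fun x => (1 / dist x 0) ^ 2 • ((ℝ ∙ (x - 0))ᗮ.reflection : E4 →L[ℝ] E4))
    (fun x hx => by
      rw [inv4_eq]
      exact (EuclideanGeometry.hasFDerivAt_inversion hx.2).hasFDerivWithinAt) hinj.injOn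
  rw [h2] at h3
  rw [h1, ← measure_congr (sdiff_null_ae_eq_self (s := s) (t := {0}) (μ := (volume : Measure E4)) (by simp)), ← h3]
  refine setLIntegral_congr_fun htm fun x hx => ?_
  unfold rho4
  congr 1
  have hdet : |(((ℝ ∙ (x - 0))ᗮ.reflection : E4 →L[ℝ] E4)).det| = 1 := by
    have h5 := Submodule.det_reflection (ℝ ∙ (x - 0))ᗮ
    have h6 : (((ℝ ∙ (x - 0))ᗮ.reflection : E4 →L[ℝ] E4)).det = (-1) ^ Module.finrank ℝ (ℝ ∙ (x - 0))ᗮᗮ := h5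
    rw [h6]
    simp
  rw [ContinuousLinearMap.det, ContinuousLinearMap.toLinearMap_smul, LinearMap.det_smul, abs_mul]
  rw [ContinuousLinearMap.det] at hdet
  rw [hdet]
  simp

open MeasureTheory in
theorem inv4_pi_lintegral {U : Type*} [Fintype U] (g : (U → E4) → ENNReal) (hg : Measurable g) :
    ∫⁻ x, g x = ∫⁻ x : U → E4, (∏ u, rho4 (x u)) * g (fun u => inv4 (x u)) := by
  have : SigmaFinite ((volume : Measure E4).withDensity rho4) :=
    SigmaFinite.withDensity_ofReal (f := fun x : E4 => ((‖x‖ ^ 2)⁻¹) ^ 4)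
  have h := measurePreserving_pi (fun _ : U => (volume : Measure E4).withDensity rho4)
    (fun _ : U => (volume : Measure E4)) (f := fun _ => inv4) (fun _ => inv4_mp)
  have h2 := h.lintegral_comp hg
  rw [pi_withDensity' _ _ rho4_measurable, lintegral_withDensity_eq_lintegral_mul] at h2
  · exact h2.symm
  · exact Finset.measurable_prod _ fun i _ => rho4_measurable.comp (measurable_pi_apply _)
  · exact hg.comp h.measurable


noncomputable def actA {U : Type*} [Fintype U] (A : Matrix U U ℝ) : (U → E4) →ₗ[ℝ] (U → E4) where
  toFun x := fun i => ∑ k, A i k • x k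
  map_add' x y := by ext i; simp [Finset.sum_add_distrib]
  map_smul' c x := by
    ext i
    simp [Finset.mul_sum, mul_left_comm]

noncomputable def flatE (U : Type*) : (U → E4) ≃ₗ[ℝ] (U × Fin 4 → ℝ) where
  toFun x := fun p => x p.1 p.2
  invFun y := fun u => WithLp.toLp 2 (fun i => y (u, i))
  map_add' x y := by ext i; simp
  map_smul' c x := by ext i; simp
  left_inv x := by ext i k; simp
  right_inv x := by ext i; simp

open scoped Kronecker in
theorem actA_det {U : Type*} [Fintype U] (A : Matrix U U ℝ) :
    LinearMap.det (actA A) = A.det ^ 4 := by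
  rw [← LinearMap.det_conj (actA A) (flatE U)]
  have : ((flatE U).toLinearMap ∘ₗ (actA A) ∘ₗ (flatE U).symm.toLinearMap) =
      Matrix.toLin' (A ⊗ₖ (1 : Matrix (Fin 4) (Fin 4) ℝ)) := by
    ext p k
    obtain ⟨u, i⟩ := p
    obtain ⟨u', i'⟩ := k
    simp [flatE, actA, Matrix.kroneckerMap_apply, Matrix.one_apply, Pi.single_apply]
    by_cases h : u = u' <;> by_cases h2 : i = i' <;> simp [h, h2, eq_comm]
  rw [this, LinearMap.det_toLin', Matrix.det_kronecker]
  simp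

theorem quad_expand {U I : Type*} [Fintype U] [Fintype I] (α : I → ℝ) (c : I → U → ℝ) (x : U → E4) :
    ∑ e, α e * ‖∑ u, c e u • x u‖ ^ 2 =
      ∑ i, ∑ k, (∑ e, α e * (c e i * c e k)) * inner ℝ (x i) (x k) := by
  simp_rw [← real_inner_self_eq_norm_sq, sum_inner, inner_sum, real_inner_smul_left,
    real_inner_smul_right, Finset.mul_sum, Finset.sum_mul]
  rw [Finset.sum_comm]
  refine Finset.sum_congr rfl fun i _ => ?_
  rw [Finset.sum_comm]
  refine Finset.sum_congr rfl fun k _ => ?_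
  exact Finset.sum_congr rfl fun e _ => by ring

open MeasureTheory in
noncomputable def gC (U : Type*) [Fintype U] : ENNReal :=
  ∫⁻ x : U → E4, ENNReal.ofReal (Real.exp (-∑ u, ‖x u‖ ^ 2))

open MeasureTheory in
theorem gC_eq (U : Type*) [Fintype U] :
    gC U = ∏ _u : U, ∫⁻ x : E4, ENNReal.ofReal (Real.exp (-‖x‖ ^ 2)) := by
  unfold gC
  rw [← lintegral_fintype_prod' (fun _ : U => (volume : Measure E4))
    (fun _ x => ENNReal.ofReal (Real.exp (-‖x‖ ^ 2))) (fun _ => by fun_prop)]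
  refine lintegral_congr fun x => ?_
  rw [← ENNReal.ofReal_prod_of_nonneg (fun _ _ => (Real.exp_pos _).le), ← Real.exp_sum]
  simp

open MeasureTheory in
theorem gauss1 : (∫⁻ x : E4, ENNReal.ofReal (Real.exp (-‖x‖ ^ 2))) ≠ 0 ∧
    (∫⁻ x : E4, ENNReal.ofReal (Real.exp (-‖x‖ ^ 2))) ≠ ⊤ := by
  have h := GaussianFourier.integral_rexp_neg_mul_sq_norm (V := E4) (b := 1) one_pos
  have hpos : 0 < ∫ v : E4, Real.exp (-1 * ‖v‖ ^ 2) := by rw [h]; positivity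
  simp only [neg_mul, one_mul] at hpos
  have hint : Integrable (fun v : E4 => Real.exp (-‖v‖ ^ 2)) := by
    by_contra hc
    rw [integral_undef hc] at hpos
    exact lt_irrefl _ hpos
  rw [← ofReal_integral_eq_lintegral_ofReal hint (Filter.Eventually.of_forall fun _ => (Real.exp_pos _).le)]
  exact ⟨by simpa using hpos, ENNReal.ofReal_ne_top⟩

theorem gC_ne_zero (U : Type*) [Fintype U] : gC U ≠ 0 := by
  rw [gC_eq]; exact Finset.prod_ne_zero_iff.2 fun _ _ => gauss1.1

theorem gC_ne_top (U : Type*) [Fintype U] : gC U ≠ ⊤ := by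
  rw [gC_eq]; exact ENNReal.prod_ne_top fun _ _ => gauss1.2

open MeasureTheory in
theorem gauss_quad {U I : Type*} [Fintype U] [Fintype I] (α : I → ℝ) (hα : ∀ e, 0 ≤ α e)
    (c : I → U → ℝ) (hdet : (Matrix.of fun i k => ∑ e, α e * (c e i * c e k)).det ≠ 0) :
    ∫⁻ x : U → E4, ENNReal.ofReal (Real.exp (-∑ e, α e * ‖∑ u, c e u • x u‖ ^ 2)) =
      ENNReal.ofReal (1 / (Matrix.of fun i k => ∑ e, α e * (c e i * c e k)).det ^ 2) * gC U := by
  set L : Matrix U U ℝ := (Matrix.of fun i k => ∑ e, α e * (c e i * c e k)) with hL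
  have hps : L.PosSemidef := by
    have h := Matrix.posSemidef_conjTranspose_mul_self
      (Matrix.of fun (e : I) (i : U) => Real.sqrt (α e) * c e i)
    convert! h using 1
    ext i k
    simp only [hL, Matrix.mul_apply, Matrix.conjTranspose_apply, Matrix.of_apply, star_trivial]
    refine Finset.sum_congr rfl fun e _ => ?_
    nth_rw 1 [← Real.mul_self_sqrt (hα e)]
    ring
  obtain ⟨A, hA⟩ : ∃ A : Matrix U U ℝ, L = Aᵀ * A := by
    open scoped MatrixOrder Matrix.Norms.L2Operator in
    obtain ⟨A, hA⟩ := CStarAlgebra.nonneg_iff_eq_star_mul_self.mp hps.nonneg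
    exact ⟨A, by rw [hA, Matrix.star_eq_conjTranspose, Matrix.conjTranspose_eq_transpose_of_trivial]⟩
  have hdA : L.det = A.det ^ 2 := by rw [hA, Matrix.det_mul, Matrix.det_transpose, sq]
  have hA0 : A.det ≠ 0 := fun h => hdet (by rw [hdA, h]; simp)
  have hq : ∀ x : U → E4, ∑ e, α e * ‖∑ u, c e u • x u‖ ^ 2 = ∑ u, ‖actA A x u‖ ^ 2 := by
    intro x
    have h1 := quad_expand α c x
    have h2 := quad_expand (fun _ => 1) (fun i k => A i k) x
    rw [h1]
    simp only [one_mul] at h2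
    change _ = ∑ u, ‖∑ k, A u k • x k‖ ^ 2
    rw [h2]
    refine Finset.sum_congr rfl fun i _ => Finset.sum_congr rfl fun k _ => ?_
    congr 1
    have := congrFun (congrFun hA i) k
    simpa [hL, Matrix.mul_apply] using this
  simp_rw [hq]
  have hf : LinearMap.det (actA A) ≠ 0 := by rw [actA_det]; exact pow_ne_zero _ hA0
  have hmap := Measure.map_linearMap_addHaar_eq_smul_addHaar (volume : Measure (U → E4)) hf
  have hmeas : Measurable (actA A) := (LinearMap.continuous_of_finiteDimensional _).measurable
  have hg : Measurable (fun x : U → E4 => ENNReal.ofReal (Real.exp (-∑ u, ‖x u‖ ^ 2))) := by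
    fun_prop
  rw [← lintegral_map (f := fun x : U → E4 => ENNReal.ofReal (Real.exp (-∑ u, ‖x u‖ ^ 2))) hg hmeas,
    hmap, lintegral_smul_measure]
  rw [smul_eq_mul]
  congr 2
  rw [actA_det, hdA, abs_of_nonneg (by positivity)]
  ring

noncomputable def posX {V U : Type*} (j : U → V) (x : U → E4) : V → E4 := Function.extend j x 0

noncomputable def qE {V U : Type*} (j : U → V) {G : SimpleGraph V} (x : U → E4) (e : G.edgeSet) : ℝ :=
  ‖posX j x (eSrc e) - posX j x (eTgt e)‖ ^ 2

theorem posX_eq {V U : Type*} [Fintype U] {j : U → V} {a : V}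
    (h : IsPin j a) (x : U → E4) (z : V) : ∑ u, (dVec j z u : ℝ) • x u = posX j x z := by
  by_cases hx : z = a
  · subst hx
    unfold posX
    rw [Function.extend_apply' _ _ _ (fun ⟨u, hu⟩ => h.na u hu)]
    simp [dVec, h.na]
  · obtain ⟨u, rfl⟩ := h.surj z hx
    unfold posX
    rw [h.inj.extend_apply, Finset.sum_eq_single u]
    · simp [dVec]
    · intro k _ hk; simp [dVec, h.inj.ne hk]
    · simp

open MeasureTheory in
theorem gauss_graph {V U : Type*} [Fintype V] [Fintype U] {G : SimpleGraph V} [Fintype G.edgeSet]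
    {j : U → V} {a : V} (h : IsPin j a) (α : G.edgeSet → ℝ) (hα : ∀ e, 0 ≤ α e)
    (hK : kPoly G α ≠ 0) :
    ∫⁻ x : U → E4, ENNReal.ofReal (Real.exp (-∑ e, α e * qE j x e)) =
      ENNReal.ofReal (1 / kPoly G α ^ 2) * gC U := by
  have hd := matrix_tree (G := G) h α
  have := gauss_quad α hα (fun e u => (bVec j e u : ℝ)) (by change (lap j G α).det ≠ 0; rwa [hd])
  change _ = ENNReal.ofReal (1 / (lap j G α).det ^ 2) * gC U at this
  rw [hd] at this
  rw [← this]
  refine lintegral_congr fun x => ?_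
  congr 3
  refine Finset.sum_congr rfl fun e _ => ?_
  unfold qE
  rw [← posX_eq h, ← posX_eq h, ← Finset.sum_sub_distrib]
  congr 4
  ext1 u
  simp [bVec, sub_smul]


open MeasureTheory in
theorem lint_inv_exp {q : ℝ} (hq : 0 < q) :
    ∫⁻ t in Set.Ioi (0:ℝ), ENNReal.ofReal ((t ^ 2)⁻¹ * Real.exp (-(t⁻¹ * q))) =
      ENNReal.ofReal q⁻¹ := by
  have h1 : ∫⁻ s in Set.Ioi (0:ℝ), ENNReal.ofReal (Real.exp (-q * s)) = ENNReal.ofReal q⁻¹ := by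
    rw [← ofReal_integral_eq_lintegral_ofReal (integrableOn_exp_mul_Ioi (by linarith) 0)
      (Filter.Eventually.of_forall fun _ => (Real.exp_pos _).le),
      integral_exp_mul_Ioi (by linarith)]
    simp
  rw [← h1]
  have himg : (fun t : ℝ => t⁻¹) '' Set.Ioi 0 = Set.Ioi 0 := by
    ext y
    constructor
    · rintro ⟨x, hx, rfl⟩; exact Set.mem_Ioi.2 (inv_pos.2 (Set.mem_Ioi.1 hx))
    · intro hy; exact ⟨y⁻¹, Set.mem_Ioi.2 (inv_pos.2 (Set.mem_Ioi.1 hy)), inv_inv y⟩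
  have h2 := lintegral_image_eq_lintegral_abs_deriv_mul (s := Set.Ioi (0:ℝ)) (f := fun t => t⁻¹)
    (f' := fun t => -(t ^ 2)⁻¹) measurableSet_Ioi
    (fun x hx => (hasDerivAt_inv (ne_of_gt hx)).hasDerivWithinAt)
    (inv_injective.injOn) (fun s => ENNReal.ofReal (Real.exp (-q * s)))
  rw [himg] at h2
  rw [h2]
  refine setLIntegral_congr_fun measurableSet_Ioi fun t ht => ?_
  have : 0 < t := ht
  rw [abs_neg, abs_of_pos (by positivity), ENNReal.ofReal_mul (by positivity)]
  congr 3
  ring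

open MeasureTheory in
theorem lint_scale {q : ℝ} (hq : 0 < q) :
    ∫⁻ t in Set.Ioi (0:ℝ), ENNReal.ofReal t⁻¹ *
      ENNReal.ofReal ((t ^ 2 * q) * Real.exp (-(t ^ 2 * q))) = ENNReal.ofReal (1 / 2) := by
  have hd : ∀ x ∈ Set.Ici (0:ℝ), HasDerivAt (fun t : ℝ => -(1/2) * Real.exp (-(t ^ 2 * q)))
      ((x * q) * Real.exp (-(x ^ 2 * q))) x := by
    intro x _
    have h1 : HasDerivAt (fun t : ℝ => -(t ^ 2 * q)) (-(2 * x * q)) x := by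
      convert! ((hasDerivAt_pow 2 x).mul_const q).fun_neg using 1
      simp
    convert! (h1.exp.const_mul (-(1/2))) using 1
    ring
  have hpos : ∀ x ∈ Set.Ioi (0:ℝ), 0 ≤ (x * q) * Real.exp (-(x ^ 2 * q)) := by
    intro x hx
    have : 0 < x := hx
    positivity
  have hlim : Filter.Tendsto (fun t : ℝ => -(1/2) * Real.exp (-(t ^ 2 * q))) Filter.atTop (nhds 0) := by
    rw [show (0:ℝ) = -(1/2) * 0 by simp]
    refine Filter.Tendsto.const_mul _ ?_
    refine Real.tendsto_exp_neg_atTop_nhds_zero.comp ?_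
    exact (Filter.tendsto_pow_atTop two_ne_zero).atTop_mul_const hq
  have hint := integrableOn_Ioi_deriv_of_nonneg' hd hpos hlim
  have hval := integral_Ioi_of_hasDerivAt_of_nonneg' hd hpos hlim
  have h3 : ∫⁻ t in Set.Ioi (0:ℝ), ENNReal.ofReal ((t * q) * Real.exp (-(t ^ 2 * q))) =
      ENNReal.ofReal (1 / 2) := by
    rw [← ofReal_integral_eq_lintegral_ofReal hint
      ((ae_restrict_iff' measurableSet_Ioi).2 (Filter.Eventually.of_forall hpos)), hval]
    simp
  rw [← h3]
  refine setLIntegral_congr_fun measurableSet_Ioi fun t ht => ?_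
  have : 0 < t := ht
  rw [← ENNReal.ofReal_mul (by positivity)]
  congr 1
  field_simp

theorem posX_linear {V U : Type*} [Fintype U] {j : U → V} {a : V}
    (h : IsPin j a) (t : ℝ) (x : U → E4) (z : V) : posX j (t • x) z = t • posX j x z := by
  rw [← posX_eq h, ← posX_eq h, Finset.smul_sum]
  refine Finset.sum_congr rfl fun u _ => ?_
  rw [Pi.smul_apply, smul_comm]

theorem posX_meas {V U : Type*} [Fintype U] {j : U → V} {a : V}
    (h : IsPin j a) (z : V) : Measurable (fun x => posX j x z) := by
  simp_rw [← posX_eq h]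
  fun_prop

theorem qE_meas {V U : Type*} [Fintype U] {j : U → V} {a : V}
    (h : IsPin j a) {G : SimpleGraph V} (e : G.edgeSet) : Measurable (fun x => qE j x e) := by
  unfold qE
  have h1 := posX_meas h (eSrc e)
  have h2 := posX_meas h (eTgt e)
  fun_prop

theorem qE_smul {V U : Type*} [Fintype U] {j : U → V} {a : V}
    (h : IsPin j a) {G : SimpleGraph V} (e : G.edgeSet) (t : ℝ) (x : U → E4) :
    qE j (t • x) e = t ^ 2 * qE j x e := by
  unfold qE
  rw [posX_linear h, posX_linear h, ← smul_sub, norm_smul, mul_pow, Real.norm_eq_abs, sq_abs]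

theorem qE_nonneg {V U : Type*} {j : U → V} {G : SimpleGraph V} (e : G.edgeSet) (x : U → E4) :
    0 ≤ qE j x e := by unfold qE; positivity

theorem posX_j {V U : Type*} {j : U → V} {a : V} (h : IsPin j a) (x : U → E4) (u : U) :
    posX j x (j u) = x u := h.inj.extend_apply _ _ _

theorem posX_a {V U : Type*} {j : U → V} {a : V} (h : IsPin j a) (x : U → E4) :
    posX j x a = 0 := Function.extend_apply' _ _ _ (fun ⟨u, hu⟩ => h.na u hu)

open MeasureTheory in
theorem ae_posX_ne {V U : Type*} [Fintype U] {j : U → V} {a : V} (h : IsPin j a) {y z : V}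
    (hyz : y ≠ z) : ∀ᵐ x : U → E4, posX j x y ≠ posX j x z := by
  wlog hy : y ≠ a generalizing y z
  · have hza : z ≠ a := fun hz => hyz ((not_not.1 hy).trans hz.symm)
    exact (this hyz.symm hza).mono fun x hx => hx.symm
  obtain ⟨u, rfl⟩ := h.surj y hy
  let ℓ : (U → E4) →ₗ[ℝ] E4 :=
    ∑ k, ((dVec j (j u) k : ℝ) - (dVec j z k : ℝ)) • LinearMap.proj k
  have hℓ : ∀ x, ℓ x = posX j x (j u) - posX j x z := by
    intro x
    rw [← posX_eq h, ← posX_eq h, ← Finset.sum_sub_distrib]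
    simp [ℓ, sub_smul]
  have hne : LinearMap.ker ℓ ≠ ⊤ := by
    intro hk
    set w : E4 := EuclideanSpace.single 0 1 with hw
    have hw0 : w ≠ 0 := by simp [hw]
    have : ℓ (Pi.single u w) = 0 := by
      have : Pi.single u w ∈ LinearMap.ker ℓ := hk ▸ Submodule.mem_top
      exact this
    rw [hℓ, posX_j h] at this
    simp only [Pi.single_eq_same] at this
    by_cases hz : z = a
    · rw [hz, posX_a h, sub_zero] at this
      exact hw0 this
    · obtain ⟨k, rfl⟩ := h.surj z hz
      rw [posX_j h, Pi.single_eq_of_ne (fun hh => hyz (by rw [hh])), sub_zero] at this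
      exact hw0 this
  have := Measure.addHaar_submodule (volume : Measure (U → E4)) _ hne
  rw [ae_iff]
  refine measure_mono_null ?_ this
  intro x hx
  simp only [ne_eq, not_not, Set.mem_ofPred_eq] at hx
  simp only [SetLike.mem_coe, LinearMap.mem_ker]
  rw [hℓ, hx, sub_self]

open MeasureTheory in
theorem ae_qE_pos {V U : Type*} [Fintype U] {j : U → V} {a : V}
    (h : IsPin j a) {G : SimpleGraph V} (e : G.edgeSet) : ∀ᵐ x : U → E4, 0 < qE j x e := by
  filter_upwards [ae_posX_ne h (eAdj e).ne] with x hx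
  unfold qE
  have := norm_pos_iff.2 (sub_ne_zero.2 hx)
  positivity


noncomputable def psi {V : Type*} (G : SimpleGraph V) [Fintype G.edgeSet] (X : G.edgeSet → ℝ) : ℝ :=
  ∑ T : Finset G.edgeSet, if (subG T).IsTree then ∏ e ∈ Tᶜ, X e else 0

theorem aeval_graphPoly {V : Type*} [Fintype V] (G : SimpleGraph V) [inst : Fintype G.edgeSet]
    (X : G.edgeSet → ℝ) : MvPolynomial.aeval X (graphPoly G) = psi G X := by
  obtain rfl : inst = Fintype.ofFinite _ := Subsingleton.elim _ _
  unfold graphPoly psi subG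
  simp only [map_sum]
  refine Finset.sum_congr rfl fun T _ => ?_
  split_ifs with h
  · simp
  · simp

theorem exists_tree {V : Type*} [Fintype V] {G : SimpleGraph V} [Fintype G.edgeSet]
    (hG : G.Connected) : ∃ T : Finset G.edgeSet, (subG T).IsTree := by
  obtain ⟨T, hle, hT⟩ := hG.exists_isTree_le
  refine ⟨Finset.univ.filter fun e => e.1 ∈ T.edgeSet, ?_⟩
  have : subG (Finset.univ.filter fun e : G.edgeSet => e.1 ∈ T.edgeSet) = T := by
    ext x y
    rw [subG_adj]
    constructor
    · rintro ⟨e, he, h⟩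
      have := (Finset.mem_filter.1 he).2
      rw [h] at this
      exact this
    · intro h
      exact ⟨⟨s(x, y), hle h⟩, by simpa using h, rfl⟩
  rw [this]
  exact hT

theorem psi_eq {V : Type*} {G : SimpleGraph V} [Fintype G.edgeSet] (X : G.edgeSet → ℝ)
    (hX : ∀ e, 0 < X e) : psi G X = (∏ e, X e) * kPoly G (fun e => (X e)⁻¹) := by
  unfold psi kPoly
  rw [Finset.mul_sum]
  refine Finset.sum_congr rfl fun T _ => ?_
  split_ifs
  · rw [← Finset.prod_mul_prod_compl T X, Finset.prod_inv_distrib]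
    have : ∏ e ∈ T, X e ≠ 0 := Finset.prod_ne_zero_iff.2 fun e _ => (hX e).ne'
    field_simp
  · simp

theorem psi_ge {V : Type*} {G : SimpleGraph V} [Fintype G.edgeSet] (X : G.edgeSet → ℝ)
    (hX : ∀ e, 0 < X e) (T : Finset G.edgeSet) (hT : (subG T).IsTree) :
    ∏ e ∈ Tᶜ, X e ≤ psi G X := by
  unfold psi
  have := Finset.single_le_sum (f := fun T : Finset G.edgeSet =>
    if (subG T).IsTree then ∏ e ∈ Tᶜ, X e else 0) (s := Finset.univ) (fun T _ => by
      split_ifs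
      · exact Finset.prod_nonneg fun e _ => (hX e).le
      · exact le_rfl) (Finset.mem_univ T)
  simpa only [hT, if_true] using this

theorem psi_pos {V : Type*} [Fintype V] {G : SimpleGraph V} [Fintype G.edgeSet]
    (hG : G.Connected) (X : G.edgeSet → ℝ)
    (hX : ∀ e, 0 < X e) : 0 < psi G X := by
  obtain ⟨T, hT⟩ := exists_tree hG
  exact lt_of_lt_of_le (Finset.prod_pos fun e _ => hX e) (psi_ge X hX T hT)

noncomputable def extX {V : Type*} {G : SimpleGraph V} (e₀ : G.edgeSet)
    (x : {e : G.edgeSet // e ≠ e₀} → ℝ) : G.edgeSet → ℝ :=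
  fun e => if h : e = e₀ then (1 : ℝ) else x ⟨e, h⟩

theorem extX_pos {V : Type*} {G : SimpleGraph V} (e₀ : G.edgeSet)
    {x : {e : G.edgeSet // e ≠ e₀} → ℝ} (hx : ∀ e, 0 < x e) (e) : 0 < extX e₀ x e := by
  unfold extX
  split_ifs with h
  · exact one_pos
  · exact hx _

theorem extX_self {V : Type*} {G : SimpleGraph V} (e₀ : G.edgeSet)
    (x : {e : G.edgeSet // e ≠ e₀} → ℝ) : extX e₀ x e₀ = 1 := by simp [extX]

theorem extX_sub {V : Type*} {G : SimpleGraph V} (e₀ : G.edgeSet)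
    (x : {e : G.edgeSet // e ≠ e₀} → ℝ) (e : {e : G.edgeSet // e ≠ e₀}) : extX e₀ x e.1 = x e := by
  simp [extX, e.2]

theorem extX_meas {V : Type*} {G : SimpleGraph V} (e₀ : G.edgeSet) (e : G.edgeSet) :
    Measurable fun x => extX e₀ x e := by
  unfold extX
  split_ifs with h
  · exact measurable_const
  · exact measurable_pi_apply _

open MeasureTheory in
noncomputable def pL {V : Type*} (G : SimpleGraph V) [Fintype G.edgeSet] (e₀ : G.edgeSet) : ENNReal :=
  ∫⁻ x in (Set.univ.pi fun _ : {e : G.edgeSet // e ≠ e₀} => Set.Ioi (0 : ℝ)),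
    ENNReal.ofReal (1 / psi G (extX e₀ x) ^ 2)

noncomputable def phiE {V U : Type*} (j : U → V) {G : SimpleGraph V} (e : G.edgeSet) (x : U → E4) : ENNReal :=
  ENNReal.ofReal (qE j x e * Real.exp (-(qE j x e)))

noncomputable def prodE {V U : Type*} (j : U → V) (G : SimpleGraph V) [Fintype G.edgeSet] (x : U → E4) : ENNReal :=
  ∏ e : G.edgeSet, ENNReal.ofReal ((qE j x e)⁻¹)

theorem pt_identity {V U : Type*} {j : U → V} {G : SimpleGraph V} [Fintype G.edgeSet]
    (e₀ : G.edgeSet) {x : {e : G.edgeSet // e ≠ e₀} → ℝ} (hx : ∀ e, 0 < x e) (y : U → E4) :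
    ENNReal.ofReal (((∏ e, extX e₀ x e) ^ 2)⁻¹) *
      ENNReal.ofReal (Real.exp (-∑ e, (extX e₀ x e)⁻¹ * qE j y e)) =
    ENNReal.ofReal (Real.exp (-(qE j y e₀))) * ∏ e : {e : G.edgeSet // e ≠ e₀},
      ENNReal.ofReal ((x e ^ 2)⁻¹ * Real.exp (-((x e)⁻¹ * qE j y e.1))) := by
  have hp : ∀ e : {e : G.edgeSet // e ≠ e₀}, 0 ≤ (x e ^ 2)⁻¹ * Real.exp (-((x e)⁻¹ * qE j y e.1)) :=
    fun e => by positivity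
  rw [← ENNReal.ofReal_mul (by positivity), ← ENNReal.ofReal_prod_of_nonneg (fun e _ => hp e),
    ← ENNReal.ofReal_mul (by positivity)]
  congr 1
  rw [Finset.prod_mul_distrib, ← Real.exp_sum, Fintype.prod_eq_mul_prod_subtype_ne _ e₀,
    Fintype.sum_eq_add_sum_subtype_ne _ e₀]
  simp only [extX_self, extX_sub]
  rw [neg_add, Real.exp_add, Finset.sum_neg_distrib, inv_one, one_mul, one_mul,
    Finset.prod_inv_distrib, Finset.prod_pow]
  ring

open MeasureTheory in
theorem pos_main {V U : Type*} [Fintype V] [Fintype U] {G : SimpleGraph V} [Fintype G.edgeSet]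
    {j : U → V} {a : V} (h : IsPin j a) (hG : G.Connected) (e₀ : G.edgeSet) :
    pL G e₀ * gC U = ∫⁻ y : U → E4, prodE j G y * phiE j e₀ y := by
  have hmeasS : MeasurableSet (Set.univ.pi fun _ : {e : G.edgeSet // e ≠ e₀} => Set.Ioi (0 : ℝ)) :=
    MeasurableSet.univ_pi fun _ => measurableSet_Ioi
  have step1 : pL G e₀ * gC U =
      ∫⁻ x in (Set.univ.pi fun _ : {e : G.edgeSet // e ≠ e₀} => Set.Ioi (0 : ℝ)),
        ∫⁻ y : U → E4, ENNReal.ofReal (Real.exp (-(qE j y e₀))) * ∏ e : {e : G.edgeSet // e ≠ e₀},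
          ENNReal.ofReal ((x e ^ 2)⁻¹ * Real.exp (-((x e)⁻¹ * qE j y e.1))) := by
    unfold pL
    rw [← lintegral_mul_const' _ _ (gC_ne_top U)]
    refine setLIntegral_congr_fun hmeasS fun x hx => ?_
    have hx' : ∀ e, 0 < x e := fun e => hx e (Set.mem_univ e)
    have hX := extX_pos e₀ hx'
    have hψ := psi_pos hG _ hX
    have hψe := psi_eq _ hX
    have hK : kPoly G (fun e => (extX e₀ x e)⁻¹) ≠ 0 := by
      intro h0; rw [h0, mul_zero] at hψe; exact hψ.ne' hψe
    have hg := gauss_graph h (fun e => (extX e₀ x e)⁻¹) (fun e => (inv_pos.2 (hX e)).le) hK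
    simp_rw [← pt_identity e₀ hx']
    rw [lintegral_const_mul' _ _ ENNReal.ofReal_ne_top, hg, ← mul_assoc,
      ← ENNReal.ofReal_mul (by positivity), hψe]
    congr 2
    rw [mul_pow, one_div, one_div, mul_inv]
  rw [step1, lintegral_lintegral_swap]
  · have hr : (volume : Measure ({e : G.edgeSet // e ≠ e₀} → ℝ)).restrict
        (Set.univ.pi fun _ => Set.Ioi (0 : ℝ)) = Measure.pi fun _ => volume.restrict (Set.Ioi 0) :=
      Measure.restrict_pi_pi _ _
    have hae : ∀ᵐ y : U → E4, ∀ e : G.edgeSet, 0 < qE j y e := ae_all_iff.2 fun e => ae_qE_pos h e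
    refine lintegral_congr_ae ?_
    filter_upwards [hae] with y hy
    rw [lintegral_const_mul' _ _ ENNReal.ofReal_ne_top, hr]
    have := lintegral_fintype_prod' (fun _ : {e : G.edgeSet // e ≠ e₀} => (volume : Measure ℝ).restrict (Set.Ioi 0))
      (fun e t => ENNReal.ofReal ((t ^ 2)⁻¹ * Real.exp (-(t⁻¹ * qE j y e.1)))) (fun e => by fun_prop)
    rw [this]
    simp_rw [lint_inv_exp (hy _)]
    unfold prodE phiE
    rw [Fintype.prod_eq_mul_prod_subtype_ne _ e₀, mul_right_comm, ← ENNReal.ofReal_mul (by have := hy e₀; positivity),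
      ← mul_assoc, inv_mul_cancel₀ (hy e₀).ne', one_mul]
  · have := fun e : G.edgeSet => qE_meas h e
    apply Measurable.aemeasurable
    apply Measurable.mul
    · have h2 : Measurable fun y : U → E4 => ENNReal.ofReal (Real.exp (-(qE j y e₀))) := by fun_prop
      exact h2.comp measurable_snd
    · refine Finset.measurable_prod _ fun e _ => ?_
      have h2 : Measurable fun p : ({e : G.edgeSet // e ≠ e₀} → ℝ) × (U → E4) => qE j p.2 e.1 :=
        (this e.1).comp measurable_snd
      have h3 : Measurable fun p : ({e : G.edgeSet // e ≠ e₀} → ℝ) × (U → E4) => p.1 e :=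
        (measurable_pi_apply e).comp measurable_fst
      fun_prop


open MeasureTheory in
theorem lint_dil {U : Type*} [Fintype U] (g : (U → E4) → ENNReal) (hg : Measurable g) {t : ℝ} (ht : 0 < t) :
    ∫⁻ x, g x = ENNReal.ofReal ((t ^ (4 * Fintype.card U))⁻¹) * ∫⁻ y, g (t⁻¹ • y) := by
  have h1 : ∫⁻ y, g (t⁻¹ • y) = ∫⁻ y, g y ∂(Measure.map (t⁻¹ • ·) (volume : Measure (U → E4))) := by
    rw [lintegral_map hg (measurable_const_smul _)]
  have hfr : Module.finrank ℝ (U → E4) = 4 * Fintype.card U := by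
    rw [Module.finrank_pi_fintype]
    simp [mul_comm]
  rw [h1, Measure.map_addHaar_smul _ (inv_pos.2 ht).ne', lintegral_smul_measure, hfr, smul_eq_mul,
    ← mul_assoc, ← ENNReal.ofReal_mul (by positivity), abs_of_pos (by positivity)]
  have : (t ^ (4 * Fintype.card U))⁻¹ * (t⁻¹ ^ (4 * Fintype.card U))⁻¹ = 1 := by
    rw [inv_pow, inv_inv]; exact inv_mul_cancel₀ (by positivity)
  rw [this]; simp

open MeasureTheory in
theorem weight_indep {U : Type*} [Fintype U] (f φ ψ : (U → E4) → ENNReal) (hf : Measurable f)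
    (hφ : Measurable φ) (hψ : Measurable ψ)
    (hhom : ∀ t : ℝ, 0 < t → ∀ x, f (t • x) = ENNReal.ofReal ((t ^ (4 * Fintype.card U))⁻¹) * f x)
    (c : ENNReal) (hc0 : c ≠ 0) (hct : c ≠ ⊤)
    (hA : ∀ᵐ x : U → E4, ∫⁻ t in Set.Ioi (0:ℝ), ENNReal.ofReal t⁻¹ * φ (t⁻¹ • x) = c)
    (hB : ∀ᵐ x : U → E4, ∫⁻ t in Set.Ioi (0:ℝ), ENNReal.ofReal t⁻¹ * ψ (t • x) = c) :
    ∫⁻ x, f x * φ x = ∫⁻ x, f x * ψ x := by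
  have key : (∫⁻ x, f x * φ x) * c = (∫⁻ x, f x * ψ x) * c := by
    calc (∫⁻ x, f x * φ x) * c = ∫⁻ x, f x * φ x * c := (lintegral_mul_const' _ _ hct).symm
      _ = ∫⁻ x, ∫⁻ t in Set.Ioi (0:ℝ), f x * φ x * (ENNReal.ofReal t⁻¹ * ψ (t • x)) := by
        refine lintegral_congr_ae ?_
        filter_upwards [hB] with x hx
        rw [lintegral_const_mul, hx]
        fun_prop
      _ = ∫⁻ t in Set.Ioi (0:ℝ), ∫⁻ x, f x * φ x * (ENNReal.ofReal t⁻¹ * ψ (t • x)) := by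
        rw [lintegral_lintegral_swap]
        apply Measurable.aemeasurable
        unfold Function.uncurry
        fun_prop
      _ = ∫⁻ t in Set.Ioi (0:ℝ), ∫⁻ x, f x * ψ x * (ENNReal.ofReal t⁻¹ * φ (t⁻¹ • x)) := by
        refine setLIntegral_congr_fun measurableSet_Ioi fun t ht => ?_
        have ht : 0 < t := ht
        have hm : Measurable fun x => f x * φ x * (ENNReal.ofReal t⁻¹ * ψ (t • x)) := by fun_prop
        rw [lint_dil _ hm ht, ← lintegral_const_mul' _ _ ENNReal.ofReal_ne_top]
        refine lintegral_congr fun y => ?_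
        have h1 := hhom t ht (t⁻¹ • y)
        rw [smul_inv_smul₀ ht.ne'] at h1
        rw [smul_inv_smul₀ ht.ne', h1]
        ring
      _ = ∫⁻ x, ∫⁻ t in Set.Ioi (0:ℝ), f x * ψ x * (ENNReal.ofReal t⁻¹ * φ (t⁻¹ • x)) := by
        rw [lintegral_lintegral_swap]
        apply Measurable.aemeasurable
        unfold Function.uncurry
        fun_prop
      _ = ∫⁻ x, f x * ψ x * c := by
        refine lintegral_congr_ae ?_
        filter_upwards [hA] with x hx
        rw [lintegral_const_mul, hx]
        fun_prop
      _ = (∫⁻ x, f x * ψ x) * c := lintegral_mul_const' _ _ hct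
  exact (ENNReal.mul_left_inj hc0 hct).1 key

theorem prodE_hom {V U : Type*} [Fintype U] {j : U → V} {a : V} {G : SimpleGraph V}
    [Fintype G.edgeSet] (h : IsPin j a) (hN : Fintype.card G.edgeSet = 2 * Fintype.card U)
    (t : ℝ) (ht : 0 < t) (x : U → E4) :
    prodE j G (t • x) = ENNReal.ofReal ((t ^ (4 * Fintype.card U))⁻¹) * prodE j G x := by
  unfold prodE
  simp_rw [qE_smul h, mul_inv, ENNReal.ofReal_mul (inv_nonneg.2 (sq_nonneg t))]
  rw [Finset.prod_mul_distrib, Finset.prod_const, Finset.card_univ, hN,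
    ← ENNReal.ofReal_pow (by positivity)]
  congr 2
  rw [inv_pow, ← pow_mul]
  congr 2
  ring

theorem prodE_meas {V U : Type*} [Fintype U] {j : U → V} {a : V} {G : SimpleGraph V}
    [Fintype G.edgeSet] (h : IsPin j a) : Measurable (prodE j G) := by
  unfold prodE
  have := fun e : G.edgeSet => qE_meas h e
  fun_prop

theorem phiE_meas {V U : Type*} [Fintype U] {j : U → V} {a : V} {G : SimpleGraph V}
    (h : IsPin j a) (e : G.edgeSet) : Measurable (phiE j e) := by
  unfold phiE
  have := qE_meas h e
  fun_prop

open MeasureTheory in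
theorem phiE_scale {V U : Type*} [Fintype U] {j : U → V} {a : V} {G : SimpleGraph V}
    (h : IsPin j a) (e : G.edgeSet) (x : U → E4) (hx : 0 < qE j x e) :
    ∫⁻ t in Set.Ioi (0:ℝ), ENNReal.ofReal t⁻¹ * phiE j e (t • x) = ENNReal.ofReal (1 / 2) := by
  unfold phiE
  simp_rw [qE_smul h]
  exact lint_scale hx


/-- vertices other than the two given ones -/
abbrev UU {W : Type*} (v w : W) := {u : W // u ≠ v ∧ u ≠ w}

def jL {W : Type*} (v w : W) : UU v w → ↥{u : W | u ≠ v} := fun u => ⟨u.1, u.2.1⟩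
def jR {W : Type*} (v w : W) : UU v w → ↥{u : W | u ≠ w} := fun u => ⟨u.1, u.2.2⟩

theorem jL_pin {W : Type*} {v w : W} (h : v ≠ w) : IsPin (jL v w) ⟨w, h.symm⟩ where
  inj := fun a b hab => Subtype.ext (congrArg (fun z => z.1) hab)
  na := fun u hu => u.2.2 (congrArg (fun z => z.1) hu)
  surj := fun x hx => ⟨⟨x.1, x.2, fun hh => hx (Subtype.ext hh)⟩, rfl⟩

theorem jR_pin {W : Type*} {v w : W} (h : v ≠ w) : IsPin (jR v w) ⟨v, h⟩ where
  inj := fun a b hab => Subtype.ext (congrArg (fun z => z.1) hab)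
  na := fun u hu => u.2.1 (congrArg (fun z => z.1) hu)
  surj := fun x hx => ⟨⟨x.1, fun hh => hx (Subtype.ext hh), x.2⟩, rfl⟩

noncomputable def PP {W : Type*} {v w : W} (x : UU v w → E4) (u : W) : E4 :=
  if h : u ≠ v ∧ u ≠ w then x ⟨u, h⟩ else 0

theorem posX_jL {W : Type*} {v w : W} (h : v ≠ w) (x : UU v w → E4) (z : ↥{u : W | u ≠ v}) :
    posX (jL v w) x z = PP x z.1 := by
  by_cases hz : z = ⟨w, h.symm⟩
  · subst hz
    rw [posX_a (jL_pin h)]; simp [PP]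
  · obtain ⟨u, rfl⟩ := (jL_pin h).surj z hz
    rw [posX_j (jL_pin h)]
    simp [PP, jL, u.2.1, u.2.2]

theorem posX_jR {W : Type*} {v w : W} (h : v ≠ w) (x : UU v w → E4) (z : ↥{u : W | u ≠ w}) :
    posX (jR v w) x z = PP x z.1 := by
  by_cases hz : z = ⟨v, h⟩
  · subst hz
    rw [posX_a (jR_pin h)]; simp [PP]
  · obtain ⟨u, rfl⟩ := (jR_pin h).surj z hz
    rw [posX_j (jR_pin h)]
    simp [PP, jR, u.2.1, u.2.2]

noncomputable def dS {W : Type*} (P : W → E4) : Sym2 W → ℝ :=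
  Sym2.lift ⟨fun a b => ‖P a - P b‖ ^ 2, fun a b => by dsimp only; rw [norm_sub_rev]⟩

theorem dS_mk {W : Type*} (P : W → E4) (a b : W) : dS P s(a, b) = ‖P a - P b‖ ^ 2 := rfl

noncomputable def rS {W : Type*} (R : W → ℝ) : Sym2 W → ℝ :=
  Sym2.lift ⟨fun a b => R a * R b, fun a b => mul_comm _ _⟩

theorem rS_mk {W : Type*} (R : W → ℝ) (a b : W) : rS R s(a, b) = R a * R b := rfl

theorem prod_del {W : Type*} [Fintype W] (Γ : SimpleGraph W) (v : W)
    [Fintype (delVert Γ v).edgeSet] (f : Sym2 W → ℝ) :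
    ∏ e : (delVert Γ v).edgeSet, f (e.1.map Subtype.val) =
      ∏ e ∈ Γ.edgeFinset, if v ∉ e then f e else 1 := by
  rw [← Finset.prod_filter]
  refine Finset.prod_bij (fun e _ => e.1.map Subtype.val) ?_ ?_ ?_ ?_
  · rintro ⟨e, he⟩ -
    induction e with | _ a b
    rw [Finset.mem_filter, SimpleGraph.mem_edgeFinset]
    refine ⟨he, ?_⟩
    simp only [Sym2.map_mk, Sym2.mem_iff]
    rintro (h | h)
    · exact a.2 h.symm
    · exact b.2 h.symm
  · intro e _ e' _ h
    exact Subtype.ext (Sym2.map.injective Subtype.val_injective h)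
  · intro e he
    rw [Finset.mem_filter, SimpleGraph.mem_edgeFinset] at he
    induction e with | _ a b
    simp only [Sym2.mem_iff, not_or] at he
    exact ⟨⟨s(⟨a, Ne.symm he.2.1⟩, ⟨b, Ne.symm he.2.2⟩), he.1⟩, Finset.mem_univ _, rfl⟩
  · intro e _; rfl

theorem prod_deg {W : Type*} [Fintype W] (Γ : SimpleGraph W)
    (hreg : ∀ u, Γ.degree u = 4) (R : W → ℝ) :
    ∏ e ∈ Γ.edgeFinset, rS R e = ∏ u, R u ^ 4 := by
  have h1 : ∀ e ∈ Γ.edgeFinset, rS R e = ∏ u, if u ∈ e then R u else 1 := by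
    intro e he
    rw [SimpleGraph.mem_edgeFinset] at he
    induction e with | _ a b
    have hab : a ≠ b := SimpleGraph.Adj.ne he
    rw [rS_mk, ← Finset.prod_filter, ← Finset.prod_pair hab]
    congr 1
    ext u
    simp
  rw [Finset.prod_congr rfl h1, Finset.prod_comm]
  refine Finset.prod_congr rfl fun u _ => ?_
  rw [← Finset.prod_filter, Finset.prod_const, ← hreg u, ← SimpleGraph.card_incidenceFinset_eq_degree,
    SimpleGraph.incidenceFinset_eq_filter]

theorem sum_deg {W : Type*} [Fintype W] (Γ : SimpleGraph W)
    (hreg : ∀ u, Γ.degree u = 4) (v : W) [Fintype (delVert Γ v).edgeSet] :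
    Fintype.card (delVert Γ v).edgeSet + 4 = 2 * Fintype.card W := by
  have h1 := prod_del Γ v (fun _ => (2:ℝ))
  rw [Finset.prod_const, Finset.card_univ, ← Finset.prod_filter, Finset.prod_const] at h1
  have h2 := Nat.pow_right_injective le_rfl (by exact_mod_cast h1 : 2 ^ _ = 2 ^ _)
  have h3 := Finset.card_filter_add_card_filter_not (s := Γ.edgeFinset) (fun e => v ∈ e)
  rw [← SimpleGraph.incidenceFinset_eq_filter, SimpleGraph.card_incidenceFinset_eq_degree, hreg] at h3
  have h4 := Γ.sum_degrees_eq_twice_card_edges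
  simp only [hreg, Finset.sum_const, Finset.card_univ, smul_eq_mul] at h4
  omega

theorem inv_identity {W : Type*} [Fintype W] (Γ : SimpleGraph W)
    (hreg : ∀ u, Γ.degree u = 4) {v w : W} (h : v ≠ w)
    [Fintype (delVert Γ v).edgeSet] [Fintype (delVert Γ w).edgeSet]
    (x : UU v w → E4) (hx : ∀ u, x u ≠ 0) :
    (∏ u, rho4 (x u)) * prodE (jL v w) (delVert Γ v) (fun u => inv4 (x u)) =
      prodE (jR v w) (delVert Γ w) x := by
  have hqL : ∀ (y : UU v w → E4) (e : (delVert Γ v).edgeSet),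
      qE (jL v w) y e = dS (PP y) (e.1.map Subtype.val) := by
    intro y e
    unfold qE
    rw [posX_jL h, posX_jL h, ← dS_mk, ← eMk e]
    rfl
  have hqR : ∀ (y : UU v w → E4) (e : (delVert Γ w).edgeSet),
      qE (jR v w) y e = dS (PP y) (e.1.map Subtype.val) := by
    intro y e
    unfold qE
    rw [posX_jR h, posX_jR h, ← dS_mk, ← eMk e]
    rfl
  have hnn : ∀ (P : W → E4) (e : Sym2 W), 0 ≤ (dS P e)⁻¹ := by
    intro P e
    induction e with | _ a b
    rw [dS_mk]; positivity
  unfold prodE rho4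
  simp_rw [hqL, hqR]
  rw [← ENNReal.ofReal_prod_of_nonneg (fun _ _ => by positivity),
    ← ENNReal.ofReal_prod_of_nonneg (fun _ _ => hnn _ _),
    ← ENNReal.ofReal_prod_of_nonneg (fun _ _ => hnn _ _),
    ← ENNReal.ofReal_mul (Finset.prod_nonneg fun _ _ => by positivity)]
  congr 1
  rw [prod_del Γ v (fun e => (dS (PP fun u => inv4 (x u)) e)⁻¹), prod_del Γ w (fun e => (dS (PP x) e)⁻¹)]
  set R : W → ℝ := fun u => if u ≠ v ∧ u ≠ w then (‖PP x u‖ ^ 2)⁻¹ else 1 with hR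
  have hPne : ∀ u, (u ≠ v ∧ u ≠ w) → PP x u ≠ 0 := by
    intro u hu
    simp only [PP, dif_pos hu]; exact hx _
  have hRne : ∀ u, R u ≠ 0 := by
    intro u
    by_cases hu : u ≠ v ∧ u ≠ w
    · have := norm_ne_zero_iff.2 (hPne u hu)
      simp only [hR, if_pos hu]; positivity
    · simp only [hR, if_neg hu]; exact one_ne_zero
  have hRprod : ∏ u : UU v w, ((‖x u‖ ^ 2)⁻¹) ^ 4 = ∏ u : W, R u ^ 4 := by
    have : ∀ u : W, R u ^ 4 = if u ≠ v ∧ u ≠ w then ((‖PP x u‖ ^ 2)⁻¹) ^ 4 else 1 := by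
      intro u; simp only [hR]; split_ifs <;> simp
    simp_rw [this]
    rw [← Finset.prod_filter, Finset.prod_subtype (p := fun u => u ≠ v ∧ u ≠ w) _ (by simp)]
    refine Finset.prod_congr rfl fun u _ => ?_
    simp [PP, u.2.1, u.2.2]
  have hPinv : ∀ u, PP (fun u => inv4 (x u)) u = inv4 (PP x u) := by
    intro u
    by_cases hu : u ≠ v ∧ u ≠ w
    · simp only [PP, dif_pos hu]
    · simp only [PP, dif_neg hu, inv4_zero]
  rw [hRprod, ← prod_deg Γ hreg, ← Finset.prod_mul_distrib]
  refine Finset.prod_congr rfl fun e he => ?_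
  rw [SimpleGraph.mem_edgeFinset] at he
  induction e with | _ a b
  have hab : a ≠ b := SimpleGraph.Adj.ne he
  clear he
  rw [rS_mk, dS_mk, dS_mk, hPinv, hPinv]
  have hPv : PP x v = 0 := by simp [PP]
  have hPw : PP x w = 0 := by simp [PP]
  have hRv : R v = 1 := by simp [hR]
  have hRw : R w = 1 := by simp [hR]
  have hRo : ∀ u, (u ≠ v ∧ u ≠ w) → R u = (‖PP x u‖ ^ 2)⁻¹ := fun u hu => by
    simp only [hR, if_pos hu]
  have hPp : ∀ u, (u ≠ v ∧ u ≠ w) → 0 < ‖PP x u‖ := fun u hu => norm_pos_iff.2 (hPne u hu)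
  have one : ∀ b, (b ≠ v ∧ b ≠ w) → R b * (‖inv4 (PP x b)‖ ^ 2)⁻¹ = 1 := by
    intro b hb
    have := hPp b hb
    rw [hRo b hb, inv4_norm, inv_inv]; field_simp
  simp only [Sym2.mem_iff, not_or]
  by_cases hav : a = v
  · subst hav
    by_cases hbw : b = w
    · subst hbw; simp [hRv, hRw]
    · have hb : b ≠ a ∧ b ≠ w := ⟨hab.symm, hbw⟩
      simp [hRv, hPv, hRo b hb, h.symm, Ne.symm hbw]
  by_cases haw : a = w
  · subst haw
    by_cases hbv : b = v
    · subst hbv; simp [hRv, hRw]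
    · have hb : b ≠ v ∧ b ≠ a := ⟨hbv, hab.symm⟩
      simpa [hRw, hPw, inv4_zero, h, Ne.symm hbv] using one b hb
  have ha : a ≠ v ∧ a ≠ w := ⟨hav, haw⟩
  by_cases hbv : b = v
  · subst hbv
    simp [hRv, hPv, hRo a ha, h.symm, Ne.symm haw]
  by_cases hbw : b = w
  · subst hbw
    simpa [hRw, hPw, inv4_zero, h, Ne.symm hav] using one a ha
  have hb : b ≠ v ∧ b ≠ w := ⟨hbv, hbw⟩
  simp only [Ne.symm hav, Ne.symm haw, Ne.symm hbv, Ne.symm hbw, not_false_eq_true, and_self, if_true]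
  rw [inv4_dist (hPne a ha) (hPne b hb), hRo a ha, hRo b hb, mul_inv]
  have h1 := hPp a ha
  have h2 := hPp b hb
  field_simp

open MeasureTheory in
theorem pL_eq {W : Type*} [Fintype W] (Γ : SimpleGraph W)
    (hreg : ∀ u, Γ.degree u = 4) {v w : W} (h : v ≠ w)
    [Fintype (delVert Γ v).edgeSet] [Fintype (delVert Γ w).edgeSet]
    (hcv : (delVert Γ v).Connected) (hcw : (delVert Γ w).Connected)
    (e₀ : (delVert Γ v).edgeSet) (e₁ : (delVert Γ w).edgeSet) :
    pL (delVert Γ v) e₀ = pL (delVert Γ w) e₁ := by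
  have hL := jL_pin h
  have hR := jR_pin h
  have hcard : Fintype.card (delVert Γ w).edgeSet = 2 * Fintype.card (UU v w) := by
    have h1 := sum_deg Γ hreg w
    have h2 := hR.card
    have h3 : Fintype.card ↥{u : W | u ≠ w} + 1 = Fintype.card W := by
      have := Fintype.card_subtype_compl (fun u => u = w)
      have hpos : 0 < Fintype.card W := Fintype.card_pos_iff.2 ⟨w⟩
      simp only [Fintype.card_subtype_eq] at this
      have h5 : Fintype.card ↥{u : W | u ≠ w} = Fintype.card W - 1 := by
        rw [← this]; exact Fintype.card_congr (Equiv.refl _)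
      omega
    omega
  have key : pL (delVert Γ v) e₀ * gC (UU v w) = pL (delVert Γ w) e₁ * gC (UU v w) := by
    rw [pos_main hL hcv, pos_main hR hcw, inv4_pi_lintegral (fun y => prodE (jL v w) (delVert Γ v) y * phiE (jL v w) e₀ y)
      ((prodE_meas hL).mul (phiE_meas hL e₀))]
    have hinv : Measurable fun (x : UU v w → E4) u => inv4 (x u) :=
      measurable_pi_lambda _ fun u => inv4_measurable.comp (measurable_pi_apply u)
    have hne : ∀ᵐ x : UU v w → E4, ∀ u, x u ≠ 0 := by
      refine ae_all_iff.2 fun u => ?_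
      have := ae_posX_ne hR (hR.na u)
      filter_upwards [this] with x hx
      rwa [posX_j hR, posX_a hR] at hx
    have s1 : ∫⁻ x : UU v w → E4, (∏ u, rho4 (x u)) *
        (prodE (jL v w) (delVert Γ v) (fun u => inv4 (x u)) * phiE (jL v w) e₀ (fun u => inv4 (x u))) =
        ∫⁻ x, prodE (jR v w) (delVert Γ w) x * phiE (jL v w) e₀ (fun u => inv4 (x u)) := by
      refine lintegral_congr_ae ?_
      filter_upwards [hne] with x hx
      rw [← mul_assoc, inv_identity Γ hreg h x hx]
    refine s1.trans ?_
    refine weight_indep _ (fun x => phiE (jL v w) e₀ (fun u => inv4 (x u))) _ (prodE_meas hR)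
      ((phiE_meas hL e₀).comp hinv) (phiE_meas hR e₁)
      (prodE_hom hR hcard) (ENNReal.ofReal (1/2)) (by simp) (by simp) ?_ ?_
    · have hn : ∀ᵐ x : UU v w → E4, posX (jL v w) x (eSrc e₀) ≠ posX (jL v w) x (eTgt e₀) :=
        ae_posX_ne hL (eAdj e₀).ne
      filter_upwards [hne, hn] with x hx hx2
      have : ∀ t : ℝ, (fun u => inv4 ((t⁻¹ • x) u)) = t • (fun u => inv4 (x u)) := by
        intro t; ext1 u; simp only [Pi.smul_apply]; exact inv4_smul _ _
      simp_rw [this]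
      refine phiE_scale hL e₀ _ ?_
      unfold qE
      have h3 : ∀ z, posX (jL v w) (fun u => inv4 (x u)) z = inv4 (posX (jL v w) x z) := by
        intro z
        rw [posX_jL h, posX_jL h]
        unfold PP
        split_ifs
        · rfl
        · exact inv4_zero.symm
      rw [h3, h3]
      have h4 : inv4 (posX (jL v w) x (eSrc e₀)) - inv4 (posX (jL v w) x (eTgt e₀)) ≠ 0 := by
        rw [sub_ne_zero]
        intro hh
        apply hx2
        rw [← inv4_inv4 (posX (jL v w) x (eSrc e₀)), hh, inv4_inv4]
      have := norm_pos_iff.2 h4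
      positivity
    · filter_upwards [ae_qE_pos hR e₁] with x hx
      exact phiE_scale hR e₁ x hx
  exact (ENNReal.mul_left_inj (gC_ne_zero _) (gC_ne_top _)).1 key


noncomputable def cutF {W : Type*} [Fintype W] (Γ : SimpleGraph W) (A : Finset W) : Finset (Sym2 W) :=
  Γ.edgeFinset.filter fun e => ∃ a ∈ A, ∃ b, b ∉ A ∧ e = s(a, b)

noncomputable def innF {W : Type*} [Fintype W] (Γ : SimpleGraph W) (A : Finset W) : Finset (Sym2 W) :=
  Γ.edgeFinset.filter fun e => ∀ u ∈ e, u ∈ A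

theorem reach_closed {V : Type*} {G : SimpleGraph V} (A : Set V)
    (h : ∀ x y, G.Adj x y → x ∈ A → y ∈ A) {x y : V} (hr : G.Reachable x y) (hx : x ∈ A) : y ∈ A := by
  obtain ⟨p⟩ := hr
  induction p with
  | nil => exact hx
  | cons hadj _ ih => exact ih (h _ _ hadj hx)

theorem cut_star {W : Type*} [Fintype W] {Γ : SimpleGraph W} (hΓ : IsCompletedPrimitive Γ)
    (hreg : ∀ u, Γ.degree u = 4) {A : Finset W} (hA : A.Nonempty) (hA' : Aᶜ.Nonempty)
    (C : Finset (Sym2 W)) (h1 : cutF Γ A ⊆ C) (h2 : C ⊆ Γ.edgeFinset) (h3 : C.card = 4) :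
    ∃ w, C = Γ.incidenceFinset w := by
  obtain ⟨-, -, -, h⟩ := hΓ
  have hC : (C : Set (Sym2 W)) ⊆ Γ.edgeSet := fun e he => SimpleGraph.mem_edgeFinset.1 (h2 he)
  rcases h C hC (by simpa using h3) with hc | ⟨w, hw⟩
  · exfalso
    obtain ⟨a, ha⟩ := hA
    obtain ⟨b, hb⟩ := hA'
    refine (Finset.mem_compl.1 hb) (reach_closed (A : Set W) ?_ (hc.preconnected a b) ha)
    intro x y hxy hx
    rw [SimpleGraph.deleteEdges_adj] at hxy
    by_contra hy
    exact hxy.2 (h1 (Finset.mem_filter.2 ⟨SimpleGraph.mem_edgeFinset.2 hxy.1, x, hx, y, hy, rfl⟩))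
  · refine ⟨w, (Finset.eq_of_subset_of_card_le ?_ ?_).symm⟩
    · intro e he
      rw [SimpleGraph.mem_incidenceFinset] at he
      obtain ⟨he1, he2⟩ := he
      obtain ⟨u, rfl⟩ := Sym2.mem_iff_exists.1 he2
      by_contra hn
      exact hw u (SimpleGraph.deleteEdges_adj.2 ⟨he1, hn⟩)
    · rw [SimpleGraph.card_incidenceFinset_eq_degree, hreg, h3]

theorem cut_compl {W : Type*} [Fintype W] (Γ : SimpleGraph W) (A : Finset W) :
    cutF Γ Aᶜ = cutF Γ A := by
  unfold cutF
  refine Finset.filter_congr fun e _ => ?_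
  constructor
  · rintro ⟨a, ha, b, hb, rfl⟩
    exact ⟨b, by simpa using hb, a, by simpa using ha, Sym2.eq_swap⟩
  · rintro ⟨a, ha, b, hb, rfl⟩
    exact ⟨b, by simpa using hb, a, by simpa using ha, Sym2.eq_swap⟩

theorem edges_ge {W : Type*} [Fintype W] {Γ : SimpleGraph W} (hΓ : IsCompletedPrimitive Γ)
    (hreg : ∀ u, Γ.degree u = 4) : 10 ≤ Γ.edgeFinset.card := by
  have h4 := Γ.sum_degrees_eq_twice_card_edges
  simp only [hreg, Finset.sum_const, Finset.card_univ, smul_eq_mul] at h4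
  have := hΓ.2.2.1
  omega

theorem cut_ge {W : Type*} [Fintype W] {Γ : SimpleGraph W} (hΓ : IsCompletedPrimitive Γ)
    (hreg : ∀ u, Γ.degree u = 4) {A : Finset W} (hA : A.Nonempty) (hA' : Aᶜ.Nonempty) :
    4 ≤ (cutF Γ A).card := by
  by_contra hlt
  push Not at hlt
  have hE := edges_ge hΓ hreg
  obtain ⟨C, hC1, hC2, hC3⟩ := Finset.exists_subsuperset_card_eq (Finset.filter_subset _ _ : cutF Γ A ⊆ Γ.edgeFinset)
    hlt.le (by omega)
  obtain ⟨w, hw⟩ := cut_star hΓ hreg hA hA' C hC1 hC2 hC3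
  obtain ⟨f, hf, hf'⟩ := Finset.exists_mem_notMem_of_card_lt_card (hC3 ▸ hlt : (cutF Γ A).card < C.card)
  obtain ⟨g, hg, hg'⟩ := Finset.exists_mem_notMem_of_card_lt_card (by omega : C.card < Γ.edgeFinset.card)
  have hcard : (C.erase f).card = 3 := by rw [Finset.card_erase_of_mem hf, hC3]
  have hgn : g ∉ C.erase f := fun h => hg' (Finset.mem_of_mem_erase h)
  obtain ⟨w', hw'⟩ := cut_star hΓ hreg hA hA' (insert g (C.erase f))
    (fun e he => Finset.mem_insert_of_mem (Finset.mem_erase.2 ⟨fun h => hf' (h ▸ he), hC1 he⟩))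
    (Finset.insert_subset hg ((Finset.erase_subset _ _).trans hC2))
    (by rw [Finset.card_insert_of_notMem hgn, hcard])
  have hne : w ≠ w' := by
    rintro rfl
    rw [← hw'] at hw
    exact hg' (hw ▸ Finset.mem_insert_self _ _)
  have hsub : C.erase f ⊆ {s(w, w')} := by
    intro e he
    have h1 : e ∈ Γ.incidenceFinset w := hw ▸ Finset.mem_of_mem_erase he
    have h2 : e ∈ Γ.incidenceFinset w' := hw' ▸ Finset.mem_insert_of_mem he
    rw [SimpleGraph.mem_incidenceFinset] at h1 h2
    rw [Finset.mem_singleton]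
    exact (Sym2.mem_and_mem_iff hne).1 ⟨h1.2, h2.2⟩
  have := Finset.card_le_card hsub
  rw [hcard, Finset.card_singleton] at this
  omega

theorem cut_four_aux {W : Type*} [Fintype W] {Γ : SimpleGraph W} (hΓ : IsCompletedPrimitive Γ)
    {A : Finset W} {w : W} (hw : cutF Γ A = Γ.incidenceFinset w) (hwA : w ∈ A) : A = {w} := by
  by_contra hne
  obtain ⟨x, hx, hxw⟩ : ∃ x ∈ A, x ≠ w := by
    by_contra hcon
    push Not at hcon
    exact hne (Finset.eq_singleton_iff_unique_mem.2 ⟨hwA, hcon⟩)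
  have := reach_closed {z | z ∈ A ∧ z ≠ w} ?_ (hΓ.1.preconnected x w) ⟨hx, hxw⟩
  · exact this.2 rfl
  · rintro a b hab ⟨ha, haw⟩
    have h1 : b ∈ A := by
      by_contra hb
      have : s(a, b) ∈ cutF Γ A := Finset.mem_filter.2 ⟨SimpleGraph.mem_edgeFinset.2 hab, a, ha, b, hb, rfl⟩
      rw [hw, SimpleGraph.mem_incidenceFinset] at this
      rcases Sym2.mem_iff.1 this.2 with h | h
      · exact haw h.symm
      · exact hb (h ▸ hwA)
    refine ⟨h1, ?_⟩
    rintro rfl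
    have : s(a, b) ∈ cutF Γ A := by
      rw [hw, SimpleGraph.mem_incidenceFinset]
      exact ⟨hab, Sym2.mem_mk_right _ _⟩
    obtain ⟨-, c, hc, d, hd, he⟩ := Finset.mem_filter.1 this
    rcases Sym2.eq_iff.1 he with ⟨_, h⟩ | ⟨h, _⟩
    · exact hd (h ▸ h1)
    · exact hd (h ▸ ha)

theorem cut_four {W : Type*} [Fintype W] {Γ : SimpleGraph W} (hΓ : IsCompletedPrimitive Γ)
    (hreg : ∀ u, Γ.degree u = 4) {A : Finset W} (hA : A.Nonempty) (hA' : Aᶜ.Nonempty)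
    (h4 : (cutF Γ A).card = 4) : A.card = 1 ∨ Aᶜ.card = 1 := by
  obtain ⟨w, hw⟩ := cut_star hΓ hreg hA hA' (cutF Γ A) (le_refl _) (Finset.filter_subset _ _) h4
  by_cases hwA : w ∈ A
  · left
    rw [cut_four_aux hΓ hw hwA]; simp
  · right
    rw [← cut_compl] at hw
    rw [cut_four_aux hΓ hw (Finset.mem_compl.2 hwA)]; simp

theorem inn_cut {W : Type*} [Fintype W] {Γ : SimpleGraph W}
    (hreg : ∀ u, Γ.degree u = 4) (A : Finset W) :
    2 * (innF Γ A).card + (cutF Γ A).card = 4 * A.card := by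
  have h1 : ∑ a ∈ A, ∑ e ∈ Γ.edgeFinset, (if a ∈ e then 1 else 0) = 4 * A.card := by
    have : ∀ a ∈ A, ∑ e ∈ Γ.edgeFinset, (if a ∈ e then 1 else 0) = 4 := by
      intro a _
      rw [← Finset.card_filter, ← SimpleGraph.incidenceFinset_eq_filter,
        SimpleGraph.card_incidenceFinset_eq_degree, hreg]
    rw [Finset.sum_congr rfl this, Finset.sum_const, smul_eq_mul, mul_comm]
  rw [← h1, Finset.sum_comm]
  unfold innF cutF
  rw [Finset.card_filter, Finset.card_filter, Finset.mul_sum, ← Finset.sum_add_distrib]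
  refine Finset.sum_congr rfl fun e he => ?_
  rw [SimpleGraph.mem_edgeFinset] at he
  induction e with | _ a b
  have hab : a ≠ b := SimpleGraph.Adj.ne he
  rw [← Finset.card_filter]
  have hcross : (∃ c ∈ A, ∃ d, d ∉ A ∧ s(a, b) = s(c, d)) ↔ (a ∈ A ∧ b ∉ A) ∨ (b ∈ A ∧ a ∉ A) := by
    constructor
    · rintro ⟨c, hc, d, hd, h⟩
      rcases Sym2.eq_iff.1 h with ⟨rfl, rfl⟩ | ⟨rfl, rfl⟩
      · exact Or.inl ⟨hc, hd⟩
      · exact Or.inr ⟨hc, hd⟩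
    · rintro (⟨h1, h2⟩ | ⟨h1, h2⟩)
      · exact ⟨a, h1, b, h2, rfl⟩
      · exact ⟨b, h1, a, h2, Sym2.eq_swap⟩
  rw [if_congr hcross rfl rfl]
  have hin : (∀ u ∈ s(a, b), u ∈ A) ↔ a ∈ A ∧ b ∈ A := by simp
  rw [if_congr hin rfl rfl]
  have hf : A.filter (fun u => u ∈ s(a, b)) = ({a, b} : Finset W).filter (fun u => u ∈ A) := by
    ext u; simp only [Finset.mem_filter, Sym2.mem_iff, Finset.mem_insert, Finset.mem_singleton]; tauto
  rw [hf]
  by_cases ha : a ∈ A <;> by_cases hb : b ∈ A <;>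
    simp [Finset.filter_insert, Finset.filter_singleton, ha, hb, hab]

theorem inn_le {W : Type*} [Fintype W] {Γ : SimpleGraph W} (hΓ : IsCompletedPrimitive Γ)
    (hreg : ∀ u, Γ.degree u = 4) {A : Finset W} (hA : A.Nonempty) (hA' : Aᶜ.Nonempty) :
    (innF Γ A).card + 2 ≤ 2 * A.card := by
  have := inn_cut hreg A
  have := cut_ge hΓ hreg hA hA'
  omega

theorem inn_lt {W : Type*} [Fintype W] {Γ : SimpleGraph W} (hΓ : IsCompletedPrimitive Γ)
    (hreg : ∀ u, Γ.degree u = 4) {A : Finset W} (hA : 2 ≤ A.card) (hA' : 2 ≤ Aᶜ.card) :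
    (innF Γ A).card + 3 ≤ 2 * A.card := by
  have h0 : A.Nonempty := Finset.card_pos.1 (by omega)
  have h0' : Aᶜ.Nonempty := Finset.card_pos.1 (by omega)
  have := inn_cut hreg A
  have := cut_ge hΓ hreg h0 h0'
  have h4 : (cutF Γ A).card ≠ 4 := fun h => by
    have := cut_four hΓ hreg h0 h0' h; omega
  omega


theorem card_V {W : Type*} [Fintype W] (v : W) : Fintype.card ↥{u : W | u ≠ v} + 1 = Fintype.card W := by
  have := Fintype.card_subtype_compl (fun u => u = v)
  have hpos : 0 < Fintype.card W := Fintype.card_pos_iff.2 ⟨v⟩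
  simp only [Fintype.card_subtype_eq] at this
  have h5 : Fintype.card ↥{u : W | u ≠ v} = Fintype.card W - 1 := by
    rw [← this]; exact Fintype.card_congr (Equiv.refl _)
  omega

noncomputable def partA {W K : Type*} [Fintype W] {v : W} (κ : ↥{u : W | u ≠ v} → K) (k : K) : Finset W :=
  (Finset.univ.filter fun z => κ z = k).map (Function.Embedding.subtype _)

theorem mem_partA {W K : Type*} [Fintype W] {v : W} (κ : ↥{u : W | u ≠ v} → K) (k : K)
    (z : ↥{u : W | u ≠ v}) : z.1 ∈ partA κ k ↔ κ z = k := by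
  unfold partA
  simp only [Finset.mem_map, Finset.mem_filter, Finset.mem_univ, true_and]
  constructor
  · rintro ⟨a, ha, h⟩
    rwa [← Subtype.ext h]
  · intro h; exact ⟨z, h, rfl⟩

theorem v_notMem_partA {W K : Type*} [Fintype W] {v : W} (κ : ↥{u : W | u ≠ v} → K) (k : K) :
    v ∉ partA κ k := by
  unfold partA
  simp only [Finset.mem_map, not_exists, not_and]
  intro a _ h
  exact a.2 h

theorem sum_partA {W K : Type*} [Fintype W] [Fintype K] {v : W} (κ : ↥{u : W | u ≠ v} → K) :
    ∑ k, (partA κ k).card = Fintype.card ↥{u : W | u ≠ v} := by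
  unfold partA
  simp only [Finset.card_map]
  rw [← Finset.card_univ, Finset.card_eq_sum_card_fiberwise (f := κ) (t := Finset.univ) (by simp)]

theorem card_fib_le {W K : Type*} [Fintype W] {Γ : SimpleGraph W} {v : W}
    (κ : ↥{u : W | u ≠ v} → K) (E' : Finset (delVert Γ v).edgeSet)
    (hE : ∀ e ∈ E', κ (eSrc e) = κ (eTgt e)) (k : K) :
    (E'.filter fun e => κ (eSrc e) = k).card ≤ (innF Γ (partA κ k)).card := by
  refine Finset.card_le_card_of_injOn (fun e => e.1.map Subtype.val) ?_ ?_
  · intro e he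
    obtain ⟨h1, h2⟩ := Finset.mem_filter.1 he
    refine Finset.mem_filter.2 ⟨SimpleGraph.mem_edgeFinset.2 ?_, ?_⟩
    · have := eAdj e
      dsimp only
      rw [← eMk e]
      exact this
    · dsimp only
      rw [← eMk e, Sym2.map_mk]
      intro u hu
      rcases Sym2.mem_iff.1 hu with rfl | rfl
      · exact (mem_partA κ k _).2 h2
      · exact (mem_partA κ k _).2 ((hE e h1).symm.trans h2)
  · intro e _ e' _ h
    exact Subtype.ext (Sym2.map.injective Subtype.val_injective h)

theorem part_le {W K : Type*} [Fintype W] [Fintype K] {Γ : SimpleGraph W} (hΓ : IsCompletedPrimitive Γ)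
    (hreg : ∀ u, Γ.degree u = 4) {v : W}
    (κ : ↥{u : W | u ≠ v} → K) (hκ : Function.Surjective κ) (k : K) :
    (innF Γ (partA κ k)).card + 2 ≤ 2 * (partA κ k).card := by
  refine inn_le hΓ hreg ?_ ⟨v, Finset.mem_compl.2 (v_notMem_partA κ k)⟩
  obtain ⟨z, hz⟩ := hκ k
  exact ⟨z.1, (mem_partA κ k z).2 hz⟩

theorem K1 {W K : Type*} [Fintype W] [Fintype K] {Γ : SimpleGraph W} (hΓ : IsCompletedPrimitive Γ)
    (hreg : ∀ u, Γ.degree u = 4) {v : W}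
    (κ : ↥{u : W | u ≠ v} → K) (hκ : Function.Surjective κ) (E' : Finset (delVert Γ v).edgeSet)
    (hE : ∀ e ∈ E', κ (eSrc e) = κ (eTgt e)) :
    E'.card + 2 * Fintype.card K ≤ 2 * Fintype.card ↥{u : W | u ≠ v} := by
  rw [Finset.card_eq_sum_card_fiberwise (f := fun e => κ (eSrc e)) (t := Finset.univ) (by simp),
    ← sum_partA κ, Finset.mul_sum]
  have : 2 * Fintype.card K = ∑ k : K, 2 := by simp [mul_comm]
  rw [this, ← Finset.sum_add_distrib]
  refine Finset.sum_le_sum fun k _ => ?_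
  exact (Nat.add_le_add_right (card_fib_le κ E' hE k) 2).trans (part_le hΓ hreg κ hκ k)

theorem K2 {W K : Type*} [Fintype W] [Fintype K] {Γ : SimpleGraph W} (hΓ : IsCompletedPrimitive Γ)
    (hreg : ∀ u, Γ.degree u = 4) {v : W} [Fintype (delVert Γ v).edgeSet]
    (κ : ↥{u : W | u ≠ v} → K) (hκ : Function.Surjective κ) (E' : Finset (delVert Γ v).edgeSet)
    (hE : ∀ e ∈ E', κ (eSrc e) = κ (eTgt e)) (hne : E'.Nonempty) (hnu : E' ≠ Finset.univ) :
    E'.card + 2 * Fintype.card K + 1 ≤ 2 * Fintype.card ↥{u : W | u ≠ v} := by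
  obtain ⟨e, he⟩ := hne
  set k0 := κ (eSrc e) with hk0
  by_cases hall : ∀ z, κ z = k0
  · have hK : Fintype.card K = 1 := by
      rw [Fintype.card_eq_one_iff]
      refine ⟨k0, fun k => ?_⟩
      obtain ⟨z, rfl⟩ := hκ k
      exact hall z
    have h1 := sum_deg Γ hreg v
    have h2 := card_V v
    have h3 : E'.card < Fintype.card (delVert Γ v).edgeSet := by
      rw [← Finset.card_univ]
      exact Finset.card_lt_card (Finset.ssubset_univ_iff.2 hnu)
    omega
  · push Not at hall
    obtain ⟨z, hz⟩ := hall
    have hstrict : (innF Γ (partA κ k0)).card + 3 ≤ 2 * (partA κ k0).card := by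
      refine inn_lt hΓ hreg ?_ ?_
      · have hs : ({(eSrc e).1, (eTgt e).1} : Finset W) ⊆ partA κ k0 := by
          intro u hu
          simp only [Finset.mem_insert, Finset.mem_singleton] at hu
          rcases hu with rfl | rfl
          · exact (mem_partA κ k0 _).2 rfl
          · exact (mem_partA κ k0 _).2 (hE e he).symm
        have hc := Finset.card_le_card hs
        rwa [Finset.card_pair (fun h => (eAdj e).ne (Subtype.ext h))] at hc
      · have hs : ({v, z.1} : Finset W) ⊆ (partA κ k0)ᶜ := by
          intro u hu
          simp only [Finset.mem_insert, Finset.mem_singleton] at hu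
          rw [Finset.mem_compl]
          rcases hu with rfl | rfl
          · exact v_notMem_partA κ k0
          · rw [mem_partA]; exact hz
        have hc := Finset.card_le_card hs
        rwa [Finset.card_pair (fun h => z.2 h.symm)] at hc
    rw [Finset.card_eq_sum_card_fiberwise (f := fun e => κ (eSrc e)) (t := Finset.univ) (by simp),
      ← sum_partA κ, Finset.mul_sum]
    have : 2 * Fintype.card K = ∑ k : K, 2 := by simp [mul_comm]
    rw [this, ← Finset.sum_add_distrib, Nat.succ_le_iff]
    refine Finset.sum_lt_sum (fun k _ => ?_) ⟨k0, Finset.mem_univ _, ?_⟩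
    · exact (Nat.add_le_add_right (card_fib_le κ E' hE k) 2).trans (part_le hΓ hreg κ hκ k)
    · have := card_fib_le κ E' hE k0
      omega

theorem del_connected {W : Type*} [Fintype W] {Γ : SimpleGraph W} (hΓ : IsCompletedPrimitive Γ)
    (hreg : ∀ u, Γ.degree u = 4) (v : W) : (delVert Γ v).Connected := by
  have hf : Fintype (delVert Γ v).edgeSet := Fintype.ofFinite _
  have hK : Fintype (delVert Γ v).ConnectedComponent := Fintype.ofFinite _
  have h1 := K1 hΓ hreg (fun z => (delVert Γ v).connectedComponentMk z)
    (fun c => by induction c using SimpleGraph.ConnectedComponent.ind with | _ z => exact ⟨z, rfl⟩) Finset.univ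
    (fun e _ => SimpleGraph.ConnectedComponent.sound (eAdj e).reachable)
  have h2 := sum_deg Γ hreg v
  have h3 := card_V v
  have h5 := hΓ.2.2.1
  rw [Finset.card_univ] at h1
  have h4 : Fintype.card (delVert Γ v).ConnectedComponent ≤ 1 := by omega
  have hne : Nonempty ↥{u : W | u ≠ v} := Fintype.card_pos_iff.1 (by omega)
  rw [SimpleGraph.connected_iff]
  refine ⟨fun x y => ?_, hne⟩
  exact SimpleGraph.ConnectedComponent.exact (Fintype.card_le_one_iff.1 h4 _ _)

theorem card_comp {V : Type*} [Fintype V] {G : SimpleGraph V} (F : Finset G.edgeSet)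
    [Fintype (subG F).ConnectedComponent] :
    Fintype.card V ≤ F.card + Fintype.card (subG F).ConnectedComponent := by
  rcases isEmpty_or_nonempty V with hV | ⟨⟨x0⟩⟩
  · simp
  have hout : ∀ c : (subG F).ConnectedComponent, ∃ z, (subG F).connectedComponentMk z = c := by
    intro c; induction c using SimpleGraph.ConnectedComponent.ind with | _ z => exact ⟨z, rfl⟩
  choose rep hrep using hout
  set c0 := (subG F).connectedComponentMk x0 with hc0
  set S : Finset (Sym2 V) := (Finset.univ.erase c0).image fun k => s(rep c0, rep k) with hS
  set H : SimpleGraph V := SimpleGraph.fromEdgeSet ((F.image Subtype.val ∪ S : Finset (Sym2 V)) : Set (Sym2 V)) with hH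
  have hle : subG F ≤ H := by
    intro x y hxy
    have hne := hxy.ne
    obtain ⟨e, he, h⟩ := subG_adj.1 hxy
    rw [hH, SimpleGraph.fromEdgeSet_adj]
    refine ⟨?_, hne⟩
    rw [Finset.mem_coe, Finset.mem_union]
    exact Or.inl (Finset.mem_image.2 ⟨e, he, h⟩)
  have hr : ∀ k, H.Reachable (rep c0) (rep k) := by
    intro k
    by_cases hk : k = c0
    · rw [hk]
    · refine SimpleGraph.Adj.reachable ?_
      rw [hH, SimpleGraph.fromEdgeSet_adj]
      refine ⟨?_, fun h => hk ?_⟩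
      · rw [Finset.mem_coe, Finset.mem_union]
        exact Or.inr (Finset.mem_image.2 ⟨k, Finset.mem_erase.2 ⟨hk, Finset.mem_univ _⟩, rfl⟩)
      · rw [← hrep k, ← h, hrep]
  have hr2 : ∀ x, H.Reachable (rep c0) x := by
    intro x
    refine (hr ((subG F).connectedComponentMk x)).trans ?_
    exact (SimpleGraph.ConnectedComponent.exact (hrep _)).mono hle
  have hconn : H.Connected := by
    rw [SimpleGraph.connected_iff]
    exact ⟨fun x y => (hr2 x).symm.trans (hr2 y), ⟨x0⟩⟩
  have h1 := hconn.card_vert_le_card_edgeSet_add_one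
  have h2 : Nat.card H.edgeSet ≤ (F.image Subtype.val ∪ S).card := by
    have : H.edgeSet ⊆ ((F.image Subtype.val ∪ S : Finset (Sym2 V)) : Set (Sym2 V)) := by
      rw [hH, SimpleGraph.edgeSet_fromEdgeSet]
      exact Set.sdiff_subset
    have := Nat.card_mono (Finset.finite_toSet _) this
    simpa using this
  have h3 : S.card ≤ Fintype.card (subG F).ConnectedComponent - 1 := by
    refine Finset.card_image_le.trans ?_
    rw [Finset.card_erase_of_mem (Finset.mem_univ _), Finset.card_univ]
  have h4 : (F.image Subtype.val).card ≤ F.card := Finset.card_image_le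
  have h5 := Finset.card_union_le (F.image Subtype.val) S
  have h6 : 0 < Fintype.card (subG F).ConnectedComponent := Fintype.card_pos_iff.2 ⟨c0⟩
  rw [Nat.card_eq_fintype_card] at h1
  omega


theorem exch {V : Type*} [Fintype V] {G : SimpleGraph V} [Fintype G.edgeSet] (y : G.edgeSet → ℝ)
    (T : Finset G.edgeSet) (hT : (subG T).IsTree)
    (hmax : ∀ T' : Finset G.edgeSet, (subG T').IsTree → ∑ e ∈ T', y e ≤ ∑ e ∈ T, y e)
    (t : ℝ) (e : G.edgeSet) (he : t ≤ y e) :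
    (subG (T.filter fun g => t ≤ y g)).Reachable (eSrc e) (eTgt e) := by
  by_contra hnr
  set F := T.filter fun g => t ≤ y g with hF
  have heT : e ∉ T := fun h => hnr (subG_adj_of_mem (Finset.mem_filter.2 ⟨h, he⟩)).reachable
  have hsub : ∀ {S S' : Finset G.edgeSet}, S ⊆ S' → subG S ≤ subG S' := by
    intro S S' h x z hxz
    obtain ⟨g, hg, hh⟩ := subG_adj.1 hxz
    exact subG_adj.2 ⟨g, h hg, hh⟩
  have hFac : (subG F).IsAcyclic := hT.isAcyclic.anti (hsub (Finset.filter_subset _ _))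
  have hac := hFac.sup_edge_of_not_reachable hnr
  have hins : ∀ S : Finset G.edgeSet, subG S ⊔ SimpleGraph.edge (eSrc e) (eTgt e) = subG (insert e S) := by
    intro S
    ext x z
    rw [SimpleGraph.sup_adj, SimpleGraph.edge_adj, subG_adj, subG_adj]
    constructor
    · rintro (⟨g, hg, h⟩ | ⟨h, -⟩)
      · exact ⟨g, Finset.mem_insert_of_mem hg, h⟩
      · refine ⟨e, Finset.mem_insert_self _ _, ?_⟩
        rw [← eMk e, Sym2.eq_iff]
        tauto
    · rintro ⟨g, hg, h⟩
      rcases Finset.mem_insert.1 hg with rfl | hg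
      · right
        refine ⟨?_, ?_⟩
        · rw [← eMk g, Sym2.eq_iff] at h
          tauto
        · have h2 : G.Adj x z := by rw [← SimpleGraph.mem_edgeSet, ← h]; exact g.2
          exact h2.ne
      · exact Or.inl ⟨g, hg, h⟩
  rw [hins] at hac
  have hconn : (subG (insert e T)).Connected := hT.connected.mono (hsub (Finset.subset_insert _ _))
  obtain ⟨H, hH1, hH2, hH3⟩ := hconn.exists_isTree_le_of_le_of_isAcyclic
    (hsub (Finset.insert_subset_insert e (Finset.filter_subset _ _))) hac
  set T' : Finset G.edgeSet := Finset.univ.filter fun g => g.1 ∈ H.edgeSet with hT'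
  have hHT : subG T' = H := by
    ext x z
    rw [subG_adj]
    constructor
    · rintro ⟨g, hg, h⟩
      have := (Finset.mem_filter.1 hg).2
      rw [h] at this
      exact this
    · intro h
      obtain ⟨g, hg, hh⟩ := subG_adj.1 (hH2 h)
      refine ⟨g, Finset.mem_filter.2 ⟨Finset.mem_univ _, ?_⟩, hh⟩
      rw [hh]; exact h
  have hT'tree : (subG T').IsTree := hHT ▸ hH3
  have hc1 := ((subG_isTree T).1 hT).2
  have hc2 := ((subG_isTree T').1 hT'tree).2
  have hT'sub : T' ⊆ insert e T := by
    intro g hg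
    have h1 := (Finset.mem_filter.1 hg).2
    have h2 : g.1 ∈ (subG (insert e T)).edgeSet := SimpleGraph.edgeSet_mono hH2 h1
    rw [subG_edgeSet] at h2
    obtain ⟨g', hg', h⟩ := h2
    rwa [← Subtype.ext h]
  have hFsub : insert e F ⊆ T' := by
    intro g hg
    refine Finset.mem_filter.2 ⟨Finset.mem_univ _, SimpleGraph.edgeSet_mono hH1 ?_⟩
    rw [subG_edgeSet]
    exact ⟨g, hg, rfl⟩
  have hcard : (insert e T \ T').card = 1 := by
    rw [Finset.card_sdiff_of_subset hT'sub, Finset.card_insert_of_notMem heT]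
    omega
  obtain ⟨g, hg⟩ := Finset.card_eq_one.1 hcard
  have hgm : g ∈ insert e T \ T' := hg ▸ Finset.mem_singleton_self g
  rw [Finset.mem_sdiff] at hgm
  have hgT : g ∈ T := by
    rcases Finset.mem_insert.1 hgm.1 with h | h
    · exact absurd (hFsub (h ▸ Finset.mem_insert_self _ _)) hgm.2
    · exact h
  have hgt : y g < t := by
    by_contra hcon
    push Not at hcon
    exact hgm.2 (hFsub (Finset.mem_insert_of_mem (Finset.mem_filter.2 ⟨hgT, hcon⟩)))
  have hs := Finset.sum_sdiff (f := y) hT'sub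
  rw [hg, Finset.sum_singleton, Finset.sum_insert heT] at hs
  have := hmax T' hT'tree
  linarith

theorem level {W : Type*} [Fintype W] {Γ : SimpleGraph W} (hΓ : IsCompletedPrimitive Γ)
    (hreg : ∀ u, Γ.degree u = 4) {v : W} [Fintype (delVert Γ v).edgeSet]
    (y : (delVert Γ v).edgeSet → ℝ)
    (T : Finset (delVert Γ v).edgeSet) (hT : (subG T).IsTree)
    (hmax : ∀ T' : Finset (delVert Γ v).edgeSet, (subG T').IsTree → ∑ e ∈ T', y e ≤ ∑ e ∈ T, y e)
    (t : ℝ) (h1 : ∃ e, t ≤ y e) (h2 : ∃ e, y e < t) :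
    (Finset.univ.filter fun g => t ≤ y g).card + 1 ≤ 2 * (T.filter fun g => t ≤ y g).card := by
  have hK : Fintype (subG (T.filter fun g => t ≤ y g)).ConnectedComponent := Fintype.ofFinite _
  have h3 := K2 hΓ hreg (fun z => (subG (T.filter fun g => t ≤ y g)).connectedComponentMk z)
    (fun c => by induction c using SimpleGraph.ConnectedComponent.ind with | _ z => exact ⟨z, rfl⟩)
    (Finset.univ.filter fun g => t ≤ y g)
    (fun e he => SimpleGraph.ConnectedComponent.sound
      (exch y T hT hmax t e (Finset.mem_filter.1 he).2))
    (by obtain ⟨e, he⟩ := h1; exact ⟨e, by simpa using he⟩)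
    (by
      obtain ⟨e, he⟩ := h2
      intro h
      have : e ∈ (Finset.univ.filter fun g => t ≤ y g) := by rw [h]; exact Finset.mem_univ e
      exact absurd (Finset.mem_filter.1 this).2 (not_le.2 he))
  have h4 := card_comp (T.filter fun g => t ≤ y g)
  omega

theorem ind_int {m M y : ℝ} (h1 : m ≤ y) (h2 : y ≤ M) :
    ∫ t in m..M, (if t ≤ y then (1:ℝ) else 0) = y - m := by
  have := intervalIntegral.integral_indicator (μ := MeasureTheory.volume) (f := fun _ => (1:ℝ)) (⟨h1, h2⟩ : y ∈ Set.Icc m M)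
  rw [intervalIntegral.integral_const, smul_eq_mul, mul_one] at this
  rw [← this]
  refine intervalIntegral.integral_congr fun t _ => ?_
  simp [Set.indicator]

theorem ind_ii (m M y : ℝ) :
    IntervalIntegrable (fun t => if t ≤ y then (1:ℝ) else 0) MeasureTheory.volume m M := by
  have hanti : Antitone (fun t => if t ≤ y then (1:ℝ) else 0) := by
    intro a b hab
    dsimp only
    split_ifs with h1 h2
    · exact le_rfl
    · exact absurd (hab.trans h1) h2
    · exact zero_le_one
    · exact le_rfl
  exact hanti.intervalIntegrable

theorem layer {W : Type*} [Fintype W] {Γ : SimpleGraph W} (hΓ : IsCompletedPrimitive Γ)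
    (hreg : ∀ u, Γ.degree u = 4) {v : W} [Fintype (delVert Γ v).edgeSet]
    (y : (delVert Γ v).edgeSet → ℝ)
    (T : Finset (delVert Γ v).edgeSet) (hT : (subG T).IsTree)
    (hmax : ∀ T' : Finset (delVert Γ v).edgeSet, (subG T').IsTree → ∑ e ∈ T', y e ≤ ∑ e ∈ T, y e)
    (a b : (delVert Γ v).edgeSet) (ha : ∀ e, y a ≤ y e) (hb : ∀ e, y e ≤ y b) :
    y b - y a + ∑ e, y e ≤ 2 * ∑ e ∈ T, y e := by
  have hI : ∀ S : Finset (delVert Γ v).edgeSet,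
      ∫ t in (y a)..(y b), ∑ e ∈ S, (if t ≤ y e then (1:ℝ) else 0) = ∑ e ∈ S, (y e - y a) := by
    intro S
    rw [intervalIntegral.integral_finsetSum (fun e _ => ind_ii _ _ _)]
    exact Finset.sum_congr rfl fun e _ => ind_int (ha e) (hb e)
  have hii : ∀ S : Finset (delVert Γ v).edgeSet, IntervalIntegrable
      (fun t => ∑ e ∈ S, (if t ≤ y e then (1:ℝ) else 0)) MeasureTheory.volume (y a) (y b) := by
    intro S
    have := IntervalIntegrable.sum (μ := MeasureTheory.volume) (a := y a) (b := y b) S (f := fun e t => if t ≤ y e then (1:ℝ) else 0) (fun e _ => ind_ii _ _ _)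
    have h2 : (∑ e ∈ S, fun t => if t ≤ y e then (1:ℝ) else 0) =
        fun t => ∑ e ∈ S, (if t ≤ y e then (1:ℝ) else 0) := by
      ext t; simp
    rw [← h2]
    exact this
  have hle : ∫ t in (y a)..(y b), ((1:ℝ) + ∑ e, (if t ≤ y e then (1:ℝ) else 0)) ≤
      ∫ t in (y a)..(y b), 2 * ∑ e ∈ T, (if t ≤ y e then (1:ℝ) else 0) := by
    refine intervalIntegral.integral_mono_on_of_le_Ioo (ha b) ?_ ?_ ?_
    · exact (intervalIntegrable_const).add (hii Finset.univ)
    · exact (hii T).const_mul 2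
    · intro t ht
      have := level hΓ hreg y T hT hmax t ⟨b, ht.2.le⟩ ⟨a, ht.1⟩
      rw [Finset.sum_boole, Finset.sum_boole]
      have h' : (((Finset.univ.filter fun g => t ≤ y g).card + 1 : ℕ) : ℝ) ≤ ((2 * (T.filter fun g => t ≤ y g).card : ℕ) : ℝ) := by
        exact_mod_cast this
      push_cast at h'
      linarith
  rw [intervalIntegral.integral_add intervalIntegrable_const (hii _), intervalIntegral.integral_const_mul,
    hI, hI, intervalIntegral.integral_const, Finset.sum_sub_distrib, Finset.sum_sub_distrib,
    Finset.sum_const, Finset.sum_const, Finset.card_univ] at hle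
  have hc : Fintype.card (delVert Γ v).edgeSet = 2 * T.card := by
    have h1 := sum_deg Γ hreg v
    have h2 := card_V v
    have h3 := ((subG_isTree T).1 hT).2
    omega
  rw [hc] at hle
  simp only [smul_eq_mul, mul_one, nsmul_eq_mul] at hle
  push_cast at hle
  linarith

theorem tree_bound {W : Type*} [Fintype W] {Γ : SimpleGraph W} (hΓ : IsCompletedPrimitive Γ)
    (hreg : ∀ u, Γ.degree u = 4) {v : W} [Fintype (delVert Γ v).edgeSet]
    (y : (delVert Γ v).edgeSet → ℝ) (e₀ : (delVert Γ v).edgeSet) (h0 : y e₀ = 0) :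
    ∃ T : Finset (delVert Γ v).edgeSet, (subG T).IsTree ∧
      ∑ e, y e + (∑ e, |y e|) / (Fintype.card (delVert Γ v).edgeSet) ≤ 2 * ∑ e ∈ T, y e := by
  obtain ⟨T0, hT0⟩ := exists_tree (del_connected hΓ hreg v)
  obtain ⟨T, hT, hmax⟩ := Finset.exists_max_image
    (Finset.univ.filter fun T : Finset (delVert Γ v).edgeSet => (subG T).IsTree)
    (fun T => ∑ e ∈ T, y e) ⟨T0, by simpa using hT0⟩
  have hT := (Finset.mem_filter.1 hT).2
  refine ⟨T, hT, ?_⟩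
  obtain ⟨a, -, ha⟩ := Finset.exists_min_image Finset.univ y ⟨e₀, Finset.mem_univ _⟩
  obtain ⟨b, -, hb⟩ := Finset.exists_max_image Finset.univ y ⟨e₀, Finset.mem_univ _⟩
  have ha : ∀ e, y a ≤ y e := fun e => ha e (Finset.mem_univ e)
  have hb : ∀ e, y e ≤ y b := fun e => hb e (Finset.mem_univ e)
  have := layer hΓ hreg y T hT (fun T' h => hmax T' (by simpa using h)) a b ha hb
  have hN : 0 < (Fintype.card (delVert Γ v).edgeSet : ℝ) := by
    exact_mod_cast Fintype.card_pos_iff.2 ⟨e₀⟩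
  have h2 : (∑ e, |y e|) / (Fintype.card (delVert Γ v).edgeSet) ≤ y b - y a := by
    rw [div_le_iff₀ hN]
    calc ∑ e, |y e| ≤ ∑ _e : (delVert Γ v).edgeSet, (y b - y a) := by
          refine Finset.sum_le_sum fun e _ => ?_
          have h1 := ha e
          have h2 := hb e
          have h3 := ha e₀
          have h4 := hb e₀
          rw [abs_le]
          constructor <;> linarith
      _ = _ := by rw [Finset.sum_const, Finset.card_univ, nsmul_eq_mul, mul_comm]
  linarith


open MeasureTheory in
theorem fin1 {ε : ℝ} (hε : 0 < ε) :
    ∫⁻ x in Set.Ioi (0:ℝ), ENNReal.ofReal (Real.exp (-Real.log x - |-Real.log x| * ε)) < ⊤ := by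
  have h1 : IntegrableOn (fun x : ℝ => Real.exp (-Real.log x - |-Real.log x| * ε)) (Set.Ioc 0 1) := by
    have h := (intervalIntegral.intervalIntegrable_rpow' (a := 0) (b := 1) (r := ε - 1) (by linarith)).1
    refine h.congr_fun (fun x hx => ?_) measurableSet_Ioc
    have hx0 : 0 < x := hx.1
    have hl : Real.log x ≤ 0 := Real.log_nonpos hx0.le hx.2
    dsimp only
    rw [Real.rpow_def_of_pos hx0, abs_of_nonneg (by linarith)]
    congr 1; ring
  have h2 : IntegrableOn (fun x : ℝ => Real.exp (-Real.log x - |-Real.log x| * ε)) (Set.Ioi 1) := by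
    have h := integrableOn_Ioi_rpow_of_lt (a := -1 - ε) (by linarith) (c := 1) one_pos
    refine h.congr_fun (fun x hx => ?_) measurableSet_Ioi
    have hx1 : 1 < x := hx
    have hx0 : 0 < x := by linarith
    have hl : 0 ≤ Real.log x := Real.log_nonneg hx1.le
    dsimp only
    rw [Real.rpow_def_of_pos hx0, abs_of_nonpos (by linarith)]
    congr 1; ring
  have h3 := h1.union h2
  rw [Set.Ioc_union_Ioi_eq_Ioi zero_le_one] at h3
  have h4 := h3.2
  rw [hasFiniteIntegral_iff_ofReal (Filter.Eventually.of_forall fun x => (Real.exp_pos _).le)] at h4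
  exact h4

open MeasureTheory in
theorem pL_lt_top_gen {V : Type*} [Fintype V] {G : SimpleGraph V} [Fintype G.edgeSet]
    (hc : G.Connected) (e₀ : G.edgeSet)
    (htb : ∀ y : G.edgeSet → ℝ, y e₀ = 0 → ∃ T : Finset G.edgeSet, (subG T).IsTree ∧
      ∑ e, y e + (∑ e, |y e|) / (Fintype.card G.edgeSet) ≤ 2 * ∑ e ∈ T, y e) :
    pL G e₀ < ⊤ := by
  set N : ℝ := ((Fintype.card G.edgeSet : ℕ) : ℝ) with hNdef
  have hN : 0 < N := by
    rw [hNdef]; exact_mod_cast Fintype.card_pos_iff.2 ⟨e₀⟩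
  have hmeasS : MeasurableSet (Set.univ.pi fun _ : {e : G.edgeSet // e ≠ e₀} => Set.Ioi (0 : ℝ)) :=
    MeasurableSet.univ_pi fun _ => measurableSet_Ioi
  have hb : pL G e₀ ≤
      ∫⁻ x in (Set.univ.pi fun _ : {e : G.edgeSet // e ≠ e₀} => Set.Ioi (0 : ℝ)),
        ∏ e, ENNReal.ofReal (Real.exp (-Real.log (x e) - |-Real.log (x e)| * N⁻¹)) := by
    unfold pL
    refine setLIntegral_mono' hmeasS fun x hx => ?_
    have hx' : ∀ e, 0 < x e := fun e => hx e (Set.mem_univ e)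
    have hX := extX_pos e₀ hx'
    have hψ := psi_pos hc _ hX
    rw [← ENNReal.ofReal_prod_of_nonneg (fun _ _ => (Real.exp_pos _).le), ← Real.exp_sum]
    refine ENNReal.ofReal_le_ofReal ?_
    set y : G.edgeSet → ℝ := fun e => -Real.log (extX e₀ x e) with hy
    have hy0 : y e₀ = 0 := by simp [hy, extX_self]
    obtain ⟨T, hT, hle⟩ := htb y hy0
    have hge := psi_ge _ hX T hT
    have hprod : ∏ e ∈ Tᶜ, extX e₀ x e = Real.exp (∑ e ∈ T, y e - ∑ e, y e) := by
      rw [← Finset.sum_add_sum_compl T y, sub_add_cancel_left, ← Finset.sum_neg_distrib, Real.exp_sum]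
      refine Finset.prod_congr rfl fun e _ => ?_
      simp only [hy, neg_neg]
      rw [Real.exp_log (hX e)]
    rw [hprod] at hge
    have hsum : ∑ e : {e : G.edgeSet // e ≠ e₀}, (-Real.log (x e) - |-Real.log (x e)| * N⁻¹) =
        ∑ e, y e - (∑ e, |y e|) / N := by
      have h1 : ∑ e, y e - (∑ e, |y e|) / N = ∑ e, (y e - |y e| * N⁻¹) := by
        rw [Finset.sum_sub_distrib, div_eq_mul_inv, Finset.sum_mul]
      rw [h1, Fintype.sum_eq_add_sum_subtype_ne _ e₀, hy0, abs_zero, zero_mul, sub_zero, zero_add]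
      refine Finset.sum_congr rfl fun e _ => ?_
      simp only [hy, extX_sub]
    rw [hsum, one_div]
    refine inv_le_of_inv_le₀ (Real.exp_pos _) ?_
    rw [← Real.exp_neg]
    calc Real.exp (-(∑ e, y e - (∑ e, |y e|) / N)) ≤ Real.exp (∑ e ∈ T, y e - ∑ e, y e) ^ 2 := by
          rw [← Real.exp_nat_mul]
          refine Real.exp_le_exp.2 ?_
          push_cast
          linarith
      _ ≤ _ := pow_le_pow_left₀ (Real.exp_pos _).le hge 2
  refine lt_of_le_of_lt hb ?_
  have hr : (volume : Measure ({e : G.edgeSet // e ≠ e₀} → ℝ)).restrict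
      (Set.univ.pi fun _ => Set.Ioi (0 : ℝ)) = Measure.pi fun _ => volume.restrict (Set.Ioi 0) :=
    Measure.restrict_pi_pi _ _
  rw [hr]
  have := lintegral_fintype_prod' (fun _ : {e : G.edgeSet // e ≠ e₀} => (volume : Measure ℝ).restrict (Set.Ioi 0))
    (fun _ t => ENNReal.ofReal (Real.exp (-Real.log t - |-Real.log t| * N⁻¹))) (fun e => by
      have := Real.measurable_log
      fun_prop)
  rw [this]
  exact ENNReal.prod_lt_top fun e _ => fin1 (inv_pos.2 hN)

theorem pL_lt_top {W : Type*} [Fintype W] {Γ : SimpleGraph W} (hΓ : IsCompletedPrimitive Γ)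
    (hreg : ∀ u, Γ.degree u = 4) {v : W} [Fintype (delVert Γ v).edgeSet]
    (e₀ : (delVert Γ v).edgeSet) : pL (delVert Γ v) e₀ < ⊤ := by
  exact pL_lt_top_gen (del_connected hΓ hreg v) e₀ fun y h0 => tree_bound hΓ hreg y e₀ h0

theorem psi_meas {V : Type*} {G : SimpleGraph V} [Fintype G.edgeSet] (e₀ : G.edgeSet) :
    Measurable fun x => psi G (extX e₀ x) := by
  unfold psi
  refine Finset.measurable_sum _ fun T _ => ?_
  split_ifs
  · exact Finset.measurable_prod _ fun e _ => extX_meas e₀ e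
  · exact measurable_const

open MeasureTheory in
theorem period_eq {V : Type*} [Fintype V] {G : SimpleGraph V} (e₀ : G.edgeSet) :
    letI : Fintype G.edgeSet := Fintype.ofFinite _
    graphPeriod G e₀ = (pL G e₀).toReal := by
  letI : Fintype G.edgeSet := Fintype.ofFinite _
  unfold graphPeriod pL
  rw [integral_eq_lintegral_of_nonneg_ae]
  · congr 1
    refine lintegral_congr fun x => ?_
    rw [aeval_graphPoly]
    rfl
  · exact Filter.Eventually.of_forall fun x => by positivity
  · apply Measurable.aestronglyMeasurable
    simp_rw [aeval_graphPoly]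
    exact ((psi_meas e₀).pow_const 2).const_div 1

open MeasureTheory in
theorem period_int {V : Type*} [Fintype V] {G : SimpleGraph V} (e₀ : G.edgeSet) :
    letI : Fintype G.edgeSet := Fintype.ofFinite _
    pL G e₀ < ⊤ → PeriodIntegrable G e₀ := by
  letI : Fintype G.edgeSet := Fintype.ofFinite _
  intro h
  unfold PeriodIntegrable IntegrableOn
  refine ⟨?_, ?_⟩
  · apply Measurable.aestronglyMeasurable
    simp_rw [aeval_graphPoly]
    exact ((psi_meas e₀).pow_const 2).const_div 1
  · rw [hasFiniteIntegral_iff_ofReal (Filter.Eventually.of_forall fun x => by positivity)]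
    simp_rw [aeval_graphPoly]
    exact h

open MeasureTheory in
theorem pL_pos {V : Type*} [Fintype V] {G : SimpleGraph V} [Fintype G.edgeSet] (hG : G.Connected)
    (e₀ : G.edgeSet) : pL G e₀ ≠ 0 := by
  have hmeasS : MeasurableSet (Set.univ.pi fun _ : {e : G.edgeSet // e ≠ e₀} => Set.Ioi (0 : ℝ)) :=
    MeasurableSet.univ_pi fun _ => measurableSet_Ioi
  unfold pL
  have hm : Measurable fun x => ENNReal.ofReal (1 / psi G (extX e₀ x) ^ 2) :=
    (((psi_meas e₀).pow_const 2).const_div 1).ennreal_ofReal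
  intro h0
  rw [lintegral_eq_zero_iff hm, Filter.EventuallyEq, ae_restrict_iff' hmeasS] at h0
  have h1 : (volume : Measure ({e : G.edgeSet // e ≠ e₀} → ℝ)) (Set.univ.pi fun _ => Set.Ioi (0 : ℝ)) = 0 := by
    refine measure_mono_null ?_ (ae_iff.1 h0)
    intro x hx
    have hx' : ∀ e, 0 < x e := fun e => hx e (Set.mem_univ e)
    have hψ := psi_pos hG _ (extX_pos e₀ hx')
    simp only [Set.mem_ofPred_eq, Classical.not_imp]
    refine ⟨hx, ?_⟩
    simp only [Pi.zero_apply, ENNReal.ofReal_eq_zero, not_le]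
    positivity
  rw [volume_pi_pi] at h1
  simp at h1


theorem stmt3 {W : Type*} [Fintype W] (Γ : SimpleGraph W)
    (hΓ : IsCompletedPrimitive Γ) (v w : W) :
    (∀ e₀ : (delVert Γ v).edgeSet, PeriodIntegrable (delVert Γ v) e₀) ∧
    (∀ e₀ : (delVert Γ v).edgeSet, 0 < graphPeriod (delVert Γ v) e₀) ∧
    (∀ e₀ e₁ : (delVert Γ v).edgeSet,
      graphPeriod (delVert Γ v) e₀ = graphPeriod (delVert Γ v) e₁) ∧
    (∀ (e₀ : (delVert Γ v).edgeSet) (e₁ : (delVert Γ w).edgeSet),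
      graphPeriod (delVert Γ v) e₀ = graphPeriod (delVert Γ w) e₁) := by
  have hreg : ∀ u, Γ.degree u = 4 := by
    intro u
    rw [← hΓ.2.1 u, Nat.card_eq_fintype_card, SimpleGraph.card_neighborSet_eq_degree]
  have hc := del_connected hΓ hreg
  have hne : ∀ (a b : W), a ≠ b → ∀ (e₀ : (delVert Γ a).edgeSet) (e₁ : (delVert Γ b).edgeSet),
      graphPeriod (delVert Γ a) e₀ = graphPeriod (delVert Γ b) e₁ := by
    intro a b hab e₀ e₁
    letI : Fintype (delVert Γ a).edgeSet := Fintype.ofFinite _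
    letI : Fintype (delVert Γ b).edgeSet := Fintype.ofFinite _
    rw [period_eq, period_eq, pL_eq Γ hreg hab (hc a) (hc b) e₀ e₁]
  have hsame : ∀ (a : W) (e₀ e₁ : (delVert Γ a).edgeSet),
      graphPeriod (delVert Γ a) e₀ = graphPeriod (delVert Γ a) e₁ := by
    intro a e₀ e₁
    have h5 := hΓ.2.2.1
    obtain ⟨b, hb⟩ := Fintype.exists_ne_of_one_lt_card (by omega) a
    letI : Fintype (delVert Γ b).edgeSet := Fintype.ofFinite _
    have hcard := sum_deg Γ hreg b
    obtain ⟨e⟩ : Nonempty (delVert Γ b).edgeSet := Fintype.card_pos_iff.1 (by omega)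
    rw [hne a b hb.symm e₀ e, hne a b hb.symm e₁ e]
  refine ⟨fun e₀ => ?_, fun e₀ => ?_, hsame v, ?_⟩
  · letI : Fintype (delVert Γ v).edgeSet := Fintype.ofFinite _
    exact period_int e₀ (pL_lt_top hΓ hreg e₀)
  · letI : Fintype (delVert Γ v).edgeSet := Fintype.ofFinite _
    rw [period_eq]
    exact ENNReal.toReal_pos (pL_pos (hc v) e₀) (pL_lt_top hΓ hreg e₀).ne
  · by_cases hvw : v = w
    · subst hvw
      exact hsame v
    · exact hne v w hvw
end
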